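/- Every n-quasigroup of order 4 is permutably reducible or semilinear. -/

import Mathlib

/-- An `n`-ary quasigroup: uniquely invertible in each place. -/
def IsNQuasigroup {n : ℕ} {S : Type*} (f : (Fin n → S) → S) : Prop :=
  ∀ (i : Fin n) (x : Fin n → S), Function.Bijective fun a => f (Function.update x i a)

/-- Permutable reducibility (Definition 1.4). -/
def PermutablyReducible {n : ℕ} {S : Type*} (f : (Fin n → S) → S) : Prop :=
  ∃ (m : ℕ) (_ : 2 ≤ m) (_ : m ≤ n - 1)
    (σ : Equiv.Perm (Fin n))
    (g : (Fin m → S) → S)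
    (h : (Fin (n - m + 1) → S) → S),
    IsNQuasigroup g ∧ IsNQuasigroup h ∧
    ∀ x : Fin n → S,
      f x = h (Fin.cons (g fun k : Fin m => x (σ ⟨k.val, by have := k.isLt; omega⟩))
                 fun j : Fin (n - m) => x (σ ⟨m + j.val, by have := j.isLt; omega⟩))

/-- `l(0)=l(1)=0`, `l(2)=l(3)=1`. -/
def lmap : Fin 4 → ZMod 2 := ![0, 0, 1, 1]

/-- Standardly semilinear: the predicate of `f` is pointwise `≤ L`. -/
def StdSemilinear {n : ℕ} (f : (Fin n → Fin 4) → Fin 4) : Prop :=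
  ∀ x : Fin n → Fin 4, lmap (f x) = ∑ i, lmap (x i)

def Semilinear {n : ℕ} (f : (Fin n → Fin 4) → Fin 4) : Prop :=
  ∃ (g : (Fin n → Fin 4) → Fin 4) (τ₀ : Equiv.Perm (Fin 4)) (τ : Fin n → Equiv.Perm (Fin 4)),
    IsNQuasigroup g ∧ StdSemilinear g ∧ ∀ x, τ₀ (f x) = g fun i => τ i (x i)

noncomputable def PrincipalRetract {n k : ℕ} {S : Type*} (f : (Fin n → S) → S) (ι : Fin k → Fin n)
    (c : Fin n → S) : (Fin k → S) → S :=
  fun y => f (Function.extend ι y c)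

def IsBinaryQG {S : Type*} (h : S → S → S) : Prop :=
  (∀ a, Function.Bijective (h a)) ∧ ∀ b, Function.Bijective fun a => h a b

def CondA {n : ℕ} {C : Type*} (μ : Fin n → Fin n → C) : Prop :=
  ∀ a b c : Fin n, a ≠ b → a ≠ c → b ≠ c →
    μ a b = μ a c ∨ μ a b = μ b c ∨ μ a c = μ b c

def CondB {n : ℕ} {C : Type*} [DecidableEq C] (μ : Fin n → Fin n → C) : Prop :=
  ∀ a b c d : Fin n, a ≠ b → a ≠ c → a ≠ d → b ≠ c → b ≠ d → c ≠ d →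
    (∃ c₁ c₂ : C, c₁ ≠ c₂ ∧
      [μ a b, μ a c, μ a d, μ b c, μ b d, μ c d].count c₁ = 3 ∧
      [μ a b, μ a c, μ a d, μ b c, μ b d, μ c d].count c₂ = 3) →
    ((μ a b = μ a c ∧ μ a c = μ b c) ∨ (μ a b = μ a d ∧ μ a d = μ b d) ∨
     (μ a c = μ a d ∧ μ a d = μ c d) ∨ (μ b c = μ b d ∧ μ b d = μ c d))

def colorOf {n : ℕ} (f : (Fin n → Fin 4) → Fin 4) (i j : Fin n) : Fin 4 → Fin 4 → Fin 4 :=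
  fun a b => f fun t => if t = i then a else if t = j then b else 0

def Normalized {n : ℕ} (f : (Fin n → Fin 4) → Fin 4) : Prop :=
  ∀ (i : Fin n) (a : Fin 4), f (fun t => if t = i then a else 0) = a

def piPerm : Fin 4 → Fin 4 := ![1, 0, 3, 2]

namespace OrderFour

open Function

set_option linter.unusedSectionVars false

/-- The alphabet, with the group structure of the Klein four-group. -/
abbrev V := ZMod 2 × ZMod 2

theorem V.add_self (a : V) : a + a = 0 := by revert a; decide

theorem V.add_add_cancel (a b : V) : a + b + b = a := by
  rw [add_assoc, V.add_self, add_zero]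

theorem V.eq_add_iff {a b c : V} : a = b + c ↔ a + c = b := by
  revert a b c; decide

set_option synthInstance.maxSize 1000 in
theorem V.cases_of_ne : ∀ π π' δ : V, π ≠ 0 → π' ≠ 0 → π ≠ π' →
    δ = 0 ∨ δ = π ∨ δ = π' ∨ δ = π + π' := by decide

section Basic

variable {ι : Type*} [DecidableEq ι]

/-- A distance-2 MDS code: every line contains exactly one element of `M`. -/
def IsCode (M : Set (ι → V)) : Prop := ∀ x i, ∃! a, update x i a ∈ M

/-- `y` lies in the face through `x` spanned by the directions in `J`. -/
def InFace (J : Finset ι) (x y : ι → V) : Prop := ∀ i, i ∉ J → y i = x i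

/-- Translation by `v` maps the part of `M` in the face `(J, x)` into `M`. -/
def Stab (M : Set (ι → V)) (J : Finset ι) (x v : ι → V) : Prop :=
  ∀ y, InFace J x y → y ∈ M → y + v ∈ M

/-- The face `(J, x)` of `M` is decomposed by `A` and its complement. -/
def Split (M : Set (ι → V)) (J : Finset ι) (x : ι → V) (A : Finset ι) : Prop :=
  ∀ p q, InFace J x p → InFace J x q → p ∈ M → A.piecewise q p ∈ M → A.piecewise p q ∈ M → q ∈ M

/-- The face `(J, x)` of `M` is reducible. -/
def Red (M : Set (ι → V)) (J : Finset ι) (x : ι → V) : Prop :=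
  ∃ A ⊆ J, 2 ≤ A.card ∧ 2 ≤ (J \ A).card ∧ Split M J x A

/-- The vector with entries `π` at `i` and `ρ` at `j`. -/
def lk (i : ι) (π : V) (j : ι) (ρ : V) : ι → V :=
  fun k => if k = i then π else if k = j then ρ else 0

/-- `π` is a system of pairings making the face `(J, x)` of `M` semilinear. -/
def IsClass (M : Set (ι → V)) (J : Finset ι) (x : ι → V) (π : ι → V) : Prop :=
  (∀ i ∈ J, π i ≠ 0) ∧ ∀ i ∈ J, ∀ j ∈ J, i ≠ j → Stab M J x (lk i (π i) j (π j))

def Semi (M : Set (ι → V)) (J : Finset ι) (x : ι → V) : Prop := ∃ π, IsClass M J x π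

variable {M : Set (ι → V)} {J I A : Finset ι} {x y z v u : ι → V} {i j k : ι} {π ρ θ δ : V}

theorem IsCode.eq (hM : IsCode M) (hy : y ∈ M) (hz : z ∈ M) (i : ι)
    (h : ∀ k, k ≠ i → y k = z k) : y = z := by
  have h1 : update y i (y i) ∈ M := by simpa using hy
  have h2 : update y i (z i) ∈ M := by
    have : update y i (z i) = z := by
      ext1 k; by_cases hk : k = i
      · subst hk; simp
      · simp [hk, h k hk]
    rwa [this]
  have := (hM y i).unique h1 h2
  ext1 k
  by_cases hk : k = i
  · subst hk; exact this
  · exact h k hk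

theorem IsCode.exists_mem (hM : IsCode M) (x : ι → V) (i : ι) : ∃ a, update x i a ∈ M :=
  (hM x i).exists

theorem InFace.refl (J : Finset ι) (x : ι → V) : InFace J x x := fun _ _ => rfl

theorem InFace.symm (h : InFace J x y) : InFace J y x := fun i hi => (h i hi).symm

theorem InFace.trans (h : InFace J x y) (h' : InFace J y z) : InFace J x z :=
  fun i hi => (h' i hi).trans (h i hi)

theorem InFace.mono (h : InFace I x y) (hIJ : I ⊆ J) : InFace J x y :=
  fun i hi => h i fun hi' => hi (hIJ hi')

theorem InFace.update (h : InFace J x y) (hi : i ∈ J) (a : V) : InFace J x (update y i a) := by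
  intro k hk
  have : k ≠ i := fun e => hk (e ▸ hi)
  simp [this, h k hk]

theorem InFace.add (h : InFace J x y) (hv : ∀ i, i ∉ J → v i = 0) : InFace J x (y + v) := by
  intro k hk
  simp [h k hk, hv k hk]

theorem InFace.piecewise (h : InFace J x y) (h' : InFace J x z) (A : Finset ι) :
    InFace J x (A.piecewise y z) := by
  intro k hk
  by_cases hA : k ∈ A <;> simp [hA, h k hk, h' k hk]

theorem InFace.congr (h : InFace J x y) : InFace J x z ↔ InFace J y z :=
  ⟨fun h' => h.symm.trans h', fun h' => h.trans h'⟩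

theorem Stab.mono (h : Stab M J x v) (hIJ : I ⊆ J) (hy : InFace J x y) : Stab M I y v :=
  fun z hz hzM => h z (hy.trans (hz.mono hIJ)) hzM

theorem Split.mono (h : Split M J x A) (hIJ : I ⊆ J) (hy : InFace J x y) : Split M I y A :=
  fun p q hp hq => h p q (hy.trans (hp.mono hIJ)) (hy.trans (hq.mono hIJ))

theorem IsClass.mono {π : ι → V} (h : IsClass M J x π) (hIJ : I ⊆ J) (hy : InFace J x y) :
    IsClass M I y π :=
  ⟨fun i hi => h.1 i (hIJ hi), fun i hi j hj hij => (h.2 i (hIJ hi) j (hIJ hj) hij).mono hIJ hy⟩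

theorem Stab.add (h : Stab M J x v) (hu : Stab M J x u) (hv : ∀ i, i ∉ J → v i = 0) :
    Stab M J x (v + u) := by
  intro y hy hyM
  rw [← add_assoc]
  exact hu _ (hy.add hv) (h y hy hyM)

theorem Split.congr {A' : Finset ι} (h : Split M J x A) (hA : ∀ i ∈ J, i ∈ A ↔ i ∈ A') :
    Split M J x A' := by
  have key : ∀ p q, InFace J x p → InFace J x q → A'.piecewise p q = A.piecewise p q := by
    intro p q hp hq
    ext1 i
    by_cases hi : i ∈ J
    · have := hA i hi
      by_cases h1 : i ∈ A
      · simp [h1, this.1 h1]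
      · have h2 : i ∉ A' := fun h => h1 (this.2 h)
        simp [h1, h2]
    · by_cases h1 : i ∈ A <;> by_cases h2 : i ∈ A' <;> simp [h1, h2, hp i hi, hq i hi]
  intro p q hp hq h0 h1 h2
  rw [key q p hq hp] at h1
  rw [key p q hp hq] at h2
  exact h p q hp hq h0 h1 h2

theorem Split.compl (h : Split M J x A) : Split M J x (J \ A) := by
  have key : ∀ p q, InFace J x p → InFace J x q → (J \ A).piecewise p q = A.piecewise q p := by
    intro p q hp hq
    ext1 i
    by_cases hi : i ∈ J
    · by_cases h1 : i ∈ A <;> simp [h1, hi]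
    · by_cases h1 : i ∈ A <;> simp [h1, hi, hp i hi, hq i hi]
  intro p q hp hq h0 h1 h2
  rw [key q p hq hp] at h1
  rw [key p q hp hq] at h2
  exact h p q hp hq h0 h2 h1

theorem Red.of_split (h : Split M J x A) (h2 : 2 ≤ (J ∩ A).card) (h3 : 2 ≤ (J \ A).card) :
    Red M J x := by
  refine ⟨J ∩ A, Finset.inter_subset_left, h2, ?_, h.congr fun i hi => by simp [hi]⟩
  rwa [show J \ (J ∩ A) = J \ A by ext; simp]

/-! ### Links -/

theorem lk_left : lk i π j ρ i = π := by simp [lk]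

theorem lk_right (h : i ≠ j) : lk i π j ρ j = ρ := by simp [lk, h.symm]

theorem lk_other (h : k ≠ i) (h' : k ≠ j) : lk i π j ρ k = 0 := by simp [lk, h, h']

theorem lk_supp (hi : i ∈ A) (hj : j ∈ A) : ∀ k, k ∉ A → lk i π j ρ k = 0 := by
  intro k hk
  exact lk_other (fun e => hk (e ▸ hi)) (fun e => hk (e ▸ hj))

theorem lk_symm (h : i ≠ j) : lk i π j ρ = lk j ρ i π := by
  ext1 k
  unfold lk
  split_ifs <;> simp_all

theorem lk_add {π' ρ' : V} : lk i π j ρ + lk i π' j ρ' = lk i (π + π') j (ρ + ρ') := by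
  ext1 k
  simp only [lk, Pi.add_apply]
  split_ifs <;> simp

theorem lk_comp (hij : i ≠ j) (hik : i ≠ k) (hjk : j ≠ k) :
    lk i π j ρ + lk j ρ k θ = lk i π k θ := by
  ext1 l
  simp only [lk, Pi.add_apply]
  split_ifs <;> simp_all [V.add_self]

theorem Stab.lk_symm (h : Stab M J x (lk i π j ρ)) (hij : i ≠ j) : Stab M J x (lk j ρ i π) := by
  rwa [OrderFour.lk_symm hij.symm]

theorem Stab.lk_add {π' ρ' : V} (h : Stab M J x (lk i π j ρ)) (h' : Stab M J x (lk i π' j ρ'))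
    (hi : i ∈ J) (hj : j ∈ J) : Stab M J x (lk i (π + π') j (ρ + ρ')) := by
  rw [← OrderFour.lk_add]
  exact h.add h' (lk_supp hi hj)

theorem Stab.lk_comp (h : Stab M J x (lk i π j ρ)) (h' : Stab M J x (lk j ρ k θ))
    (hi : i ∈ J) (hj : j ∈ J) (hij : i ≠ j) (hik : i ≠ k) (hjk : j ≠ k) :
    Stab M J x (lk i π k θ) := by
  rw [← OrderFour.lk_comp hij hik hjk (ρ := ρ)]
  exact h.add h' (lk_supp hi hj)

/-- A face contains a codeword with prescribed values outside one direction. -/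
theorem IsCode.exists_inFace (hM : IsCode M) (hy : InFace J x y) (hi : i ∈ J) :
    ∃ z ∈ M, InFace J x z ∧ ∀ k, k ≠ i → z k = y k := by
  obtain ⟨a, ha⟩ := hM.exists_mem y i
  exact ⟨_, ha, hy.update hi a, fun k hk => by simp [hk]⟩

/-- The second entry of a link is determined by the first. -/
theorem lk_unique (hM : IsCode M) {ρ' : V} (h : Stab M J x (lk i π j ρ))
    (h' : Stab M I y (lk i π j ρ')) (hij : i ≠ j) (hz : InFace J x z) (hz' : InFace I y z)
    (hi : i ∈ J) (hi' : i ∈ I) : ρ = ρ' := by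
  obtain ⟨a, ha⟩ := hM.exists_mem z i
  have h1 := h _ (hz.update hi a) ha
  have h2 := h' _ (hz'.update hi' a) ha
  have := hM.eq h1 h2 j fun k hk => by
    by_cases hki : k = i
    · subst hki; simp [lk_left]
    · simp [lk_other hki hk]
  have := congrFun this j
  simpa [lk_right hij] using this

theorem lk_ne_zero (hM : IsCode M) (h : Stab M J x (lk i π j ρ)) (hij : i ≠ j) (hi : i ∈ J)
    (hπ : π ≠ 0) : ρ ≠ 0 := by
  rintro rfl
  obtain ⟨a, ha⟩ := hM.exists_mem x i
  have h1 := h _ ((InFace.refl J x).update hi a) ha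
  have := hM.eq h1 ha i fun k hk => by
    by_cases hkj : k = j
    · subst hkj; simp [lk_right hij]
    · simp [lk_other hk hkj]
  have := congrFun this i
  simp [lk_left] at this
  exact hπ this

/-- Two different links between `i` and `j` make `{i, j}` a part of a decomposition. -/
theorem split_of_links (hM : IsCode M) {π' ρ' : V} (hij : i ≠ j) (hi : i ∈ J) (hj : j ∈ J)
    (h : Stab M J x (lk i π j ρ)) (h' : Stab M J x (lk i π' j ρ'))
    (hπ : π ≠ 0) (hπ' : π' ≠ 0) (hne : π ≠ π') : Split M J x {i, j} := by
  have all : ∀ δ : V, ∃ ε, Stab M J x (lk i δ j ε) := by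
    intro δ
    rcases V.cases_of_ne π π' δ hπ hπ' hne with rfl | rfl | rfl | rfl
    · refine ⟨0, fun y _ hy => ?_⟩
      have : (lk i 0 j 0 : ι → V) = 0 := by ext1 k; simp [lk]
      simpa [this] using hy
    · exact ⟨_, h⟩
    · exact ⟨_, h'⟩
    · exact ⟨_, h.lk_add h' hi hj⟩
  intro p q hp hq hpM h1 h2
  obtain ⟨ε, hε⟩ := all (q i + p i)
  have hqi : p i + (q i + p i) = q i := by
    rw [add_comm (q i), ← add_assoc, V.add_self, zero_add]
  have e1 : p + lk i (q i + p i) j ε = ({i, j} : Finset ι).piecewise q p := by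
    refine hM.eq (hε p hp hpM) h1 j fun k hk => ?_
    by_cases hki : k = i
    · subst hki; simp [lk_left, hqi]
    · simp [lk_other hki hk, hki, hk]
  have hjj : p j + ε = q j := by
    have := congrFun e1 j
    simpa [lk_right hij] using this
  have e2 := hε _ (hp.piecewise hq {i, j}) h2
  convert e2 using 1
  ext1 k
  by_cases hki : k = i
  · subst hki; simp [lk_left, hqi]
  · by_cases hkj : k = j
    · subst hkj; simp [lk_right hij, hjj]
    · simp [lk_other hki hkj, hki, hkj]

/-- A translation supported in one part of a decomposition extends from a small face. -/
theorem Split.stab (hM : IsCode M) (h : Split M J x A) (hA : A ⊆ J) (hk : k ∈ J)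
    (hkA : k ∉ A) (hv : ∀ i, i ∉ A → v i = 0) (hs : Stab M (insert k A) x v) : Stab M J x v := by
  intro y hy hyM
  obtain ⟨p, hpM, hp, hpe⟩ := hM.exists_inFace (J := insert k A) (x := x) (y := A.piecewise y x)
    (i := k) (by intro i hi; simp at hi; simp [hi.2]) (by simp)
  have hpJ : InFace J x p := hp.mono (Finset.insert_subset hk hA)
  have hpA : ∀ i ∈ A, p i = y i := fun i hi => by
    rw [hpe i (fun e => hkA (e ▸ hi))]; simp [hi]
  refine h p (y + v) hpJ (hy.add fun i hi => hv i fun h => hi (hA h)) hpM ?_ ?_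
  · convert hs p hp hpM using 1
    ext1 i
    by_cases hi : i ∈ A
    · simp [hi, hpA i hi]
    · simp [hi, hv i hi]
  · convert hyM using 1
    ext1 i
    by_cases hi : i ∈ A
    · simp [hi, hpA i hi]
    · simp [hi, hv i hi]

/-- Conjugation of one translation by another. -/
theorem Stab.conj (hu : Stab M J x u) (hI : I ⊆ J) (hyx : InFace J x y)
    (hus : ∀ i, i ∉ J → u i = 0) (hvs : ∀ i, i ∉ I → v i = 0) (h : Stab M I y v)
    (hz : ∀ i, i ∉ I → z i = y i + u i) : Stab M I z v := by
  intro p hp hpM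
  have hpJ : InFace J x p := by
    intro i hi
    rw [hp i fun h => hi (hI h), hz i fun h => hi (hI h), hyx i hi, hus i hi, add_zero]
  have h1 : InFace I y (p + u) := by
    intro i hi
    simp only [Pi.add_apply]
    rw [hp i hi, hz i hi, V.add_add_cancel]
  have h2 := h _ h1 (hu p hpJ hpM)
  have h3 := hu (p + u + v) ((hpJ.add hus).add fun i hi => hvs i fun h => hi (hI h)) h2
  convert h3 using 1
  ext1 i
  simp only [Pi.add_apply]
  rw [add_right_comm (p i) (u i) (v i), V.add_add_cancel]

/-- Changing one part of a decomposition within its class preserves translations in the other. -/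
theorem Split.stab_congr {p r : ι → V} (h : Split M J x A) (hI : I ⊆ A) (hp : InFace J x p)
    (hr : InFace J x r) (hpM : p ∈ M) (hrM : r ∈ M) (hpr : ∀ i ∈ A, p i = r i) (hA : A ⊆ J)
    (hv : ∀ i, i ∉ I → v i = 0) (hs : Stab M I p v) : Stab M I r v := by
  have swap : ∀ p r q : ι → V, InFace J x p → InFace J x r → p ∈ M → r ∈ M →
      (∀ i ∈ A, p i = r i) → InFace J x q → q ∈ M → (∀ i, i ∉ A → q i = r i) →
      A.piecewise q p ∈ M := by
    intro p r q hp hr hpM hrM hpr hq hqM hqr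
    refine h r _ hr (hq.piecewise hp A) hrM ?_ ?_
    · convert hqM using 1
      ext1 i; by_cases hi : i ∈ A <;> simp [hi, hqr]
    · convert hpM using 1
      ext1 i; by_cases hi : i ∈ A <;> simp [hi, hpr]
  intro q hq hqM
  have hqJ : InFace J x q := hr.trans (hq.mono (hI.trans hA))
  have h1 := swap p r q hp hr hpM hrM hpr hqJ hqM fun i hi => hq i fun h => hi (hI h)
  have h2 := hs (A.piecewise q p) (by
    intro i hi
    by_cases hiA : i ∈ A
    · simp [hiA, hq i hi, hpr]
    · simp [hiA]) h1
  have hvJ : ∀ i, i ∉ J → v i = 0 := fun i hi => hv i fun h => hi (hA (hI h))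
  have h3 := swap r p _ hr hp hrM hpM (fun i hi => (hpr i hi).symm)
    ((hqJ.piecewise hp A).add hvJ) h2 fun i hi => by
      simp [hi, hv i fun h => hi (hI h)]
  convert h3 using 1
  ext1 i
  by_cases hiA : i ∈ A
  · simp [hiA]
  · simp [hiA, hq i fun h => hiA (hI h), hv i fun h => hiA (hI h)]

/-- A decomposition of a small face inside one part of a decomposition extends. -/
theorem Split.comp (hM : IsCode M) {S : Finset ι} (h : Split M J x S) (hS : S ⊆ J) (hk : k ∈ J)
    (hkS : k ∉ S) (hA : A ⊆ S) (hy : InFace J x y) (h' : Split M (insert k S) y A) :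
    Split M J x A := by
  intro p q hp hq hpM h1 h2
  -- replace the part outside `S` by that of `y`
  have lift : ∀ p : ι → V, InFace J x p → p ∈ M → ∃ p' ∈ M, InFace (insert k S) y p' ∧
      ∀ i ∈ S, p' i = p i := by
    intro p hp hpM
    obtain ⟨p', hpM', hp', hpe⟩ := hM.exists_inFace (J := insert k S) (x := y)
      (y := S.piecewise p y) (i := k) (by intro i hi; simp at hi; simp [hi.2]) (by simp)
    exact ⟨p', hpM', hp', fun i hi => by rw [hpe i (fun e => hkS (e ▸ hi))]; simp [hi]⟩
  have hsub : insert k S ⊆ J := Finset.insert_subset hk hS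
  have key : ∀ p p' r : ι → V, InFace J x p → InFace J x p' → InFace J x r → p ∈ M → p' ∈ M →
      (∀ i ∈ S, p' i = p i) → (∀ i, i ∉ S → r i = p i) → (r ∈ M ↔ S.piecewise r p' ∈ M) := by
    intro p p' r hp hp' hr hpM hpM' e1 e2
    constructor
    · intro hrM
      refine h p _ hp (hr.piecewise hp' S) hpM ?_ ?_
      · convert hrM using 1
        ext1 i; by_cases hi : i ∈ S <;> simp [hi, e2]
      · convert hpM' using 1
        ext1 i; by_cases hi : i ∈ S <;> simp [hi, e1]
    · intro hrM
      refine h p' _ hp' hr hpM' hrM ?_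
      convert hpM using 1
      ext1 i; by_cases hi : i ∈ S <;> simp [hi, e1, e2]
  -- lift `p` and the point `A.piecewise p q`
  obtain ⟨p', hpM', hp', ep⟩ := lift p hp hpM
  obtain ⟨r', hrM', hr', er⟩ := lift _ (hp.piecewise hq A) h2
  have hp'J := hy.trans (hp'.mono hsub)
  have hr'J := hy.trans (hr'.mono hsub)
  have k1 := (key p p' (A.piecewise q p) hp hp'J (hq.piecewise hp A) hpM hpM' ep fun i hi => by
    have : i ∉ A := fun h => hi (hA h)
    simp [this]).1 h1
  refine (key (A.piecewise p q) r' q (hp.piecewise hq A) hr'J hq h2 hrM' er fun i hi => by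
    have : i ∉ A := fun h => hi (hA h)
    simp [this]).2 ?_
  refine h' p' _ hp' ?_ hpM' ?_ ?_
  · intro i hi
    have : i ∉ S := fun h => hi (Finset.mem_insert_of_mem h)
    simp [this, hr' i hi]
  · convert k1 using 1
    ext1 i
    by_cases hi : i ∈ A
    · simp [hi, hA hi]
    · by_cases hiS : i ∈ S <;> simp [hi, hiS, ep]
  · convert hrM' using 1
    ext1 i
    by_cases hi : i ∈ A
    · simp [hi, ep i (hA hi), er i (hA hi)]
    · by_cases hiS : i ∈ S
      · simp [hi, hiS, er]
      · simp [hi, hiS]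

theorem Red.congr (h : InFace J x y) (hr : Red M J x) : Red M J y := by
  obtain ⟨A, hA, h2, h3, hs⟩ := hr
  exact ⟨A, hA, h2, h3, hs.mono subset_rfl h⟩

end Basic

/-! ### Exhaustive search for small Latin squares and cubes -/

section Search

/-- Depth-first search through the base-4 digit strings whose prefixes satisfy `ok`, testing `leaf`
on all completed strings. -/
def search (ok : ℕ → ℕ → ℕ → Bool) (leaf : ℕ → Bool) : ℕ → ℕ → ℕ → Bool
  | 0, _, w => leaf w
  | n + 1, k, w =>
    (!ok k w 0 || search ok leaf n (k + 1) w) &&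
    (!ok k w 1 || search ok leaf n (k + 1) (w + 1 * 4 ^ k)) &&
    (!ok k w 2 || search ok leaf n (k + 1) (w + 2 * 4 ^ k)) &&
    (!ok k w 3 || search ok leaf n (k + 1) (w + 3 * 4 ^ k))

def encode (f : ℕ → ℕ) : ℕ → ℕ
  | 0 => 0
  | k + 1 => encode f k + f k * 4 ^ k

def digit (w i : ℕ) : ℕ := w / 4 ^ i % 4

theorem encode_lt {f : ℕ → ℕ} (hf : ∀ i, f i < 4) (k : ℕ) : encode f k < 4 ^ k := by
  induction k with
  | zero => simp [encode]
  | succ k ih =>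
    have h4 : 4 ^ (k + 1) = 4 * 4 ^ k := by ring
    have : f k * 4 ^ k ≤ 3 * 4 ^ k := Nat.mul_le_mul_right _ (Nat.le_of_lt_succ (hf k))
    simp only [encode]
    omega

theorem digit_encode {f : ℕ → ℕ} (hf : ∀ i, f i < 4) {i k : ℕ} (hik : i < k) :
    digit (encode f k) i = f i := by
  induction k with
  | zero => omega
  | succ k ih =>
    have hpos : 0 < 4 ^ i := by positivity
    rcases Nat.lt_succ_iff_lt_or_eq.1 hik with h | rfl
    · rw [← ih h]
      obtain ⟨d, rfl⟩ := Nat.exists_eq_add_of_lt h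
      have : f (i + d + 1) * 4 ^ (i + d + 1) = 4 ^ i * (4 * (f (i + d + 1) * 4 ^ d)) := by ring
      simp only [digit, encode]
      rw [this, Nat.add_mul_div_left _ _ hpos, Nat.add_mul_mod_self_left]
    · simp only [digit, encode]
      rw [mul_comm, Nat.add_mul_div_left _ _ hpos, Nat.div_eq_of_lt (encode_lt hf i), zero_add,
        Nat.mod_eq_of_lt (hf i)]

theorem leaf_of_search {ok : ℕ → ℕ → ℕ → Bool} {leaf : ℕ → Bool} {f : ℕ → ℕ} {N : ℕ}
    (hf : ∀ i, f i < 4) (hok : ∀ k < N, ok k (encode f k) (f k) = true) (n k : ℕ)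
    (hkn : k + n = N) (hs : search ok leaf n k (encode f k) = true) :
    leaf (encode f N) = true := by
  induction n generalizing k with
  | zero => subst hkn; exact hs
  | succ n ih =>
    apply ih (k + 1) (by omega)
    have h := hok k (by omega)
    simp only [search, Bool.and_eq_true, Bool.or_eq_true, Bool.not_eq_true'] at hs
    have h4 := hf k
    simp only [encode]
    generalize hc : f k = c at h h4 ⊢
    interval_cases c <;> simp_all

/-- The search condition for a normalized Latin square. -/
def squareOk (k w c : ℕ) : Bool :=
  (k % 4 != 0 || c == k / 4) && (k / 4 != 0 || c == k % 4) &&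
  (List.range (k / 4)).all (fun a => digit w (4 * a + k % 4) != c) &&
  (List.range (k % 4)).all (fun b => digit w (4 * (k / 4) + b) != c)

def squareLeaf (w : ℕ) : Bool :=
  [1, 2, 3].any fun p => (List.range 4).all fun a => (List.range 4).all fun b =>
    digit w (4 * (a ^^^ p) + b) == digit w (4 * a + b) ^^^ p &&
    digit w (4 * a + (b ^^^ p)) == digit w (4 * a + b) ^^^ p

/-- The search condition for a normalized Latin cube. -/
def cubeOk (k w c : ℕ) : Bool :=
  (k / 4 % 4 != 0 || k % 4 != 0 || c == k / 16) &&
  (k / 16 != 0 || k % 4 != 0 || c == k / 4 % 4) &&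
  (k / 16 != 0 || k / 4 % 4 != 0 || c == k % 4) &&
  (List.range (k / 16)).all (fun a => digit w (16 * a + 4 * (k / 4 % 4) + k % 4) != c) &&
  (List.range (k / 4 % 4)).all (fun a => digit w (16 * (k / 16) + 4 * a + k % 4) != c) &&
  (List.range (k % 4)).all (fun a => digit w (16 * (k / 16) + 4 * (k / 4 % 4) + a) != c)

def cubeLeaf (w : ℕ) : Bool :=
  ((List.range 4).all fun a => (List.range 4).all fun b => (List.range 4).all fun c =>
    digit w (16 * a + 4 * b + c) == digit w (16 * digit w (16 * a + 4 * b + 0) + 4 * 0 + c)) ||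
  ((List.range 4).all fun a => (List.range 4).all fun b => (List.range 4).all fun c =>
    digit w (16 * a + 4 * b + c) == digit w (16 * digit w (16 * a + 4 * 0 + c) + 4 * b + 0)) ||
  ((List.range 4).all fun a => (List.range 4).all fun b => (List.range 4).all fun c =>
    digit w (16 * a + 4 * b + c) == digit w (16 * a + 4 * digit w (16 * 0 + 4 * b + c) + 0)) ||
  [1, 2, 3].any fun p => (List.range 4).all fun a => (List.range 4).all fun b =>
    (List.range 4).all fun c =>
      digit w (16 * (a ^^^ p) + 4 * b + c) == digit w (16 * a + 4 * b + c) ^^^ p &&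
      digit w (16 * a + 4 * (b ^^^ p) + c) == digit w (16 * a + 4 * b + c) ^^^ p &&
      digit w (16 * a + 4 * b + (c ^^^ p)) == digit w (16 * a + 4 * b + c) ^^^ p

theorem search_square : search squareOk squareLeaf 16 0 0 = true := by decide +kernel

theorem search_cube : search cubeOk cubeLeaf 64 0 0 = true := by decide +kernel

end Search

/-! ### Latin squares and cubes over the Klein group -/

section Latin

def V.toNat (v : V) : ℕ := 2 * v.1.val + v.2.val

def V.ofNat (n : ℕ) : V := ((n / 2 : ℕ), (n : ℕ))

theorem V.toNat_lt (v : V) : v.toNat < 4 := by revert v; decide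

theorem V.ofNat_toNat (v : V) : V.ofNat v.toNat = v := by revert v; decide

theorem V.toNat_add (u v : V) : (u + v).toNat = u.toNat ^^^ v.toNat := by revert u v; decide

theorem V.toNat_injective : Injective V.toNat := by decide

theorem V.toNat_ofNat : ∀ a < 4, (V.ofNat a).toNat = a := by decide

theorem V.toNat_zero : (0 : V).toNat = 0 := rfl

theorem V.ofNat_ne_zero : ∀ p ∈ [1, 2, 3], V.ofNat p ≠ 0 := by decide

theorem V.ofNat_inj {a b : ℕ} (ha : a < 4) (hb : b < 4) (h : V.ofNat a = V.ofNat b) : a = b := by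
  rw [← V.toNat_ofNat a ha, ← V.toNat_ofNat b hb, h]

theorem normalized_square {g : V → V → V} (h1 : ∀ a, Injective (g a))
    (h2 : ∀ b, Injective fun a => g a b) (h3 : ∀ b, g 0 b = b) (h4 : ∀ a, g a 0 = a) :
    ∃ π : V, π ≠ 0 ∧ ∀ a b, g (a + π) b = g a b + π ∧ g a (b + π) = g a b + π := by
  set F : ℕ → ℕ := fun k => (g (V.ofNat (k / 4)) (V.ofNat (k % 4))).toNat with hF
  have hF4 : ∀ i, F i < 4 := fun i => V.toNat_lt _
  have hFv : ∀ a b, b < 4 → F (4 * a + b) = (g (V.ofNat a) (V.ofNat b)).toNat := by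
    intro a b hb
    simp only [hF]
    rw [show (4 * a + b) / 4 = a by omega, show (4 * a + b) % 4 = b by omega]
  have hok : ∀ k < 16, squareOk k (encode F k) (F k) = true := by
    intro k hk
    obtain ⟨a, b, hb, ha, rfl⟩ : ∃ a b, b < 4 ∧ a < 4 ∧ k = 4 * a + b :=
      ⟨k / 4, k % 4, by omega, by omega, by omega⟩
    simp only [squareOk, Bool.and_eq_true, Bool.or_eq_true, bne_iff_ne, beq_iff_eq,
      List.all_eq_true, List.mem_range, show (4 * a + b) / 4 = a by omega,
      show (4 * a + b) % 4 = b by omega]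
    refine ⟨⟨⟨?_, ?_⟩, ?_⟩, ?_⟩
    · by_cases h0 : b = 0
      · subst h0
        right
        rw [hFv _ _ hb, show V.ofNat 0 = 0 from rfl, h4, V.toNat_ofNat a ha]
      · left; exact h0
    · by_cases h0 : a = 0
      · subst h0
        right
        rw [hFv _ _ hb, show V.ofNat 0 = 0 from rfl, h3, V.toNat_ofNat b hb]
      · left; exact h0
    · intro a' ha' h
      rw [digit_encode hF4 (by omega), hFv _ _ hb, hFv _ _ hb] at h
      exact absurd (V.ofNat_inj (by omega) ha (h2 _ (V.toNat_injective h))) (by omega)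
    · intro b' hb' h
      rw [digit_encode hF4 (by omega), hFv _ _ (by omega), hFv _ _ hb] at h
      exact absurd (V.ofNat_inj (by omega) hb (h1 _ (V.toNat_injective h))) (by omega)
  have key := leaf_of_search hF4 hok 16 0 rfl search_square
  simp only [squareLeaf, List.any_eq_true, List.all_eq_true, List.mem_range, Bool.and_eq_true,
    beq_iff_eq] at key
  obtain ⟨p, hp, hp2⟩ := key
  have hp4 : p < 4 := by simp at hp; omega
  have hd : ∀ u v : V, digit (encode F 16) (4 * u.toNat + v.toNat) = (g u v).toNat := by
    intro u v
    have := u.toNat_lt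
    have := v.toNat_lt
    rw [digit_encode hF4 (by omega), hFv _ _ (by omega), V.ofNat_toNat, V.ofNat_toNat]
  refine ⟨V.ofNat p, V.ofNat_ne_zero p hp, fun a b => ?_⟩
  have := hp2 a.toNat a.toNat_lt b.toNat b.toNat_lt
  rw [← V.toNat_ofNat p hp4, ← V.toNat_add, ← V.toNat_add, hd, hd, hd, ← V.toNat_add] at this
  exact ⟨V.toNat_injective this.1, V.toNat_injective this.2⟩

theorem normalized_cube {g : V → V → V → V} (i1 : ∀ a b, Injective (g a b))
    (i2 : ∀ a c, Injective fun b => g a b c) (i3 : ∀ b c, Injective fun a => g a b c)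
    (h1 : ∀ a, g a 0 0 = a) (h2 : ∀ b, g 0 b 0 = b) (h3 : ∀ c, g 0 0 c = c) :
    (∀ a b c, g a b c = g (g a b 0) 0 c) ∨ (∀ a b c, g a b c = g (g a 0 c) b 0) ∨
    (∀ a b c, g a b c = g a (g 0 b c) 0) ∨
    ∃ π : V, π ≠ 0 ∧ ∀ a b c, g (a + π) b c = g a b c + π ∧ g a (b + π) c = g a b c + π ∧
      g a b (c + π) = g a b c + π := by
  set F : ℕ → ℕ := fun k =>
    (g (V.ofNat (k / 16)) (V.ofNat (k / 4 % 4)) (V.ofNat (k % 4))).toNat with hF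
  have hF4 : ∀ i, F i < 4 := fun i => V.toNat_lt _
  have hFv : ∀ a b c, b < 4 → c < 4 →
      F (16 * a + 4 * b + c) = (g (V.ofNat a) (V.ofNat b) (V.ofNat c)).toNat := by
    intro a b c hb hc
    simp only [hF]
    rw [show (16 * a + 4 * b + c) / 16 = a by omega, show (16 * a + 4 * b + c) / 4 % 4 = b by omega,
      show (16 * a + 4 * b + c) % 4 = c by omega]
  have h0 : V.ofNat 0 = 0 := rfl
  have hok : ∀ k < 64, cubeOk k (encode F k) (F k) = true := by
    intro k hk
    obtain ⟨a, b, c, hc, hb, ha, rfl⟩ : ∃ a b c, c < 4 ∧ b < 4 ∧ a < 4 ∧ k = 16 * a + 4 * b + c :=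
      ⟨k / 16, k / 4 % 4, k % 4, by omega, by omega, by omega, by omega⟩
    simp only [cubeOk, Bool.and_eq_true, Bool.or_eq_true, bne_iff_ne, beq_iff_eq,
      List.all_eq_true, List.mem_range, show (16 * a + 4 * b + c) / 16 = a by omega,
      show (16 * a + 4 * b + c) / 4 % 4 = b by omega, show (16 * a + 4 * b + c) % 4 = c by omega]
    refine ⟨⟨⟨⟨⟨?_, ?_⟩, ?_⟩, ?_⟩, ?_⟩, ?_⟩
    · by_cases hb0 : b = 0
      · by_cases hc0 : c = 0
        · subst hb0 hc0
          right
          rw [hFv _ _ _ hb hc, h0, h1, V.toNat_ofNat a ha]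
        · exact .inl (.inr hc0)
      · exact .inl (.inl hb0)
    · by_cases hb0 : a = 0
      · by_cases hc0 : c = 0
        · subst hb0 hc0
          right
          rw [hFv _ _ _ hb hc, h0, h2, V.toNat_ofNat b hb]
        · exact .inl (.inr hc0)
      · exact .inl (.inl hb0)
    · by_cases hb0 : a = 0
      · by_cases hc0 : b = 0
        · subst hb0 hc0
          right
          rw [hFv _ _ _ hb hc, h0, h3, V.toNat_ofNat c hc]
        · exact .inl (.inr hc0)
      · exact .inl (.inl hb0)
    · intro a' ha' h
      rw [digit_encode hF4 (by omega), hFv _ _ _ hb hc, hFv _ _ _ hb hc] at h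
      exact absurd (V.ofNat_inj (by omega) ha (i3 _ _ (V.toNat_injective h))) (by omega)
    · intro b' hb' h
      rw [digit_encode hF4 (by omega), hFv _ _ _ (by omega) hc, hFv _ _ _ hb hc] at h
      exact absurd (V.ofNat_inj (by omega) hb (i2 _ _ (V.toNat_injective h))) (by omega)
    · intro c' hc' h
      rw [digit_encode hF4 (by omega), hFv _ _ _ hb (by omega), hFv _ _ _ hb hc] at h
      exact absurd (V.ofNat_inj (by omega) hc (i1 _ _ (V.toNat_injective h))) (by omega)
  have key := leaf_of_search hF4 hok 64 0 rfl search_cube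
  simp only [cubeLeaf, List.any_eq_true, List.all_eq_true, List.mem_range, Bool.and_eq_true,
    beq_iff_eq, Bool.or_eq_true] at key
  have hd : ∀ u v t : V,
      digit (encode F 64) (16 * u.toNat + 4 * v.toNat + t.toNat) = (g u v t).toNat := by
    intro u v t
    have := u.toNat_lt
    have := v.toNat_lt
    have := t.toNat_lt
    rw [digit_encode hF4 (by omega), hFv _ _ _ (by omega) (by omega), V.ofNat_toNat,
      V.ofNat_toNat, V.ofNat_toNat]
  rcases key with ((h | h) | h) | ⟨p, hp, h⟩
  · left
    intro a b c
    have := h _ a.toNat_lt _ b.toNat_lt _ c.toNat_lt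
    rw [← V.toNat_zero, hd, hd, hd] at this
    exact V.toNat_injective this
  · right; left
    intro a b c
    have := h _ a.toNat_lt _ b.toNat_lt _ c.toNat_lt
    rw [← V.toNat_zero, hd, hd, hd] at this
    exact V.toNat_injective this
  · right; right; left
    intro a b c
    have := h _ a.toNat_lt _ b.toNat_lt _ c.toNat_lt
    rw [← V.toNat_zero, hd, hd, hd] at this
    exact V.toNat_injective this
  · right; right; right
    have hp4 : p < 4 := by simp at hp; omega
    refine ⟨V.ofNat p, V.ofNat_ne_zero p hp, fun a b c => ?_⟩
    have := h _ a.toNat_lt _ b.toNat_lt _ c.toNat_lt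
    rw [← V.toNat_ofNat p hp4, ← V.toNat_add, ← V.toNat_add, ← V.toNat_add, hd, hd, hd, hd,
      ← V.toNat_add] at this
    exact ⟨V.toNat_injective this.1.1, V.toNat_injective this.1.2, V.toNat_injective this.2⟩

set_option synthInstance.maxSize 1000 in
theorem V.add_eq_add_of_ne : ∀ a b c d : V, a ≠ b → a ≠ c → a ≠ d → b ≠ c → b ≠ d → c ≠ d →
    a + b = c + d := by decide

/-- Every permutation of the Klein group respects the cosets of its subgroups. -/
theorem V.map_add_map {f : V → V} (hf : Injective f) {π : V} (hπ : π ≠ 0) (u v : V) :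
    f u + f (u + π) = f v + f (v + π) := by
  by_cases h1 : v = u
  · rw [h1]
  by_cases h2 : v = u + π
  · rw [h2, V.add_add_cancel, add_comm]
  have e1 : u ≠ u + π := by simpa using hπ
  have e2 : v ≠ v + π := by simpa using hπ
  have e3 : u ≠ v + π := fun h => h2 (by rw [h, V.add_add_cancel])
  have e4 : u + π ≠ v + π := fun h => h1 (add_right_cancel h).symm
  exact V.add_eq_add_of_ne _ _ _ _ (hf.ne e1) (hf.ne fun h => h1 h.symm) (hf.ne e3)
    (hf.ne fun h => h2 h.symm) (hf.ne e4) (hf.ne e2)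

theorem V.exists_shift {f : V → V} (hf : Injective f) {π : V} (hπ : π ≠ 0) :
    ∃ ρ : V, ρ ≠ 0 ∧ ∀ u, f (u + π) = f u + ρ := by
  refine ⟨f 0 + f (0 + π), ?_, fun u => ?_⟩
  · intro h
    have : f 0 = f (0 + π) := by
      rw [← V.add_add_cancel (f 0) (f (0 + π)), h, zero_add]
    exact hπ (by simpa using (hf this).symm)
  · rw [V.map_add_map hf hπ 0 u, ← add_assoc, V.add_self, zero_add]

/-- Every Latin square of order 4 is semilinear. -/
theorem latin_square {g : V → V → V} (h1 : ∀ a, Injective (g a))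
    (h2 : ∀ b, Injective fun a => g a b) :
    ∃ α β θ : V, α ≠ 0 ∧ β ≠ 0 ∧ θ ≠ 0 ∧
      ∀ a b, g (a + α) b = g a b + θ ∧ g a (b + β) = g a b + θ := by
  have b1 := (Finite.injective_iff_bijective (f := fun a => g a 0)).1 (h2 0)
  have b2 := (Finite.injective_iff_bijective (f := g 0)).1 (h1 0)
  set p := Equiv.ofBijective _ b1 with hp
  set q := Equiv.ofBijective _ b2 with hq
  have hp' : ∀ a, p a = g a 0 := fun a => rfl
  have hq' : ∀ a, q a = g 0 a := fun a => rfl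
  set e := g 0 0 with he
  have hpe : p.symm e = 0 := by rw [Equiv.symm_apply_eq]; rfl
  have hqe : q.symm e = 0 := by rw [Equiv.symm_apply_eq]; rfl
  obtain ⟨π, hπ, H⟩ := normalized_square (g := fun a b => g (p.symm (a + e)) (q.symm (b + e)) + e)
    (fun a b b' h => by simpa using h1 _ (add_right_cancel h))
    (fun b a a' h => by simpa using h2 _ (add_right_cancel h))
    (fun b => by simp only [zero_add, hpe]; rw [← hq', Equiv.apply_symm_apply, V.add_add_cancel])
    (fun b => by simp only [zero_add, hqe]; rw [← hp', Equiv.apply_symm_apply, V.add_add_cancel])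
  obtain ⟨α, hα, hα'⟩ := V.exists_shift p.symm.injective hπ
  obtain ⟨β, hβ, hβ'⟩ := V.exists_shift q.symm.injective hπ
  refine ⟨α, β, π, hα, hβ, hπ, fun a b => ?_⟩
  have := H (p a + e) (q b + e)
  simp only [add_right_comm _ π, V.add_add_cancel, Equiv.symm_apply_apply, hα', hβ'] at this
  simp only [add_right_comm _ e π] at this
  exact ⟨add_right_cancel this.1, add_right_cancel this.2⟩

/-- Every Latin cube of order 4 is reducible or semilinear. -/
theorem latin_cube {g : V → V → V → V} (i1 : ∀ a b, Injective (g a b))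
    (i2 : ∀ a c, Injective fun b => g a b c) (i3 : ∀ b c, Injective fun a => g a b c) :
    (∀ a b a' b' c, g a b 0 = g a' b' 0 → g a b c = g a' b' c) ∨
    (∀ a c a' c' b, g a 0 c = g a' 0 c' → g a b c = g a' b c') ∨
    (∀ b c b' c' a, g 0 b c = g 0 b' c' → g a b c = g a b' c') ∨
    ∃ α β γ θ : V, α ≠ 0 ∧ β ≠ 0 ∧ γ ≠ 0 ∧ θ ≠ 0 ∧ ∀ a b c, g (a + α) b c = g a b c + θ ∧
      g a (b + β) c = g a b c + θ ∧ g a b (c + γ) = g a b c + θ := by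
  have b1 := (Finite.injective_iff_bijective (f := fun a => g a 0 0)).1 (i3 0 0)
  have b2 := (Finite.injective_iff_bijective (f := fun b => g 0 b 0)).1 (i2 0 0)
  have b3 := (Finite.injective_iff_bijective (f := g 0 0)).1 (i1 0 0)
  set p := Equiv.ofBijective _ b1 with hp
  set q := Equiv.ofBijective _ b2 with hq
  set r := Equiv.ofBijective _ b3 with hr
  have hp' : ∀ a, p a = g a 0 0 := fun a => rfl
  have hq' : ∀ a, q a = g 0 a 0 := fun a => rfl
  have hr' : ∀ a, r a = g 0 0 a := fun a => rfl
  set e := g 0 0 0 with he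
  have hpe : p.symm e = 0 := by rw [Equiv.symm_apply_eq]; rfl
  have hqe : q.symm e = 0 := by rw [Equiv.symm_apply_eq]; rfl
  have hre : r.symm e = 0 := by rw [Equiv.symm_apply_eq]; rfl
  have H := normalized_cube
    (g := fun a b c => g (p.symm (a + e)) (q.symm (b + e)) (r.symm (c + e)) + e)
    (fun a b c c' h => by simpa using i1 _ _ (add_right_cancel h))
    (fun a c b b' h => by simpa using i2 _ _ (add_right_cancel h))
    (fun b c a a' h => by simpa using i3 _ _ (add_right_cancel h))
    (fun b => by
      simp only [zero_add, hqe, hre]; rw [← hp', Equiv.apply_symm_apply, V.add_add_cancel])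
    (fun b => by
      simp only [zero_add, hpe, hre]; rw [← hq', Equiv.apply_symm_apply, V.add_add_cancel])
    (fun b => by
      simp only [zero_add, hpe, hqe]; rw [← hr', Equiv.apply_symm_apply, V.add_add_cancel])
  simp only [zero_add, hpe, hqe, hre, V.add_add_cancel] at H
  rcases H with H | H | H | ⟨π, hπ, H⟩
  · left
    intro a b a' b' c h
    have h1 := H (p a + e) (q b + e) (r c + e)
    have h2 := H (p a' + e) (q b' + e) (r c + e)
    simp only [V.add_add_cancel, Equiv.symm_apply_apply] at h1 h2
    exact add_right_cancel (h1.trans (by rw [h, ← h2]))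
  · right; left
    intro a c a' c' b h
    have h1 := H (p a + e) (q b + e) (r c + e)
    have h2 := H (p a' + e) (q b + e) (r c' + e)
    simp only [V.add_add_cancel, Equiv.symm_apply_apply] at h1 h2
    exact add_right_cancel (h1.trans (by rw [h, ← h2]))
  · right; right; left
    intro b c b' c' a h
    have h1 := H (p a + e) (q b + e) (r c + e)
    have h2 := H (p a + e) (q b' + e) (r c' + e)
    simp only [V.add_add_cancel, Equiv.symm_apply_apply] at h1 h2
    exact add_right_cancel (h1.trans (by rw [h, ← h2]))
  · right; right; right
    obtain ⟨α, hα, hα'⟩ := V.exists_shift p.symm.injective hπ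
    obtain ⟨β, hβ, hβ'⟩ := V.exists_shift q.symm.injective hπ
    obtain ⟨γ, hγ, hγ'⟩ := V.exists_shift r.symm.injective hπ
    refine ⟨α, β, γ, π, hα, hβ, hγ, hπ, fun a b c => ?_⟩
    have := H (p a + e) (q b + e) (r c + e)
    simp only [add_right_comm _ π, V.add_add_cancel, Equiv.symm_apply_apply, hα', hβ',
      hγ'] at this
    simp only [add_right_comm _ e π] at this
    exact ⟨add_right_cancel this.1, add_right_cancel this.2.1, add_right_cancel this.2.2⟩

end Latin

/-! ### Faces of small dimension -/

section Small

variable {ι : Type*} [DecidableEq ι]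
variable {M : Set (ι → V)} {J I A : Finset ι} {x y z v u : ι → V} {i j k l a : ι} {π ρ θ δ : V}

/-- The value completing `x` to a codeword in direction `k`. -/
noncomputable def IsCode.sol (hM : IsCode M) (x : ι → V) (k : ι) : V :=
  (hM.exists_mem x k).choose

theorem IsCode.sol_mem (hM : IsCode M) (x : ι → V) (k : ι) : update x k (hM.sol x k) ∈ M :=
  (hM.exists_mem x k).choose_spec

theorem IsCode.mem_iff_sol (hM : IsCode M) : y ∈ M ↔ y k = hM.sol y k := by
  have h := hM.sol_mem y k
  constructor
  · intro hy
    exact (hM y k).unique (by simpa using hy) h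
  · intro hy
    rwa [← hy, update_eq_self] at h

theorem IsCode.sol_congr (hM : IsCode M) (h : ∀ l, l ≠ k → y l = z l) :
    hM.sol y k = hM.sol z k := by
  have h1 := hM.sol_mem y k
  have h2 := hM.sol_mem z k
  have : update y k (hM.sol y k) = update z k (hM.sol y k) := by
    ext1 l
    by_cases hl : l = k
    · subst hl; simp
    · simp [hl, h l hl]
  rw [this] at h1
  exact (hM z k).unique h1 h2

theorem IsCode.sol_injective (hM : IsCode M) (h : j ≠ k) (hyz : ∀ l, l ≠ j → y l = z l)
    (hs : hM.sol y k = hM.sol z k) : y j = z j := by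
  have h1 := hM.sol_mem y k
  have h2 := hM.sol_mem z k
  have := hM.eq h1 h2 j fun l hl => by
    by_cases hlk : l = k
    · subst hlk; simpa using hs
    · simp [hlk, hyz l hl]
  simpa [h] using congrFun this j

theorem IsClass.of_hub {π : ι → V} (hk : k ∈ J) (h0 : ∀ i ∈ J, π i ≠ 0)
    (h : ∀ i ∈ J, i ≠ k → Stab M J x (lk i (π i) k (π k))) : IsClass M J x π := by
  refine ⟨h0, fun i hi j hj hij => ?_⟩
  by_cases hik : i = k
  · subst hik
    exact (h j hj hij.symm).lk_symm hij.symm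
  by_cases hjk : j = k
  · subst hjk
    exact h i hi hij
  exact (h i hi hik).lk_comp ((h j hj hjk).lk_symm hjk) hi hk hik hij fun e => hjk e.symm

theorem semi_pair (hM : IsCode M) (hij : i ≠ j) : Semi M {i, j} x := by
  have inj : Injective fun a => hM.sol (update x i a) j := fun a b h => by
    simpa using hM.sol_injective hij (by simp +contextual) h
  obtain ⟨ρ, hρ, h⟩ := V.exists_shift inj (π := (1, 0)) (by decide)
  refine ⟨lk i (1, 0) j ρ, IsClass.of_hub (k := j) (by simp) ?_ ?_⟩
  · intro k hk
    simp at hk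
    rcases hk with rfl | rfl
    · rw [lk_left]; decide
    · rw [lk_right hij]; exact hρ
  · intro k hk hkj
    simp [hkj] at hk
    subst hk
    rw [lk_left, lk_right hij]
    intro y hy hyM
    rw [hM.mem_iff_sol (k := j)] at hyM ⊢
    have e1 : hM.sol y j = hM.sol (update x k (y k)) j := hM.sol_congr fun l hl => by
      by_cases hlk : l = k
      · subst hlk; simp
      · simp [hlk, hy l (by simp [hl, hlk])]
    have e2 : hM.sol (y + lk k (1, 0) j ρ) j = hM.sol (update x k (y k + (1, 0))) j :=
      hM.sol_congr fun l hl => by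
      by_cases hlk : l = k
      · subst hlk; simp [lk_left]
      · simp [hlk, lk_other hlk hl, hy l (by simp [hl, hlk])]
    rw [e2, h, ← e1, ← hyM, Pi.add_apply, lk_right hij]

/-- The Latin square of a three-dimensional face. -/
theorem square_of_face (hM : IsCode M) (hij : i ≠ j) (hik : i ≠ k) (hjk : j ≠ k) (x : ι → V) :
    ∃ g : V → V → V, (∀ a, Injective (g a)) ∧ (∀ b, Injective fun a => g a b) ∧
      ∀ y, InFace {i, j, k} x y → (y ∈ M ↔ y k = g (y i) (y j)) := by
  refine ⟨fun a b => hM.sol (update (update x i a) j b) k, fun a b b' h => ?_, fun b a a' h => ?_,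
    fun y hy => ?_⟩
  · simpa using hM.sol_injective hjk (by simp +contextual) h
  · simpa [hij] using hM.sol_injective hik (fun l hl => by
      by_cases hlj : l = j <;> simp [hlj, hl]) h
  · rw [hM.mem_iff_sol (k := k), hM.sol_congr (z := update (update x i (y i)) j (y j))]
    intro l hl
    by_cases hlj : l = j
    · subst hlj; simp
    by_cases hli : l = i
    · subst hli; simp [hij]
    simp [hlj, hli, hy l (by simp [hl, hlj, hli])]

theorem inFace_lk (hy : InFace J x y) (hi : i ∈ J) (hj : j ∈ J) :
    InFace J x (y + lk i π j ρ) := hy.add (lk_supp hi hj)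

theorem semi_triple (hM : IsCode M) (hij : i ≠ j) (hik : i ≠ k) (hjk : j ≠ k) :
    Semi M {i, j, k} x := by
  obtain ⟨g, h1, h2, hg⟩ := square_of_face hM hij hik hjk x
  obtain ⟨α, β, θ, hα, hβ, hθ, H⟩ := latin_square h1 h2
  refine ⟨fun l => if l = i then α else if l = j then β else θ,
    IsClass.of_hub (k := k) (by simp) ?_ ?_⟩
  · intro l _
    split_ifs <;> assumption
  · intro l hl hlk
    simp [hlk] at hl
    intro y hy hyM
    rw [hg _ hy] at hyM
    rw [hg _ (inFace_lk hy (by simp; tauto) (by simp))]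
    rcases hl with rfl | rfl
    · simp [hik.symm, hjk.symm, lk_left, lk_right hik, lk_other hij.symm hjk, H, hyM]
    · simp [hik.symm, hjk.symm, hij.symm, lk_left, lk_right hjk, lk_other hij hik, H, hyM]

/-- A link between two directions of a three-dimensional face extends to the third one. -/
theorem exists_link_third (hM : IsCode M) (hij : i ≠ j) (hik : i ≠ k) (hjk : j ≠ k)
    (h : Stab M {i, j, k} x (lk i π j ρ)) (hπ : π ≠ 0) :
    ∃ θ, θ ≠ 0 ∧ Stab M {i, j, k} x (lk i π k θ) ∧ Stab M {i, j, k} x (lk j ρ k θ) := by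
  have hρ : ρ ≠ 0 := lk_ne_zero hM h hij (by simp) hπ
  obtain ⟨g, h1, h2, hg⟩ := square_of_face hM hij hik hjk x
  have hs : ∀ a b, g (a + π) (b + ρ) = g a b := by
    intro a b
    have hy : InFace {i, j, k} x (update (update (update x i a) j b) k (g a b)) := by
      intro l hl
      simp at hl
      simp [hl]
    have := h _ hy ((hg _ hy).2 (by simp [hij, hik, hjk]))
    rw [hg _ (inFace_lk hy (by simp) (by simp))] at this
    simpa [hij, hik, hjk, lk_left, lk_right, lk_other hik.symm hjk.symm] using this.symm
  have hs' : ∀ a b, g (a + π) b = g a (b + ρ) := fun a b => by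
    rw [← hs (a + π) b, V.add_add_cancel]
  obtain ⟨θ, hθ, hr⟩ := V.exists_shift (h1 0) hρ
  have hc : ∀ a b, g a (b + ρ) = g a b + θ := by
    intro a b
    have := V.map_add_map (h2 b) hπ a 0
    rw [hs', hs', hr, ← add_assoc (g 0 b), V.add_self, zero_add] at this
    rw [← this, ← add_assoc, V.add_self, zero_add]
  refine ⟨θ, hθ, fun y hy hyM => ?_, fun y hy hyM => ?_⟩
  · rw [hg _ hy] at hyM
    rw [hg _ (inFace_lk hy (by simp) (by simp))]
    simp [lk_left, lk_right hik, lk_other hij.symm hjk, hs', hc, hyM]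
  · rw [hg _ hy] at hyM
    rw [hg _ (inFace_lk hy (by simp) (by simp))]
    simp [lk_left, lk_right hjk, lk_other hij hik, hc, hyM]

theorem semi_of_card_le_three (hM : IsCode M) (h : J.card ≤ 3) : Semi M J x := by
  obtain h | h | h : J.card ≤ 1 ∨ J.card = 2 ∨ J.card = 3 := by omega
  · refine ⟨fun _ => (1, 0), fun _ _ => (by decide : ((1, 0) : V) ≠ 0), fun i hi j hj hij => ?_⟩
    exact absurd (Finset.card_le_one.1 h i hi j hj) hij
  · obtain ⟨i, j, hij, rfl⟩ := Finset.card_eq_two.1 h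
    exact semi_pair hM hij
  · obtain ⟨i, j, k, hij, hik, hjk, rfl⟩ := Finset.card_eq_three.1 h
    exact semi_triple hM hij hik hjk

theorem eq_map_of_eq_map {G : V → V → V → V} (h2 : ∀ a c, Injective fun b => G a b c)
    (h : ∀ a b a' b' c, G a b 0 = G a' b' 0 → G a b c = G a' b' c) (a b a' b' c c' : V)
    (he : G a b c = G a' b' c) : G a b c' = G a' b' c' := by
  obtain ⟨b'', hb⟩ := (Finite.injective_iff_surjective.1 (h2 a' 0)) (G a b 0)
  have h3 := h a' b'' a b c hb
  have : b'' = b' := h2 a' c (h3.trans he)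
  subst this
  exact (h a' b'' a b c' hb).symm

theorem red_or_semi_of_card_four (hM : IsCode M) (h : J.card = 4) : Red M J x ∨ Semi M J x := by
  obtain ⟨l, J', hl, rfl, h3⟩ := Finset.card_eq_succ.1 h
  obtain ⟨i, j, k, hij, hik, hjk, rfl⟩ := Finset.card_eq_three.1 h3
  simp only [Finset.mem_insert, Finset.mem_singleton, not_or] at hl
  obtain ⟨hli, hlj, hlk⟩ := hl
  set g : V → V → V → V := fun a b c => hM.sol (update (update (update x i a) j b) k c) l with hgd
  have i1 : ∀ a b, Injective (g a b) := fun a b c c' h => by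
    simpa using hM.sol_injective (j := k) (Ne.symm hlk) (by simp +contextual) h
  have i2 : ∀ a c, Injective fun b => g a b c := fun a c b b' h => by
    simpa [hjk] using hM.sol_injective (j := j) (Ne.symm hlj) (fun m hm => by
      by_cases hmk : m = k <;> simp [hmk, hm]) h
  have i3 : ∀ b c, Injective fun a => g a b c := fun b c a a' h => by
    simpa [hij, hik] using hM.sol_injective (j := i) (Ne.symm hli) (fun m hm => by
      by_cases hmk : m = k
      · simp [hmk]
      · by_cases hmj : m = j <;> simp [hmk, hmj, hm, hjk]) h
  have hg : ∀ y, InFace {l, i, j, k} x y → (y ∈ M ↔ y l = g (y i) (y j) (y k)) := by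
    intro y hy
    rw [hM.mem_iff_sol (k := l),
      hM.sol_congr (z := update (update (update x i (y i)) j (y j)) k (y k))]
    intro m hm
    by_cases hmk : m = k
    · subst hmk; simp
    by_cases hmj : m = j
    · subst hmj; simp [hjk]
    by_cases hmi : m = i
    · subst hmi; simp [hij, hik]
    simp [hmk, hmj, hmi, hy m (by simp [hm, hmk, hmj, hmi])]
  rcases latin_cube i1 i2 i3 with H | H | H | ⟨α, β, γ, θ, hα, hβ, hγ, hθ, H⟩
  · left
    refine ⟨{i, j}, by grind, by rw [Finset.card_pair hij], ?_, fun p q hp hq h1 h2 h3 => ?_⟩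
    · rw [show ({l, i, j, k} : Finset ι) \ {i, j} = {l, k} by grind, Finset.card_pair hlk]
    · rw [hg _ hp] at h1
      rw [hg _ (hq.piecewise hp _)] at h2
      rw [hg _ (hp.piecewise hq _)] at h3
      rw [hg _ hq]
      simp [hli, hlj, hij, hik.symm, hjk.symm] at h2 h3
      rw [h3]
      exact eq_map_of_eq_map i2 H _ _ _ _ (p k) _ (h1.symm.trans h2)
  · left
    refine ⟨{i, k}, by grind, by rw [Finset.card_pair hik], ?_, fun p q hp hq h1 h2 h3 => ?_⟩
    · rw [show ({l, i, j, k} : Finset ι) \ {i, k} = {l, j} by grind, Finset.card_pair hlj]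
    · rw [hg _ hp] at h1
      rw [hg _ (hq.piecewise hp _)] at h2
      rw [hg _ (hp.piecewise hq _)] at h3
      rw [hg _ hq]
      simp [hli, hlk, hij.symm, hik, hjk] at h2 h3
      rw [h3]
      exact eq_map_of_eq_map (G := fun a c b => g a b c) (fun a b => i1 a b)
        (fun a b a' b' c => H a b a' b' c) _ _ _ _ (p j) _ (h1.symm.trans h2)
  · left
    refine ⟨{j, k}, by grind, by rw [Finset.card_pair hjk], ?_, fun p q hp hq h1 h2 h3 => ?_⟩
    · rw [show ({l, i, j, k} : Finset ι) \ {j, k} = {l, i} by grind, Finset.card_pair hli]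
    · rw [hg _ hp] at h1
      rw [hg _ (hq.piecewise hp _)] at h2
      rw [hg _ (hp.piecewise hq _)] at h3
      rw [hg _ hq]
      simp [hlj, hlk, hij, hik] at h2 h3
      rw [h3]
      exact eq_map_of_eq_map (G := fun b c a => g a b c) (fun b a => i1 a b)
        (fun a b a' b' c => H a b a' b' c) _ _ _ _ (p i) _ (h1.symm.trans h2)
  · right
    refine ⟨fun m => if m = i then α else if m = j then β else if m = k then γ else θ,
      IsClass.of_hub (k := l) (by simp) ?_ ?_⟩
    · intro m _
      split_ifs <;> assumption
    · intro m hm hml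
      simp [hml] at hm
      intro y hy hyM
      rw [hg _ hy] at hyM
      rw [hg _ (inFace_lk hy (by simp; tauto) (by simp))]
      rcases hm with rfl | rfl | rfl
      · simp [hli, hlj, hlk, lk, hij.symm, hik.symm, H, hyM, Ne.symm hlj, Ne.symm hlk]
      · simp [hli, hlj, hlk, lk, hij, hij.symm, hjk.symm, H, hyM, Ne.symm hli, Ne.symm hlk]
      · simp [hli, hlj, hlk, lk, hik, hjk, hik.symm, hjk.symm, H, hyM, Ne.symm hli, Ne.symm hlj]

/-! ### Uniqueness of classes -/

theorem link_unique_of_not_red (hM : IsCode M) {π' ρ' : V} (h4 : 4 ≤ J.card) (hnr : ¬Red M J x)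
    (hij : i ≠ j) (hi : i ∈ J) (hj : j ∈ J) (h : Stab M J x (lk i π j ρ))
    (h' : Stab M J x (lk i π' j ρ')) (hπ : π ≠ 0) (hπ' : π' ≠ 0) : π = π' := by
  by_contra hne
  refine hnr ⟨{i, j}, by grind, by rw [Finset.card_pair hij], ?_,
    split_of_links hM hij hi hj h h' hπ hπ' hne⟩
  have := Finset.card_sdiff_of_subset (show {i, j} ⊆ J by grind)
  rw [Finset.card_pair hij] at this
  omega

set_option synthInstance.maxSize 1000 in
theorem V.eq_add_of_ne : ∀ a b c : V, a ≠ 0 → b ≠ 0 → c ≠ 0 → a ≠ c → b ≠ c → a ≠ b →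
    b = a + c := by decide

/-- Two classes of one face either agree or are everywhere different. -/
theorem IsClass.eq_of_eq (hM : IsCode M) {X Z : ι → V} (hX : IsClass M J x X)
    (hZ : IsClass M J x Z) (hi : i ∈ J) (h : X i = Z i) (hj : j ∈ J) : X j = Z j := by
  by_cases hij : i = j
  · rwa [← hij]
  have h1 := hX.2 i hi j hj hij
  rw [h] at h1
  exact lk_unique hM h1 (hZ.2 i hi j hj hij) hij (InFace.refl _ _) (InFace.refl _ _) hi hi

set_option synthInstance.maxSize 1000 in
theorem V.coset_cases : ∀ π : V, π ≠ 0 → ∃ e, ∀ c : V, c = 0 ∨ c = π ∨ c = e ∨ c = e + π := by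
  decide

set_option synthInstance.maxSize 1000 in
theorem V.cosets_meet : ∀ c d π ρ : V, π ≠ 0 → ρ ≠ 0 → π ≠ ρ →
    ∃ e, (e = c ∨ e = c + π) ∧ (e = d ∨ e = d + ρ) := by decide

theorem exists_unique_slice (hM : IsCode M) {X : ι → V} (hX : IsClass M J x X)
    (h4 : 4 ≤ J.card) (ha : a ∈ J) (hnr : ¬Red M J x) :
    ∃ c₀, ∀ c, (c = c₀ ∨ c = c₀ + X a) → ∀ Z, IsClass M (J.erase a) (update x a c) Z →
      ∀ i ∈ J.erase a, Z i = X i := by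
  have hsub := Finset.erase_subset a J
  have hface : ∀ c, InFace J x (update x a c) := fun c => (InFace.refl J x).update ha c
  have hXc : ∀ c, IsClass M (J.erase a) (update x a c) X := fun c => hX.mono hsub (hface c)
  obtain ⟨i, hi⟩ : (J.erase a).Nonempty := by
    rw [← Finset.card_pos, Finset.card_erase_of_mem ha]; omega
  have hi' := Finset.mem_erase.1 hi
  have move : ∀ c Z, IsClass M (J.erase a) (update x a c) Z →
      IsClass M (J.erase a) (update x a (c + X a)) Z := by
    intro c Z hZ
    refine ⟨hZ.1, fun j hj k hk hjk => ?_⟩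
    refine Stab.conj (hX.2 a ha i hi'.2 (Ne.symm hi'.1)) hsub (hface c) (lk_supp ha hi'.2)
      (lk_supp hj hk) (hZ.2 j hj k hk hjk) fun l hl => ?_
    by_cases hla : l = a
    · subst hla; simp [lk_left]
    · have hli : l ≠ i := fun e => hl (e ▸ hi)
      simp [hla, lk_other hla hli]
  have cover : ∀ (j k : ι) (π ρ : V), j ∈ J.erase a → k ∈ J.erase a →
      (∀ c, Stab M (J.erase a) (update x a c) (lk j π k ρ)) → Stab M J x (lk j π k ρ) := by
    intro j k π ρ hj hk h y hy hyM
    refine h (y a) y (fun l hl => ?_) hyM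
    by_cases hla : l = a
    · subst hla; simp
    · simp [hla]
      exact hy l fun h => hl (Finset.mem_erase.2 ⟨hla, h⟩)
  by_contra! hcon
  have other : ∀ c, ∃ Z, IsClass M (J.erase a) (update x a c) Z ∧
      IsClass M (J.erase a) (update x a (c + X a)) Z ∧ ∀ j ∈ J.erase a, Z j ≠ X j := by
    intro c
    obtain ⟨d, hd, Z, hZ, j, hj, hne⟩ := hcon c
    have hZ' := move d Z hZ
    refine ⟨Z, ?_, ?_, fun k hk h => hne (IsClass.eq_of_eq hM hZ (hXc d) hk h hj)⟩
    · rcases hd with rfl | rfl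
      · exact hZ
      · rwa [V.add_add_cancel] at hZ'
    · rcases hd with rfl | rfl
      · exact hZ'
      · exact hZ
  obtain ⟨e, he⟩ := V.coset_cases (X a) (hX.1 a ha)
  obtain ⟨Z, hZ, hZ', hZX⟩ := other 0
  obtain ⟨W, hW, hW', hWX⟩ := other e
  rw [zero_add] at hZ'
  have bad : ∀ j ∈ J.erase a, ∀ k ∈ J.erase a, j ≠ k → ¬(Z j = W j ↔ Z k = W k) := by
    intro j hj k hk hjk hiff
    have hjJ := hsub hj
    have hkJ := hsub hk
    refine hWX j hj (link_unique_of_not_red hM h4 hnr hjk hjJ hkJ (cover j k _ (W k) hj hk ?_)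
      (hX.2 j hjJ k hkJ hjk) (hW.1 j hj) (hX.1 j hjJ))
    have main : ∀ c, IsClass M (J.erase a) (update x a c) Z →
        Stab M (J.erase a) (update x a c) (lk j (W j) k (W k)) := by
      intro c hc
      by_cases hj' : Z j = W j
      · rw [← hj', ← hiff.1 hj']
        exact hc.2 j hj k hk hjk
      · have hk' : Z k ≠ W k := fun h => hj' (hiff.2 h)
        rw [V.eq_add_of_ne _ _ _ (hZ.1 j hj) (hW.1 j hj) (hX.1 j hjJ) (hZX j hj) (hWX j hj) hj',
          V.eq_add_of_ne _ _ _ (hZ.1 k hk) (hW.1 k hk) (hX.1 k hkJ) (hZX k hk) (hWX k hk) hk']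
        exact (hc.2 j hj k hk hjk).lk_add ((hXc c).2 j hj k hk hjk) hj hk
    intro c
    rcases he c with rfl | rfl | rfl | rfl
    · exact main _ hZ
    · exact main _ hZ'
    · exact hW.2 j hj k hk hjk
    · exact hW'.2 j hj k hk hjk
  have h3 : 2 < (J.erase a).card := by rw [Finset.card_erase_of_mem ha]; omega
  obtain ⟨j, k, l, hj, hk, hl, hjk, hjl, hkl⟩ := Finset.two_lt_card_iff.1 h3
  have b1 := bad j hj k hk hjk
  have b2 := bad j hj l hl hjl
  have b3 := bad k hk l hl hkl
  tauto

end Small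

/-! ### Two-colourings with balanced lines -/

section Colouring

variable {ι : Type*} [DecidableEq ι]
variable {R : (ι → V) → ZMod 2} {B A D : Finset ι} {x y z : ι → V} {i j k : ι}

/-- Every line of the face `(B, x)` has two points of each colour. -/
def Balanced (R : (ι → V) → ZMod 2) (B : Finset ι) (x : ι → V) : Prop :=
  ∀ y, InFace B x y → ∀ i ∈ B, ∃ δ : V, δ ≠ 0 ∧
    ∀ v, R (update y i v) = R y ↔ v = y i ∨ v = y i + δ

/-- On the face `(B, x)`, the colouring is a sum of a function of the coordinates in `A` and a
function of the other coordinates. -/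
def Separable (R : (ι → V) → ZMod 2) (B : Finset ι) (x : ι → V) (A : Finset ι) : Prop :=
  ∀ p q b, InFace B x p → InFace B x q → InFace B x b → (∀ i, i ∉ A → p i = q i) →
    R p + R q = R (A.piecewise p b) + R (A.piecewise q b)

/-- One step, in a direction from `B`, between two points of the same colour. -/
def Step (R : (ι → V) → ZMod 2) (B : Finset ι) (y z : ι → V) : Prop :=
  ∃ i ∈ B, ∃ v, z = update y i v ∧ R z = R y

def Conn (R : (ι → V) → ZMod 2) (B : Finset ι) : (ι → V) → (ι → V) → Prop :=
  Relation.ReflTransGen (Step R B)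

theorem Step.symm (h : Step R B y z) : Step R B z y := by
  obtain ⟨i, hi, v, rfl, h⟩ := h
  exact ⟨i, hi, y i, by simp, h.symm⟩

theorem Conn.symm (h : Conn R B y z) : Conn R B z y := by
  induction h with
  | refl => exact .refl
  | tail _ h ih => exact .head h.symm ih

theorem Conn.trans (h : Conn R B x y) (h' : Conn R B y z) : Conn R B x z :=
  Relation.ReflTransGen.trans h h'

theorem Conn.colour (h : Conn R B y z) : R z = R y := by
  induction h with
  | refl => rfl
  | tail _ h ih =>
    obtain ⟨i, hi, v, rfl, h⟩ := h
    exact h.trans ih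

theorem Conn.inFace (h : Conn R B y z) : InFace B y z := by
  induction h with
  | refl => exact InFace.refl _ _
  | tail _ h ih =>
    obtain ⟨i, hi, v, rfl, h⟩ := h
    exact ih.update hi v

theorem Conn.step (h : Conn R B x y) (hi : i ∈ B) {v : V} (hR : R (update y i v) = R x) :
    Conn R B x (update y i v) :=
  .tail h ⟨i, hi, v, rfl, hR.trans h.colour.symm⟩

theorem Conn.mono (h : Conn R A y z) (hAB : A ⊆ B) : Conn R B y z :=
  Relation.ReflTransGen.mono (fun _ _ ⟨i, hi, h⟩ => ⟨i, hAB hi, h⟩) _ _ h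

theorem ZMod.two_cases (a b c : ZMod 2) (h : a ≠ b) : c = a ∨ c = b := by
  revert a b c; decide

theorem V.exists_ne_ne (a b : V) : ∃ c, c ≠ a ∧ c ≠ b := by revert a b; decide

theorem Balanced.exists_colour (h : Balanced R B x) (hy : InFace B x y) (hi : i ∈ B) (r : ZMod 2) :
    ∃ v, R (update y i v) = r := by
  obtain ⟨δ, hδ, H⟩ := h y hy i hi
  obtain ⟨c, hc1, hc2⟩ := V.exists_ne_ne (y i) (y i + δ)
  have : R (update y i c) ≠ R y := fun h => by
    rcases (H c).1 h with h | h
    · exact hc1 h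
    · exact hc2 h
  rcases ZMod.two_cases _ _ r this with h | h
  · exact ⟨c, h.symm⟩
  · exact ⟨y i, by simp [h]⟩

set_option synthInstance.maxSize 1000 in
theorem V.coset_compl : ∀ a₀ a₂ α : V, α ≠ 0 → a₂ ≠ a₀ → a₂ ≠ a₀ + α →
    ∀ a, (¬(a = a₀ ∨ a = a₀ + α) ↔ (a = a₂ ∨ a = a₂ + α)) := by decide

set_option synthInstance.maxSize 1000 in
theorem V.coset_compl_eq : ∀ a₀ a₂ α δ : V, α ≠ 0 → δ ≠ 0 → a₂ ≠ a₀ → a₂ ≠ a₀ + α →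
    a₂ + δ ≠ a₀ → a₂ + δ ≠ a₀ + α → δ = α := by decide

/-- The column of a point outside the component `C` of a balanced square. -/
theorem column_of_not_mem {L C : V → V → Prop} {a₀ b₀ a₂ b₂ α : V} (hα : α ≠ 0)
    (hcol : ∀ a b, L a b → ∃ δ : V, δ ≠ 0 ∧ ∀ a', L a' b ↔ a' = a ∨ a' = a + δ)
    (hrC : ∀ a b b', C a b → L a b' → C a b') (hcC : ∀ a a' b, C a b → L a' b → C a' b)
    (h₀ : ∀ a, C a b₀ ↔ a = a₀ ∨ a = a₀ + α) (hL : L a₂ b₂) (hC : ¬C a₂ b₂) :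
    ∀ a, (L a b₂ ↔ ¬(a = a₀ ∨ a = a₀ + α)) ∧ ¬C a b₂ := by
  obtain ⟨δ, hδ, H⟩ := hcol a₂ b₂ hL
  have hn : ∀ a, L a b₂ → ¬C a b₂ := fun a ha hc => hC (hcC _ _ _ hc hL)
  have hd : ∀ a, L a b₂ → a ≠ a₀ ∧ a ≠ a₀ + α := by
    intro a ha
    have : ¬C a b₀ := fun hc => hn a ha (hrC _ _ _ hc ha)
    rw [h₀] at this
    tauto
  have d1 := hd a₂ hL
  have d2 := hd _ ((H (a₂ + δ)).2 (.inr rfl))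
  obtain rfl := V.coset_compl_eq a₀ a₂ α δ hα hδ d1.1 d1.2 d2.1 d2.2
  intro a
  refine ⟨by rw [H, V.coset_compl a₀ a₂ δ hα d1.1 d1.2], fun hc => ?_⟩
  by_cases ha : a = a₀ ∨ a = a₀ + δ
  · exact hC (hcC _ _ _ hc hL)
  · exact hn a ((H a).2 ((V.coset_compl a₀ a₂ δ hα d1.1 d1.2 a).1 ha)) hc

/-- A disconnected balanced square is a union of two rectangles. -/
theorem rectangle_of_not_mem {L C : V → V → Prop} {a₀ b₀ a₂ b₂ : V}
    (hrow : ∀ a b, L a b → ∃ δ : V, δ ≠ 0 ∧ ∀ b', L a b' ↔ b' = b ∨ b' = b + δ)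
    (hcol : ∀ a b, L a b → ∃ δ : V, δ ≠ 0 ∧ ∀ a', L a' b ↔ a' = a ∨ a' = a + δ)
    (hCL : ∀ a b, C a b → L a b)
    (hrC : ∀ a b b', C a b → L a b' → C a b') (hcC : ∀ a a' b, C a b → L a' b → C a' b)
    (h₀ : C a₀ b₀) (hL : L a₂ b₂) (hC : ¬C a₂ b₂) :
    ∃ α β : V, α ≠ 0 ∧ β ≠ 0 ∧ ∀ a b,
      (L a b ↔ ((a = a₀ ∨ a = a₀ + α) ↔ (b = b₀ ∨ b = b₀ + β))) ∧
      (C a b ↔ ((a = a₀ ∨ a = a₀ + α) ∧ (b = b₀ ∨ b = b₀ + β))) := by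
  obtain ⟨α, hα, Hα⟩ := hcol a₀ b₀ (hCL _ _ h₀)
  obtain ⟨β, hβ, Hβ⟩ := hrow a₀ b₀ (hCL _ _ h₀)
  have Cα : ∀ a, C a b₀ ↔ a = a₀ ∨ a = a₀ + α := fun a =>
    ⟨fun h => (Hα a).1 (hCL _ _ h), fun h => hcC _ _ _ h₀ ((Hα a).2 h)⟩
  have Cβ : ∀ b, C a₀ b ↔ b = b₀ ∨ b = b₀ + β := fun b =>
    ⟨fun h => (Hβ b).1 (hCL _ _ h), fun h => hrC _ _ _ h₀ ((Hβ b).2 h)⟩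
  have c1 := column_of_not_mem hα hcol hrC hcC Cα hL hC
  have r1 := column_of_not_mem (L := fun b a => L a b) (C := fun b a => C a b) hβ
    (fun b a h => hrow a b h) (fun b a a' h h' => hcC a a' b h h') (fun b b' a h h' => hrC a b b' h h')
    Cβ hL hC
  have out1 : ∀ a b, ¬(a = a₀ ∨ a = a₀ + α) → (b = b₀ ∨ b = b₀ + β) → ¬L a b := fun a b ha hb h =>
    (c1 a).2 (hrC _ _ _ (hcC _ _ _ ((Cβ b).2 hb) h) ((c1 a).1.2 ha))
  have out2 : ∀ a b, (a = a₀ ∨ a = a₀ + α) → ¬(b = b₀ ∨ b = b₀ + β) → ¬L a b := fun a b ha hb h =>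
    (r1 b).2 (hcC _ _ _ (hrC _ _ _ ((Cα a).2 ha) h) ((r1 b).1.2 hb))
  have in1 : ∀ a b, (a = a₀ ∨ a = a₀ + α) → (b = b₀ ∨ b = b₀ + β) → C a b := by
    intro a b ha hb
    obtain ⟨δ, hδ, H⟩ := hrow a b₀ (hCL _ _ ((Cα a).2 ha))
    have : b₀ + δ = b₀ ∨ b₀ + δ = b₀ + β := by
      by_contra hcon
      exact out2 a _ ha hcon ((H _).2 (.inr rfl))
    have : δ = β := by simpa [hδ] using this
    subst this
    exact hrC _ _ _ ((Cα a).2 ha) ((H b).2 hb)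
  have in2 : ∀ a b, ¬(a = a₀ ∨ a = a₀ + α) → ¬(b = b₀ ∨ b = b₀ + β) → L a b := by
    intro a b ha hb
    have hab₂ := (c1 a).1.2 ha
    have hca : ¬C a b₂ := (c1 a).2
    have r2 := column_of_not_mem (L := fun b a => L a b) (C := fun b a => C a b) hβ
      (fun b a h => hrow a b h) (fun b a a' h h' => hcC a a' b h h')
      (fun b b' a h h' => hrC a b b' h h') Cβ hab₂ hca
    exact (r2 b).1.2 hb
  refine ⟨α, β, hα, hβ, fun a b => ?_⟩
  by_cases ha : a = a₀ ∨ a = a₀ + α <;> by_cases hb : b = b₀ ∨ b = b₀ + β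
  · have h1 := in1 a b ha hb
    have h2 := hCL _ _ h1
    tauto
  · have h1 := out2 a b ha hb
    have h2 := mt (hCL a b) h1
    tauto
  · have h1 := out1 a b ha hb
    have h2 := mt (hCL a b) h1
    tauto
  · have h1 := in2 a b ha hb
    have h2 : ¬C a b := fun h => (c1 a).2 (hrC _ _ _ h ((c1 a).1.2 ha))
    tauto

set_option synthInstance.maxSize 1000 in
theorem V.mem_of_pair_subset : ∀ b δ b₀ β : V, δ ≠ 0 → (b = b₀ ∨ b = b₀ + β) →
    (b + δ = b₀ ∨ b + δ = b₀ + β) → (b₀ = b ∨ b₀ = b + δ) := by decide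

theorem not_isolated {L : V → V → Prop} {a₀ b₀ α β : V} (hα : α ≠ 0)
    (hrow : ∀ a, ∃ b δ : V, δ ≠ 0 ∧ ∀ b', L a b' ↔ b' = b ∨ b' = b + δ)
    (hcol : ∀ a b, L a b → ∃ δ : V, δ ≠ 0 ∧ ∀ a', L a' b ↔ a' = a ∨ a' = a + δ)
    (hout : ∀ a b, ¬(a = a₀ ∨ a = a₀ + α) → ¬(b = b₀ ∨ b = b₀ + β) → ¬L a b)
    (h₀ : L a₀ b₀) : False := by
  have key : ∀ a, ¬(a = a₀ ∨ a = a₀ + α) → L a b₀ := by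
    intro a ha
    obtain ⟨b, δ, hδ, H⟩ := hrow a
    rw [H]
    refine V.mem_of_pair_subset b δ b₀ β hδ ?_ ?_
    · by_contra hb
      exact hout a b ha hb ((H b).2 (.inl rfl))
    · by_contra hb
      exact hout a _ ha hb ((H _).2 (.inr rfl))
  obtain ⟨a₂, h1, h2⟩ := V.exists_ne_ne a₀ (a₀ + α)
  have hc := V.coset_compl a₀ a₂ α hα h1 h2
  obtain ⟨δ, hδ, H⟩ := hcol a₀ b₀ h₀
  have k1 := (H _).1 (key a₂ ((hc _).2 (.inl rfl)))
  have k2 := (H _).1 (key (a₂ + α) ((hc _).2 (.inr rfl)))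
  have h3 : a₂ + α ≠ a₀ := fun e => (hc _).2 (.inr rfl) (.inl e)
  have : a₂ + α = a₂ := by
    rw [(k2.resolve_left h3), k1.resolve_left h1]
  exact hα (by simpa using this)

/-- All points of the colour of `x` in the `i`,`j`-face of `y` belong to the component of `x`. -/
def IsFull (R : (ι → V) → ZMod 2) (B : Finset ι) (x y : ι → V) (i j : ι) : Prop :=
  ∀ a b, R (update (update y i a) j b) = R x → Conn R B x (update (update y i a) j b)

theorem rectangle_of_not_isFull (h : Balanced R B x) (hy : Conn R B x y) (hij : i ≠ j) (hi : i ∈ B)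
    (hj : j ∈ B) (hf : ¬IsFull R B x y i j) : ∃ α β : V, α ≠ 0 ∧ β ≠ 0 ∧ ∀ a b,
      (R (update (update y i a) j b) = R x ↔
        ((a = y i ∨ a = y i + α) ↔ (b = y j ∨ b = y j + β))) ∧
      (Conn R B x (update (update y i a) j b) ↔
        ((a = y i ∨ a = y i + α) ∧ (b = y j ∨ b = y j + β))) := by
  unfold IsFull at hf
  push Not at hf
  obtain ⟨a₂, b₂, hL, hC⟩ := hf
  have e1 : ∀ a b b', update (update (update y i a) j b) j b' = update (update y i a) j b' := by
    simp
  have e2 : ∀ a b a', update (update (update y i a) j b) i a' = update (update y i a') j b := by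
    intro a b a'
    rw [update_comm hij.symm, update_idem]
  have hface : ∀ a b, InFace B x (update (update y i a) j b) := fun a b =>
    (hy.inFace.update hi a).update hj b
  refine rectangle_of_not_mem (L := fun a b => R (update (update y i a) j b) = R x)
    (C := fun a b => Conn R B x (update (update y i a) j b)) ?_ ?_ ?_ ?_ ?_ ?_ hL hC
  · intro a b hab
    obtain ⟨δ, hδ, H⟩ := h _ (hface a b) j hj
    refine ⟨δ, hδ, fun b' => ?_⟩
    have := H b'
    rw [e1, hab] at this
    simpa using this
  · intro a b hab
    obtain ⟨δ, hδ, H⟩ := h _ (hface a b) i hi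
    refine ⟨δ, hδ, fun a' => ?_⟩
    have := H a'
    rw [e2, hab] at this
    simpa [hij] using this
  · exact fun a b hab => hab.colour
  · intro a b b' hab hab'
    rw [← e1 a b b'] at hab' ⊢
    exact hab.step hj hab'
  · intro a a' b hab hab'
    rw [← e2 a b a'] at hab' ⊢
    exact hab.step hi hab'
  · simpa using hy

theorem IsFull.step (h : Balanced R B x) (hy : Conn R B x y) (hij : i ≠ j) (hi : i ∈ B)
    (hj : j ∈ B) (hf : IsFull R B x y i j) (hs : Step R B y z) : IsFull R B x z i j := by
  obtain ⟨k, hk, v, rfl, hv⟩ := hs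
  by_cases hki : k = i
  · subst hki; simpa [IsFull] using hf
  by_cases hkj : k = j
  · subst hkj
    intro a b
    rw [update_comm hij.symm, update_idem]
    exact hf a b
  by_contra hn
  have hz : Conn R B x (update y k v) := hy.step hk (hv.trans hy.colour)
  obtain ⟨α, β, hα, hβ, H⟩ := rectangle_of_not_isFull h hz hij hi hj hn
  have hyi : update y k v i = y i := by simp [Ne.symm hki]
  have hyj : update y k v j = y j := by simp [Ne.symm hkj]
  rw [hyi, hyj] at H
  have ecomm : ∀ a b w, update (update (update y i a) j b) k w =
      update (update (update y k w) i a) j b := by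
    intro a b w
    rw [update_comm (Ne.symm hkj), update_comm (Ne.symm hki)]
  have hout : ∀ a b, ¬(a = y i ∨ a = y i + α) → ¬(b = y j ∨ b = y j + β) →
      R (update (update y i a) j b) ≠ R x := by
    intro a b ha hb hab
    have h1 := hf a b hab
    have h2 := (H a b).1.2 (by tauto)
    rw [← ecomm] at h2
    have h3 := h1.step hk h2
    rw [ecomm] at h3
    exact ha ((H a b).2.1 h3).1
  have hface : ∀ a b, InFace B x (update (update y i a) j b) := fun a b =>
    (hy.inFace.update hi a).update hj b
  have e1 : ∀ a b b', update (update (update y i a) j b) j b' = update (update y i a) j b' := by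
    simp
  have e2 : ∀ a b a', update (update (update y i a) j b) i a' = update (update y i a') j b := by
    intro a b a'
    rw [update_comm hij.symm, update_idem]
  refine not_isolated (L := fun a b => R (update (update y i a) j b) = R x) hα ?_ ?_ hout ?_
  · intro a
    obtain ⟨b, hb⟩ := h.exists_colour (hface a 0) hj (R x)
    rw [e1] at hb
    obtain ⟨δ, hδ, H⟩ := h _ (hface a b) j hj
    refine ⟨b, δ, hδ, fun b' => ?_⟩
    have := H b'
    rw [e1, hb] at this
    simpa using this
  · intro a b hab
    obtain ⟨δ, hδ, H⟩ := h _ (hface a b) i hi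
    refine ⟨δ, hδ, fun a' => ?_⟩
    have := H a'
    rw [e2, hab] at this
    simpa [hij] using this
  · simpa using hy.colour

theorem IsFull.conn (h : Balanced R B x) (hij : i ≠ j) (hi : i ∈ B) (hj : j ∈ B)
    (hy : Conn R B x y) (hz : Conn R B x z) (hf : IsFull R B x y i j) : IsFull R B x z i j := by
  have hyz := hy.symm.trans hz
  clear hz
  induction hyz with
  | refl => exact hf
  | tail h1 h2 ih => exact ih.step h (hy.trans h1) hij hi hj h2

/-- The directions `i` and `j` are related if the component of `x` is full in all its
`i`,`j`-faces. -/
def Related (R : (ι → V) → ZMod 2) (B : Finset ι) (x : ι → V) (i j : ι) : Prop :=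
  ∀ y, Conn R B x y → IsFull R B x y i j

theorem related_refl (hi : i ∈ B) : Related R B x i i := by
  intro y hy a b hR
  rw [update_idem] at hR ⊢
  exact hy.step hi hR

theorem Related.symm (h : Related R B x i j) : Related R B x j i := by
  by_cases hij : i = j
  · subst hij; exact h
  intro y hy a b
  rw [update_comm (Ne.symm hij)]
  exact h y hy b a

theorem Related.trans (hb : Balanced R B x) (hi : i ∈ B) (hj : j ∈ B) (hk : k ∈ B)
    (h : Related R B x i j) (h' : Related R B x j k) : Related R B x i k := by
  by_cases hij : i = j
  · subst hij; exact h'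
  by_cases hjk : j = k
  · subst hjk; exact h
  by_cases hik : i = k
  · subst hik; exact related_refl hi
  intro y hy a b hR
  obtain ⟨c, hc⟩ := hb.exists_colour (hy.inFace.update hi a) hj (R x)
  have h1 := h y hy a c hc
  have e : update (update (update (update y i a) j c) j (y j)) k b = update (update y i a) k b := by
    rw [update_idem]
    congr 1
    rw [update_eq_self_iff]
    simp [Ne.symm hij]
  rw [← e] at hR ⊢
  exact h' _ h1 _ _ hR

theorem rectangle_of_not_related (h : Balanced R B x) (hy : Conn R B x y) (hij : i ≠ j)
    (hi : i ∈ B) (hj : j ∈ B) (hf : ¬Related R B x i j) {v w : V}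
    (hv : R (update y i v) = R x) (hw : R (update y j w) = R x) :
    R (update (update y i v) j w) = R x := by
  have hf' : ¬IsFull R B x y i j := fun hf' => hf fun z hz => hf'.conn h hij hi hj hy hz
  obtain ⟨α, β, -, -, H⟩ := rectangle_of_not_isFull h hy hij hi hj hf'
  have h1 := (H v (y j)).1
  have h2 := (H (y i) w).1
  rw [show update (update y i v) j (y j) = update y i v by
    rw [update_eq_self_iff]; simp [hij.symm]] at h1
  rw [update_eq_self] at h2
  rw [(H v w).1]
  exact iff_of_true ((h1.1 hv).2 (.inl rfl)) ((h2.1 hw).1 (.inl rfl))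

/-- In a set of related directions, all coordinates but one can be prescribed. -/
theorem exists_conn_of_related (h : Balanced R B x) (hj : j ∈ B) (hq : A ⊆ B)
    (hr : ∀ i ∈ A, Related R B x i j) (hy : Conn R B x y) (z : ι → V) :
    ∃ c, Conn R B x c ∧ (∀ k ∈ A, k ≠ j → c k = z k) ∧ ∀ k, k ∉ A → k ≠ j → c k = y k := by
  induction A using Finset.induction_on with
  | empty => exact ⟨y, hy, by simp, by simp⟩
  | insert i A hiA ih =>
    obtain ⟨c, hc, h1, h2⟩ := ih ((Finset.subset_insert i A).trans hq)
      fun k hk => hr k (Finset.mem_insert_of_mem hk)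
    by_cases hij : i = j
    · subst hij
      refine ⟨c, hc, fun k hk hki => h1 k ?_ hki, fun k hk hki => h2 k ?_ hki⟩
      · exact Finset.mem_of_mem_insert_of_ne hk hki
      · exact fun h => hk (Finset.mem_insert_of_mem h)
    have hi : i ∈ B := hq (Finset.mem_insert_self i A)
    obtain ⟨b, hb⟩ := h.exists_colour (hc.inFace.update hi (z i)) hj (R x)
    refine ⟨_, hr i (Finset.mem_insert_self i A) c hc _ _ hb, fun k hk hkj => ?_,
      fun k hk hkj => ?_⟩
    · by_cases hki : k = i
      · subst hki; simp [hkj]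
      · simp [hkj, hki, h1 k (Finset.mem_of_mem_insert_of_ne hk hki) hkj]
    · rw [Finset.mem_insert, not_or] at hk
      simp [hkj, hk.1, h2 k hk.2 hkj]

theorem Conn.update_of_not_related (h : Balanced R B x) (hD : D ⊆ B) (hi : i ∈ B) (hiD : i ∉ D)
    (hr : ∀ j ∈ D, ¬Related R B x i j) {e d : ι → V} (he : Conn R B x e) (hed : Conn R D e d)
    {v : V} (hv : R (update e i v) = R x) :
    Conn R D (update e i v) (update d i v) ∧ R (update d i v) = R x := by
  induction hed with
  | refl => exact ⟨.refl, hv⟩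
  | @tail b c hb hs ih =>
    obtain ⟨j, hj, w, rfl, hw⟩ := hs
    have hbB : Conn R B x b := he.trans (Conn.mono hb hD)
    have hij : i ≠ j := fun e => hiD (e ▸ hj)
    have key := rectangle_of_not_related h hbB hij hi (hD hj) (hr j hj) ih.2
      (hw.trans hbB.colour)
    rw [update_comm hij] at key
    refine ⟨.tail ih.1 ⟨j, hj, w, update_comm hij.symm _ _ _, key.trans ih.2.symm⟩, key⟩

/-- The component of `x` is a product over unions of classes of related directions. -/
theorem Conn.piecewise (h : Balanced R B x)
    (hr : ∀ i ∈ A, ∀ j ∈ B \ A, ¬Related R B x i j) {c e : ι → V} (hc : Conn R B x c)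
    (he : Conn R B x e) : Conn R B x (A.piecewise e c) := by
  suffices H : Conn R (B \ A) e (A.piecewise e c) from he.trans (H.mono Finset.sdiff_subset)
  have hce := hc.symm.trans he
  clear he
  induction hce with
  | refl => rw [Finset.piecewise_same]; exact .refl
  | @tail b d hb hs ih =>
    obtain ⟨i, hi, v, rfl, hv⟩ := hs
    have hbB : Conn R B x b := hc.trans hb
    by_cases hiA : i ∈ A
    · have := (Conn.update_of_not_related h (D := B \ A) Finset.sdiff_subset hi (by simp [hiA])
        (hr i hiA) hbB ih (hv.trans hbB.colour)).1
      convert this using 1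
      ext1 k
      by_cases hki : k = i
      · subst hki; simp [hiA]
      · by_cases hk : k ∈ A <;> simp [hk, hki]
    · have e : A.piecewise (update b i v) c = A.piecewise b c := by
        ext1 k
        by_cases hk : k ∈ A
        · have : k ≠ i := fun e => hiA (e ▸ hk)
          simp [hk, this]
        · simp [hk]
      rw [e]
      exact .head (Step.symm ⟨i, by simp [hi, hiA], v, rfl, hv⟩) ih

open Classical in
/-- The class of directions related to `i`. -/
noncomputable def relClass (R : (ι → V) → ZMod 2) (B : Finset ι) (x : ι → V) (i : ι) : Finset ι :=
  B.filter (Related R B x i)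

theorem mem_relClass : j ∈ relClass R B x i ↔ j ∈ B ∧ Related R B x i j := by
  simp [relClass]

theorem relClass_subset : relClass R B x i ⊆ B := fun _ h => (mem_relClass.1 h).1

theorem relClass_eq (h : Balanced R B x) (hi : i ∈ B) (hj : j ∈ relClass R B x i) :
    relClass R B x j = relClass R B x i := by
  rw [mem_relClass] at hj
  ext k
  simp only [mem_relClass]
  exact ⟨fun hk => ⟨hk.1, hj.2.trans h hi hj.1 hk.1 hk.2⟩,
    fun hk => ⟨hk.1, hj.2.symm.trans h hj.1 hi hk.1 hk.2⟩⟩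

/-- The coordinates of `y` in `q` can be completed to a point of the component of `x`. -/
def Good (R : (ι → V) → ZMod 2) (B : Finset ι) (x : ι → V) (q : Finset ι) (y : ι → V) : Prop :=
  ∃ c, Conn R B x c ∧ ∀ k ∈ q, c k = y k

theorem good_congr {q : Finset ι} (hyz : ∀ k ∈ q, y k = z k) :
    Good R B x q y ↔ Good R B x q z := by
  unfold Good
  refine exists_congr fun c => and_congr_right fun _ => forall₂_congr fun k hk => ?_
  rw [hyz k hk]

theorem conn_of_good (h : Balanced R B x) (hy : InFace B x y)
    (hg : ∀ i ∈ B, Good R B x (relClass R B x i) y) : Conn R B x y := by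
  suffices H : ∀ T ⊆ B, ∃ c, Conn R B x c ∧ ∀ k ∈ T, c k = y k by
    obtain ⟨c, hc, hcy⟩ := H B subset_rfl
    convert hc using 1
    ext1 k
    by_cases hk : k ∈ B
    · exact (hcy k hk).symm
    · rw [hy k hk, hc.inFace k hk]
  intro T
  induction T using Finset.induction_on with
  | empty => exact fun _ => ⟨x, .refl, by simp⟩
  | insert i T hiT ih =>
    intro hT
    have hi := hT (Finset.mem_insert_self i T)
    obtain ⟨c, hc, hcy⟩ := ih ((Finset.subset_insert i T).trans hT)
    obtain ⟨e, he, hey⟩ := hg i hi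
    refine ⟨(relClass R B x i).piecewise e c, hc.piecewise h ?_ he, ?_⟩
    · intro j hj k hk hjk
      rw [mem_relClass] at hj
      rw [Finset.mem_sdiff, mem_relClass] at hk
      exact hk.2 ⟨hk.1, hj.2.trans h hi hj.1 hk.1 hjk⟩
    · intro k hk
      by_cases hk' : k ∈ relClass R B x i
      · simp [hk', hey k hk']
      · have : k ≠ i := by
          rintro rfl
          exact hk' (mem_relClass.2 ⟨hi, related_refl hi⟩)
        simp [hk', hcy k (Finset.mem_of_mem_insert_of_ne hk this)]

open Classical in
/-- The colour of a point counts the bad classes modulo 2. -/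
theorem colour_eq_card (h : Balanced R B x) (hy : InFace B x y) :
    R y = R x + (((B.image (relClass R B x)).filter fun q => ¬Good R B x q y).card : ZMod 2) := by
  generalize hn : ((B.image (relClass R B x)).filter fun q => ¬Good R B x q y).card = n
  induction n generalizing y with
  | zero =>
    rw [Finset.card_eq_zero, Finset.filter_eq_empty_iff] at hn
    have : Conn R B x y := conn_of_good h hy fun i hi => by
      simpa using hn (Finset.mem_image_of_mem _ hi)
    simp [this.colour]
  | succ n ih =>
    have hpos : 0 < ((B.image (relClass R B x)).filter fun q => ¬Good R B x q y).card := by omega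
    obtain ⟨q, hq⟩ := Finset.card_pos.1 hpos
    have hq' := Finset.mem_filter.1 hq
    obtain ⟨j, hj, hjq⟩ := Finset.mem_image.1 hq'.1
    have hjmem : j ∈ q := by rw [← hjq]; exact mem_relClass.2 ⟨hj, related_refl hj⟩
    obtain ⟨c, hc, hcq, -⟩ := exists_conn_of_related (A := q) h hj
      (by rw [← hjq]; exact relClass_subset)
      (fun i hi => by
        rw [← hjq] at hi
        exact (mem_relClass.1 hi).2.symm) .refl y
    obtain ⟨δ, hδ, H⟩ := h c hc.inFace j hj
    have good_iff : ∀ v, (v = c j ∨ v = c j + δ) → Good R B x q (update y j v) := by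
      intro v hv
      refine ⟨update c j v, hc.step hj (((H v).2 hv).trans hc.colour), fun k hk => ?_⟩
      by_cases hkj : k = j
      · subst hkj; simp
      · simp [hkj, hcq k hk hkj]
    have hyj : ¬(y j = c j ∨ y j = c j + δ) := by
      intro hv
      have := good_iff _ hv
      rw [update_eq_self] at this
      exact hq'.2 this
    have val : ∀ v, (v = c j ∨ v = c j + δ) → R (update y j v) = R x + (n : ZMod 2) := by
      intro v hv
      refine ih (hy.update hj v) ?_
      have : ((B.image (relClass R B x)).filter fun q => ¬Good R B x q (update y j v)) =
          ((B.image (relClass R B x)).filter fun q => ¬Good R B x q y).erase q := by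
        ext q'
        simp only [Finset.mem_filter, Finset.mem_erase]
        by_cases hqq : q' = q
        · subst hqq
          simp [good_iff v hv]
        · simp only [hqq, ne_eq, not_false_eq_true, true_and]
          refine and_congr_right fun hq1 => not_congr (good_congr fun k hk => ?_)
          obtain ⟨i, hi, rfl⟩ := Finset.mem_image.1 hq1
          have : k ≠ j := by
            rintro rfl
            exact hqq (by rw [← hjq, relClass_eq h hi hk])
          simp [this]
      rw [this, Finset.card_erase_of_mem hq, hn, Nat.add_sub_cancel]
    obtain ⟨ε, hε, K⟩ := h _ (hy.update hj (c j)) j hj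
    have k1 := K (c j + δ)
    have k2 := K (y j)
    rw [update_idem, update_self] at k1 k2
    rw [val _ (.inl rfl)] at k1 k2
    rw [val _ (.inr rfl)] at k1
    have : δ = ε := by simpa [hδ] using k1
    subst this
    rw [update_eq_self] at k2
    have hne : R y ≠ R x + (n : ZMod 2) := fun e => hyj (k2.1 e)
    push_cast
    rw [← add_assoc]
    revert hne
    generalize R x + (n : ZMod 2) = s
    generalize R y = t
    revert s t
    decide

/-- A balanced colouring with a disconnected colour class is separable. -/
theorem exists_separable (h : Balanced R B x) (hy : InFace B x y) (hR : R y = R x)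
    (hn : ¬Conn R B x y) : ∃ A ⊆ B, A.Nonempty ∧ A ≠ B ∧ Separable R B x A := by
  classical
  have hB : B.Nonempty := by
    rw [Finset.nonempty_iff_ne_empty]
    rintro rfl
    have : y = x := by ext1 k; exact hy k (by simp)
    exact hn (this ▸ .refl)
  obtain ⟨i, hi⟩ := hB
  refine ⟨relClass R B x i, relClass_subset,
    ⟨i, mem_relClass.2 ⟨hi, related_refl hi⟩⟩, ?_, ?_⟩
  · intro hall
    obtain ⟨c, hc, hcy, hc'⟩ := exists_conn_of_related (A := B) h hi subset_rfl
      (fun k hk => by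
        rw [← hall] at hk
        exact (mem_relClass.1 hk).2.symm) .refl y
    have e : y = update c i (y i) := by
      ext1 k
      by_cases hki : k = i
      · subst hki; simp
      by_cases hk : k ∈ B
      · simp [hki, hcy k hk hki]
      · simp [hki, hc' k hk hki, hy k hk]
    rw [e] at hR hn
    exact hn (hc.step hi hR)
  · set q := relClass R B x i with hq
    have hqm : q ∈ B.image (relClass R B x) := Finset.mem_image_of_mem _ hi
    have count : ∀ z, InFace B x z → R z = R x + ((if Good R B x q z then 0 else 1) +
        ((((B.image (relClass R B x)).erase q).filter fun q => ¬Good R B x q z).card : ZMod 2)) := by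
      intro z hz
      rw [colour_eq_card h hz]
      congr 1
      conv_lhs => rw [← Finset.insert_erase hqm, Finset.filter_insert]
      by_cases hg : Good R B x q z
      · simp [hg]
      · rw [if_pos hg, if_neg hg, Finset.card_insert_of_notMem (by simp)]
        push_cast
        ring
    have rest : ∀ z z', (∀ k, k ∉ q → z k = z' k) →
        (((B.image (relClass R B x)).erase q).filter fun q => ¬Good R B x q z) =
        (((B.image (relClass R B x)).erase q).filter fun q => ¬Good R B x q z') := by
      intro z z' hzz
      refine Finset.filter_congr fun q' hq' => not_congr (good_congr fun k hk => hzz k fun hkq => ?_)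
      rw [Finset.mem_erase] at hq'
      obtain ⟨j, hj, rfl⟩ := Finset.mem_image.1 hq'.2
      exact hq'.1 (by rw [hq, ← relClass_eq h hi hkq, relClass_eq h hj hk])
    intro p p' b hp hp' hb hpp
    rw [count p hp, count p' hp', count _ (hp.piecewise hb q), count _ (hp'.piecewise hb q),
      rest p p' hpp, rest (q.piecewise p b) b (by simp +contextual),
      rest (q.piecewise p' b) b (by simp +contextual),
      good_congr (y := q.piecewise p b) (z := p) (by simp +contextual),
      good_congr (y := q.piecewise p' b) (z := p') (by simp +contextual)]
    have two : ∀ s a b c d : ZMod 2, s + (a + c) + (s + (b + c)) = s + (a + d) + (s + (b + d)) := by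
      decide
    apply two

end Colouring

/-! ### A face with a link is reducible or semilinear -/

section Separable

variable {ι : Type*} [DecidableEq ι]
variable {R : (ι → V) → ZMod 2} {J B A D : Finset ι} {x y z : ι → V} {i j k : ι}

theorem Balanced.mono (h : Balanced R J x) (hB : B ⊆ J) (hy : InFace J x y) : Balanced R B y :=
  fun z hz i hi => h z (hy.trans (hz.mono hB)) i (hB hi)

theorem separable_iff : Separable R B x A ↔ ∀ p q, InFace B x p → InFace B x q →
    R p + R q = R (A.piecewise p q) + R (A.piecewise q p) := by
  have two : ∀ a b c d : ZMod 2, a + b = c + d → a + d = c + b := by decide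
  constructor
  · intro h p q hp hq
    have := h p (A.piecewise q p) q hp (hq.piecewise hp A) hq fun i hi => by simp [hi]
    rw [show A.piecewise (A.piecewise q p) q = q by simp [Finset.piecewise_same]] at this
    exact two _ _ _ _ this
  · intro h p p' b hp hp' hb hpp
    have := h p (A.piecewise p' b) hp (hp'.piecewise hb A)
    have e : A.piecewise (A.piecewise p' b) p = p' := by
      ext1 i
      by_cases hi : i ∈ A <;> simp [hi, hpp]
    rw [e] at this
    refine two _ _ _ _ (this.trans ?_)
    simp

theorem Separable.sdiff_face (h : Separable R B x A) : Separable R B x (B \ A) := by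
  rw [separable_iff] at h ⊢
  have key : ∀ p q, InFace B x p → InFace B x q → (B \ A).piecewise p q = A.piecewise q p := by
    intro p q hp hq
    ext1 i
    by_cases hi : i ∈ B
    · by_cases h1 : i ∈ A <;> simp [h1, hi]
    · by_cases h1 : i ∈ A <;> simp [h1, hi, hp i hi, hq i hi]
  intro p q hp hq
  rw [key p q hp hq, key q p hq hp, h p q hp hq, add_comm]

theorem Separable.inter (h : Separable R B x A) (h' : Separable R B x D) :
    Separable R B x (A ∩ D) := by
  intro p p' b hp hp' hb hpp
  have e : ∀ q : ι → V, (A ∩ D).piecewise q b = D.piecewise (A.piecewise q b) b := by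
    intro q
    ext1 i
    by_cases h1 : i ∈ A <;> by_cases h2 : i ∈ D <;> simp [h1, h2]
  rw [e, e, h p p' b hp hp' hb fun i hi => hpp i fun h => hi (Finset.mem_inter.1 h).1]
  refine h' _ _ b (hp.piecewise hb A) (hp'.piecewise hb A) hb fun i hi => ?_
  by_cases h1 : i ∈ A
  · simp [h1, hpp i fun h => hi (Finset.mem_inter.1 h).2]
  · simp [h1]

theorem Separable.extend (h : Separable R J x B) (hy : InFace J x y)
    (h' : Separable R B y A) (hA : A ⊆ B) : Separable R J x A := by
  intro p p' b hp hp' hb hpp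
  have hf : ∀ q, InFace J x q → InFace B y (B.piecewise q y) := by
    intro q _ i hi
    simp [hi]
  have h1 := h p p' y hp hp' hy fun i hi => hpp i fun h => hi (hA h)
  have h2 := h (A.piecewise p b) (A.piecewise p' b) y (hp.piecewise hb A) (hp'.piecewise hb A) hy
    fun i hi => by
      have : i ∉ A := fun h => hi (hA h)
      simp [this]
  have h3 := h' (B.piecewise p y) (B.piecewise p' y) (B.piecewise b y) (hf p hp) (hf p' hp')
    (hf b hb) fun i hi => by
      by_cases hiB : i ∈ B
      · simp [hiB, hpp i hi]
      · simp [hiB]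
  have e : ∀ q : ι → V, B.piecewise (A.piecewise q b) y =
      A.piecewise (B.piecewise q y) (B.piecewise b y) := by
    intro q
    ext1 i
    by_cases hi : i ∈ A
    · simp [hi, hA hi]
    · by_cases hiB : i ∈ B <;> simp [hi, hiB]
  rw [h1, h2, h3, e, e]

theorem V.shift_of_balanced {f : V → ZMod 2} {c δ : V} (h : ∀ v, f v = f c ↔ v = c ∨ v = c + δ)
    (v : V) : f (v + δ) = f v := by
  have coset : ∀ v c δ : V, (v + δ = c ∨ v + δ = c + δ) ↔ (v = c ∨ v = c + δ) := by decide
  have two : ∀ a b c : ZMod 2, (a = c ↔ b = c) → a = b := by decide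
  exact two _ _ (f c) (by rw [h, h, coset])

theorem Separable.of_shift (h : Balanced R B x) (hi : i ∈ B) {δ : V} (hδ : δ ≠ 0)
    (hs : ∀ y, InFace B x y → R (update y i (y i + δ)) = R y) : Separable R B x {i} := by
  have key : ∀ y, InFace B x y → ∀ v, R (update y i v) = R y ↔ v = y i ∨ v = y i + δ := by
    intro y hy v
    obtain ⟨ε, hε, H⟩ := h y hy i hi
    have := (H _).1 (hs y hy)
    have : δ = ε := by simpa [hδ] using this
    rw [this, H]
  have two : ∀ a b c d : ZMod 2, (b = a ↔ d = c) → a + b = c + d := by decide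
  intro p p' b hp hp' hb hpp
  apply two
  have e1 : p' = update p i (p' i) := by
    ext1 k
    by_cases hk : k = i
    · subst hk; simp
    · simp [hk, hpp k (by simpa using hk)]
  have e2 : ({i} : Finset ι).piecewise p' b = update (({i} : Finset ι).piecewise p b) i (p' i) := by
    ext1 k
    by_cases hk : k = i
    · subst hk; simp
    · simp [hk]
  rw [e2, key _ (hp.piecewise hb _)]
  conv_lhs => rw [e1]
  rw [key p hp]
  simp

theorem Separable.shift (h : Separable R B x {i}) (hb : Balanced R B x) (hi : i ∈ B) :
    ∃ δ : V, δ ≠ 0 ∧ ∀ y, InFace B x y → R (update y i (y i + δ)) = R y := by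
  obtain ⟨δ, hδ, H⟩ := hb x (InFace.refl B x) i hi
  refine ⟨δ, hδ, fun y hy => ?_⟩
  have h1 := V.shift_of_balanced (f := fun v => R (update x i v)) (c := x i) (δ := δ)
    (fun v => by simpa using H v) (y i)
  have h2 := h (update y i (y i + δ)) y x (hy.update hi _) hy (InFace.refl B x) fun k hk => by
    simp [show k ≠ i by simpa using hk]
  have e : ∀ q : ι → V, ({i} : Finset ι).piecewise q x = update x i (q i) := by
    intro q
    rw [Finset.piecewise_singleton]
  rw [e, e, update_self] at h2
  have two : ∀ a b c d : ZMod 2, a + b = c + d → c = d → a = b := by decide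
  exact two _ _ _ _ h2 h1

end Separable

section Link

variable {ι : Type*} [DecidableEq ι]
variable {M : Set (ι → V)} {J B : Finset ι} {x y z : ι → V} {i a a' : ι} {π ρ : V}

open Classical in
/-- The colour of a point: `0` if one of its two `π`-translates in direction `a` is in `M`. -/
noncomputable def colour (M : Set (ι → V)) (a : ι) (π : V) (y : ι → V) : ZMod 2 :=
  if y ∈ M ∨ update y a (y a + π) ∈ M then 0 else 1

theorem colour_eq_zero : colour M a π y = 0 ↔ y ∈ M ∨ update y a (y a + π) ∈ M := by
  unfold colour
  split_ifs with h <;> simp [h]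

theorem colour_eq_iff : colour M a π y = colour M a π z ↔
    ((y ∈ M ∨ update y a (y a + π) ∈ M) ↔ (z ∈ M ∨ update z a (z a + π) ∈ M)) := by
  rw [← colour_eq_zero, ← colour_eq_zero]
  generalize colour M a π y = s
  generalize colour M a π z = t
  revert s t
  decide

theorem colour_update : colour M a π (update y a (y a + π)) = colour M a π y := by
  rw [colour_eq_iff]
  simp only [update_self, update_idem, V.add_add_cancel, update_eq_self]
  exact or_comm

theorem V.pair_iff : ∀ v₁ v₂ u v : V, v₁ ≠ v₂ →
    (((v = v₁ ∨ v = v₂) ↔ (u = v₁ ∨ u = v₂)) ↔ (v = u ∨ v = u + (v₁ + v₂))) := by decide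

theorem IsCode.eq_of_update (hM : IsCode M) {b c : V} (h : update y i b ∈ M)
    (h' : update y i c ∈ M) : b = c := (hM y i).unique h h'

theorem balanced_colour (hM : IsCode M) (hπ : π ≠ 0) : Balanced (colour M a π) J x := by
  intro y _ i _
  suffices H : ∃ v₁ v₂ : V, v₁ ≠ v₂ ∧ ∀ v, colour M a π (update y i v) = 0 ↔ v = v₁ ∨ v = v₂ by
    obtain ⟨v₁, v₂, hne, H⟩ := H
    refine ⟨v₁ + v₂, fun h => hne ?_, fun v => ?_⟩
    · rw [← V.add_add_cancel v₁ v₂, h, zero_add]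
    · have h1 := H v
      have h2 := H (y i)
      rw [update_eq_self] at h2
      rw [← V.pair_iff v₁ v₂ (y i) v hne, ← h1, ← h2]
      generalize colour M a π (update y i v) = s
      generalize colour M a π y = t
      revert s t
      decide
  simp only [colour_eq_zero]
  by_cases hi : i = a
  · subst hi
    obtain ⟨c, hc⟩ := hM.exists_mem y i
    have hv : ∀ v, update y i v ∈ M ↔ v = c := fun v =>
      ⟨fun h => hM.eq_of_update h hc, fun h => h ▸ hc⟩
    refine ⟨c, c + π, by simpa using hπ, fun v => ?_⟩
    simp only [update_self, update_idem, hv]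
    rw [V.eq_add_iff (a := v)]
  · obtain ⟨c, hc⟩ := hM.exists_mem y i
    obtain ⟨d, hd⟩ := hM.exists_mem (update y a (y a + π)) i
    have hv : ∀ v, update y i v ∈ M ↔ v = c := fun v =>
      ⟨fun h => hM.eq_of_update h hc, fun h => h ▸ hc⟩
    have hv' : ∀ v, update (update y a (y a + π)) i v ∈ M ↔ v = d := fun v =>
      ⟨fun h => hM.eq_of_update h hd, fun h => h ▸ hd⟩
    refine ⟨c, d, ?_, fun v => ?_⟩
    · rintro rfl
      rw [update_comm (Ne.symm hi)] at hd
      have h1 : update (update y i c) a (y a) ∈ M := by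
        rw [← update_comm (Ne.symm hi), update_eq_self]; exact hc
      have := hM.eq_of_update hd h1
      exact hπ (by simpa using this)
    · rw [hv, update_of_ne (Ne.symm hi), update_comm hi, hv']

theorem colour_update_other (h : Stab M J x (lk a π a' ρ)) (haa : a ≠ a') (ha : a ∈ J)
    (ha' : a' ∈ J) (hy : InFace J x y) :
    colour M a π (update y a' (y a' + ρ)) = colour M a π y := by
  have key : ∀ z, InFace J x z → z ∈ M → update (update z a' (z a' + ρ)) a (z a + π) ∈ M := by
    intro z hz hzM
    convert h z hz hzM using 1
    ext1 k
    by_cases hk : k = a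
    · subst hk; simp [lk_left]
    · by_cases hk' : k = a'
      · subst hk'; simp [lk_right haa, hk]
      · simp [lk_other hk hk', hk, hk']
  have imp : ∀ z, InFace J x z → (z ∈ M ∨ update z a (z a + π) ∈ M) →
      (update z a' (z a' + ρ) ∈ M ∨
        update (update z a' (z a' + ρ)) a (update z a' (z a' + ρ) a + π) ∈ M) := by
    intro z hz hzM
    rw [update_of_ne haa]
    rcases hzM with hzM | hzM
    · exact .inr (key z hz hzM)
    · left
      have := key _ (hz.update ha _) hzM
      rw [update_comm haa, update_idem, update_self, V.add_add_cancel, update_of_ne haa.symm,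
        update_comm haa.symm, update_eq_self] at this
      exact this
  rw [colour_eq_iff]
  refine ⟨fun hm => ?_, imp y hy⟩
  have := imp _ (hy.update ha' _) hm
  simpa [V.add_add_cancel] using this

/-- Along a step between two points of colour `0`, membership in `M` alternates. -/
theorem mem_iff_not_mem_of_step (hM : IsCode M) (hia : i ≠ a) {v : V} (hv : v ≠ y i)
    (h0 : colour M a π y = 0) (h1 : colour M a π (update y i v) = 0) :
    update y i v ∈ M ↔ y ∉ M := by
  constructor
  · intro h h'
    exact hv (hM.eq_of_update h (by simpa using h'))
  · intro h
    have h0' := (colour_eq_zero.1 h0).resolve_left h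
    rcases colour_eq_zero.1 h1 with h1 | h1
    · exact h1
    · rw [update_of_ne hia.symm, update_comm hia] at h1
      refine absurd (hM.eq_of_update h1 (c := y i) ?_) hv
      rwa [show update (update y a (y a + π)) i (y i) = update y a (y a + π) by
        rw [update_eq_self_iff]; simp [hia]]

/-- A separable set avoiding `a` with connected colour classes decomposes `M`. -/
theorem split_of_conn (hM : IsCode M) (hB : B ⊆ J) (haB : a ∉ B)
    (hs : Separable (colour M a π) J x B)
    (hc : ∀ p q, InFace J x p → InFace B p q → colour M a π p = colour M a π q →
      Conn (colour M a π) B p q) : Split M J x B := by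
  intro p q hp hq hpM h1 h2
  have c0 : ∀ {r}, r ∈ M → colour M a π r = 0 := fun h => colour_eq_zero.2 (.inl h)
  have hw := hc p (B.piecewise q p) hp (fun i hi => by simp [hi]) (by rw [c0 hpM, c0 h1])
  have key : ∀ r, Conn (colour M a π) B p r → (r ∈ M ↔ B.piecewise r q ∈ M) := by
    intro r hr
    induction hr with
    | refl => exact iff_of_true hpM h2
    | @tail b c hb hst ih =>
      obtain ⟨i, hi, v, rfl, hv⟩ := hst
      have hia : i ≠ a := fun e => haB (e ▸ hi)
      have hbc : Conn (colour M a π) B p b := hb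
      have zero : ∀ r, Conn (colour M a π) B p r → colour M a π r = 0 ∧
          colour M a π (B.piecewise r q) = 0 := by
        intro r hr
        have hr0 : colour M a π r = 0 := hr.colour.trans (c0 hpM)
        have := hs r p q (hp.trans (hr.inFace.mono hB)) hp hq fun i hi => hr.inFace i hi
        rw [hr0, c0 hpM, c0 h2, add_zero, add_zero] at this
        exact ⟨hr0, this.symm⟩
      have z1 := zero b hbc
      have z2 := zero _ (hbc.step hi (hv.trans hbc.colour))
      have e : B.piecewise (update b i v) q = update (B.piecewise b q) i v := by
        ext1 k
        by_cases hk : k = i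
        · subst hk; simp [hi]
        · by_cases hkB : k ∈ B <;> simp [hk, hkB]
      by_cases hvb : v = b i
      · subst hvb; simpa using ih
      · rw [e] at z2 ⊢
        rw [mem_iff_not_mem_of_step hM hia hvb z1.1 z2.1,
          mem_iff_not_mem_of_step hM hia (by simpa [hi] using hvb) z1.2 z2.2, ih]
  have := (key _ hw).1 h1
  convert this using 1
  ext1 k
  by_cases hk : k ∈ B <;> simp [hk]

theorem red_or_semi_of_link (hM : IsCode M) (haa : a ≠ a') (ha : a ∈ J) (ha' : a' ∈ J)
    (hπ : π ≠ 0) (h : Stab M J x (lk a π a' ρ)) : Red M J x ∨ Semi M J x := by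
  have hρ : ρ ≠ 0 := lk_ne_zero hM h haa ha hπ
  have hb : Balanced (colour M a π) J x := balanced_colour hM hπ
  have sa : Separable (colour M a π) J x {a} :=
    Separable.of_shift hb ha hπ fun y _ => colour_update
  have sa' : Separable (colour M a π) J x {a'} :=
    Separable.of_shift hb ha' hρ fun y hy => colour_update_other h haa ha ha' hy
  by_cases hall : ∀ i ∈ J, Separable (colour M a π) J x {i}
  · right
    have := fun i (hi : i ∈ J) => (hall i hi).shift hb hi
    choose! δ hδ0 hδ using this
    refine ⟨update δ a π, IsClass.of_hub ha (fun i hi => ?_) fun i hi hia => ?_⟩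
    · by_cases hia : i = a
      · subst hia; simpa using hπ
      · simpa [hia] using hδ0 i hi
    · rw [update_self, update_of_ne hia]
      intro y hy hyM
      have h0 : colour M a π (update y i (y i + δ i)) = 0 := by
        rw [hδ i hi y hy]; exact colour_eq_zero.2 (.inl hyM)
      have h1 : update y i (y i + δ i) ∉ M := fun h' => by
        have := hM.eq_of_update h' (c := y i) (by simpa using hyM)
        exact hδ0 i hi (by simpa using this)
      have h2 := (colour_eq_zero.1 h0).resolve_left h1
      convert h2 using 1
      ext1 k
      by_cases hk : k = i
      · subst hk; simp [lk_left, hia]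
      · by_cases hka : k = a
        · subst hka; simp [lk_right hia, hk]
        · simp [lk_other hk hka, hk, hka]
  left
  push Not at hall
  obtain ⟨i, hi, hns⟩ := hall
  have hia : i ≠ a := fun e => hns (e ▸ sa)
  have hia' : i ≠ a' := fun e => hns (e ▸ sa')
  have hex : ∃ n, ∃ B ⊆ J, B.card = n ∧ i ∈ B ∧ a ∉ B ∧ a' ∉ B ∧
      Separable (colour M a π) J x B :=
    ⟨_, (J \ {a}) ∩ (J \ {a'}), fun k hk => by simp at hk; exact hk.1.1, rfl,
      by simp [hi, hia, hia'], by simp, by simp, sa.sdiff_face.inter sa'.sdiff_face⟩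
  classical
  obtain ⟨B, hBJ, hBn, hiB, haB, haB', hBs⟩ := Nat.find_spec hex
  have hmin : ∀ D ⊂ B, i ∈ D → ¬Separable (colour M a π) J x D := fun D hD hiD hDs =>
    Nat.find_min hex (m := D.card) (hBn ▸ Finset.card_lt_card hD)
      ⟨D, hD.1.trans hBJ, rfl, hiD, fun h => haB (hD.1 h), fun h => haB' (hD.1 h), hDs⟩
  have hsplit : Split M J x B := by
    refine split_of_conn hM hBJ haB hBs fun p q hp hq hpq => ?_
    by_contra hcon
    obtain ⟨A, hA, hAne, hAB, hAs⟩ := exists_separable (hb.mono hBJ hp) hq hpq.symm hcon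
    have hAs' := hBs.extend hp hAs hA
    by_cases hiA : i ∈ A
    · exact hmin A (hA.ssubset_of_ne hAB) hiA hAs'
    · refine hmin (B ∩ (J \ A)) ?_ (by simp [hiB, hi, hiA]) (hBs.inter hAs'.sdiff_face)
      refine Finset.inter_subset_left.ssubset_of_ne fun e => ?_
      obtain ⟨k, hk⟩ := hAne
      have := hA hk
      rw [← e] at this
      simp [hk] at this
  refine ⟨B, hBJ, ?_, ?_, hsplit⟩
  · by_contra hlt
    have : B = {i} := by
      symm
      apply Finset.eq_of_subset_of_card_le (by simpa using hiB)
      simp; omega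
    exact hns (this ▸ hBs)
  · rw [← Finset.card_pair haa]
    apply Finset.card_le_card
    intro k hk
    simp at hk
    rcases hk with rfl | rfl <;> simp [*]

end Link

/-! ### Minimal counterexamples -/

section Critical

variable {ι : Type*} [DecidableEq ι]
variable {M : Set (ι → V)} {J I A S G : Finset ι} {x y z : ι → V} {i j a a' t w c d : ι} {π ρ : V}

/-- The face `(J, x)` is a minimal counterexample to the main theorem. -/
structure Critical (M : Set (ι → V)) (J : Finset ι) (x : ι → V) : Prop where
  isCode : IsCode M
  five_le : 5 ≤ J.card
  not_red : ¬Red M J x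
  not_semi : ¬Semi M J x
  smaller : ∀ I ⊂ J, ∀ z, Red M I z ∨ Semi M I z

theorem Critical.congr (h : Critical M J x) (hy : InFace J x y) : Critical M J y where
  isCode := h.isCode
  five_le := h.five_le
  not_red := fun hr => h.not_red (hr.congr hy.symm)
  not_semi := fun ⟨π, hπ⟩ => h.not_semi ⟨π, hπ.mono subset_rfl hy.symm⟩
  smaller := h.smaller

theorem Critical.not_link (h : Critical M J x) (hij : i ≠ j) (hi : i ∈ J) (hj : j ∈ J)
    (hπ : π ≠ 0) : ¬Stab M J x (lk i π j ρ) := fun hs =>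
  (red_or_semi_of_link h.isCode hij hi hj hπ hs).elim h.not_red h.not_semi

theorem exists_mem_of_card_lt (A : Finset ι) (h : A.card < J.card) : ∃ s ∈ J, s ∉ A := by
  by_contra! hc
  exact absurd (Finset.card_le_card (fun s hs => hc s hs : J ⊆ A)) (by omega)

/-- A minimal counterexample has a reducible layer. -/
theorem Critical.exists_red_layer (h : Critical M J x) :
    ∃ t ∈ J, ∃ y, InFace J x y ∧ Red M (J.erase t) y := by
  by_contra! hcon
  have h5 := h.five_le
  have hM := h.isCode
  have hsemi : ∀ t ∈ J, ∀ y, Semi M (J.erase t) y ∨ ¬InFace J x y := by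
    intro t ht y
    by_cases hy : InFace J x y
    · exact .inl ((h.smaller _ (Finset.erase_ssubset ht) y).resolve_left (hcon t ht y hy))
    · exact .inr hy
  obtain ⟨t, ht, -⟩ := exists_mem_of_card_lt (J := J) ∅ (by rw [Finset.card_empty]; omega)
  obtain ⟨a, ha, hat⟩ := exists_mem_of_card_lt (J := J) {t} (by simp; omega)
  obtain ⟨a', ha', hat'⟩ := exists_mem_of_card_lt (J := J) {t, a}
    (lt_of_le_of_lt Finset.card_le_two (by omega))
  obtain ⟨s, hs, hst⟩ := exists_mem_of_card_lt (J := J) {t, a, a'}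
    (lt_of_le_of_lt Finset.card_le_three (by omega))
  simp only [Finset.mem_insert, Finset.mem_singleton, not_or] at hat hat' hst
  obtain ⟨X, hX⟩ := (hsemi t ht x).resolve_right (not_not.2 (InFace.refl J x))
  have hXa : X a ≠ 0 := hX.1 a (by simp [ha, hat])
  have hnl := h.not_link (Ne.symm hat'.2) ha ha' hXa (ρ := X a')
  unfold Stab at hnl
  push Not at hnl
  obtain ⟨y, hy, hyM, hyn⟩ := hnl
  obtain ⟨Y, hY⟩ := (hsemi s hs y).resolve_right (not_not.2 hy)
  have hz1 : InFace (J.erase t) x (update y t (x t)) := by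
    intro k hk
    by_cases hkt : k = t
    · subst hkt; simp
    · rw [update_of_ne hkt, hy k fun h => hk (by simp [hkt, h])]
  have hz2 : InFace (J.erase s) y (update y t (x t)) :=
    (InFace.refl _ _).update (by simp [ht, Ne.symm hst.1]) _
  have hJz : InFace J x (update y t (x t)) := hy.update ht _
  set z := update y t (x t)
  have X2 := hX.2 a (by simp [ha, hat]) a' (by simp [ha', hat'.1]) (Ne.symm hat'.2)
  have Y2 := hY.2 a (by simp [ha, Ne.symm hst.2.1]) a' (by simp [ha', Ne.symm hst.2.2])
    (Ne.symm hat'.2)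
  have hne : X a ≠ Y a := by
    intro e
    rw [← e] at Y2
    have := lk_unique hM X2 Y2 (Ne.symm hat'.2) hz1 hz2 (by simp [ha, hat])
      (by simp [ha, Ne.symm hst.2.1])
    rw [← this] at Y2
    exact hyn (Y2 y (InFace.refl _ _) hyM)
  have hne' : X a' ≠ Y a' := by
    intro e
    rw [← e] at Y2
    have := lk_unique hM (X2.lk_symm (Ne.symm hat'.2)) (Y2.lk_symm (Ne.symm hat'.2)) hat'.2 hz1 hz2
      (by simp [ha', hat'.1]) (by simp [ha', Ne.symm hst.2.2])
    exact hne this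
  have hXz := hX.mono subset_rfl hz1
  have hYz := hY.mono subset_rfl hz2
  obtain ⟨c, hc⟩ := exists_unique_slice hM hXz (a := a)
    (by rw [Finset.card_erase_of_mem ht]; omega) (by simp [ha, hat]) (hcon t ht z hJz)
  obtain ⟨d, hd⟩ := exists_unique_slice hM hYz (a := a)
    (by rw [Finset.card_erase_of_mem hs]; omega) (by simp [ha, Ne.symm hst.2.1]) (hcon s hs z hJz)
  obtain ⟨e, he1, he2⟩ := V.cosets_meet c d (X a) (Y a) hXa (hY.1 a (by simp [ha, Ne.symm hst.2.1]))
    hne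
  obtain ⟨Z, hZ⟩ := (hsemi a ha (update z a e)).resolve_right (not_not.2 (hJz.update ha e))
  have hsub : ∀ s, (J.erase s).erase a ⊆ J.erase a := fun s =>
    Finset.erase_subset_erase a (Finset.erase_subset s J)
  have h1 := hc e he1 Z (hZ.mono (hsub t) (InFace.refl _ _)) a' (by simp [ha', hat'])
  have h2 := hd e he2 Z (hZ.mono (hsub s) (InFace.refl _ _)) a'
    (by simp [ha', hat', Ne.symm hst.2.2])
  exact hne' (h1.symm.trans h2)

/-- A decomposition `S` of the layer of `J` through `x` in direction `t`. -/
structure Layer (M : Set (ι → V)) (J : Finset ι) (x : ι → V) (t : ι) (S : Finset ι) : Prop where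
  crit : Critical M J x
  mem : t ∈ J
  subset : S ⊆ J.erase t
  two_le : 2 ≤ S.card
  two_le_compl : 2 ≤ (J.erase t \ S).card
  split : Split M (J.erase t) x S
  minimal : ∀ A ⊆ J.erase t, 2 ≤ A.card → 2 ≤ (J.erase t \ A).card → Split M (J.erase t) x A →
    S.card ≤ A.card

theorem Critical.exists_layer (h : Critical M J x) :
    ∃ t S y, InFace J x y ∧ Layer M J y t S := by
  obtain ⟨t, ht, y, hy, hr⟩ := h.exists_red_layer
  have hex : ∃ n, ∃ A ⊆ J.erase t, A.card = n ∧ 2 ≤ A.card ∧ 2 ≤ (J.erase t \ A).card ∧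
      Split M (J.erase t) y A := by
    obtain ⟨A, hA, h2, h3, hs⟩ := hr
    exact ⟨_, A, hA, rfl, h2, h3, hs⟩
  classical
  obtain ⟨S, hS, hn, h2, h3, hs⟩ := Nat.find_spec hex
  refine ⟨t, S, y, hy, h.congr hy, ht, hS, h2, h3, hs, fun A hA h2 h3 hs => ?_⟩
  by_contra hlt
  exact Nat.find_min hex (m := A.card) (by omega) ⟨A, hA, rfl, h2, h3, hs⟩

/-- A link between the two parts of a decomposition of `G` by `{t, d}` that holds for one value
of `t` and on one small face holds on `G`. -/
theorem Split.stab_of_triple (hM : IsCode M) {c₂ : ι} {π₂ : V} {z' : ι → V}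
    (hs : Split M G z {t, d}) (ht : t ∈ G) (hd : d ∈ G) (hc : c ∈ G) (htd : t ≠ d) (hct : c ≠ t)
    (hcd : c ≠ d) (hct₂ : c₂ ≠ t) (hcd₂ : c₂ ≠ d) (hc₂ : c₂ ∈ G)
    (hz' : InFace G z z') (hy : InFace G z y)
    (h : Stab M (G.erase t) z' (lk c π d ρ)) (h₂ : Stab M (G.erase t) z' (lk c₂ π₂ d ρ))
    (h3 : Stab M {c, d, t} y (lk c π d ρ)) : Stab M G z (lk c₂ π₂ d ρ) := by
  intro p hp hpM
  -- `u` agrees with `p` at `t` and `d`, and lies in the small face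
  obtain ⟨u, huM, hu, hue⟩ := hM.exists_inFace (J := {c, d, t}) (x := y)
    (y := ({t, d} : Finset ι).piecewise p y) (i := c)
    (by intro k hk; simp at hk; simp [hk]) (by simp)
  have hsub : ({c, d, t} : Finset ι) ⊆ G := by
    intro k hk; simp at hk; rcases hk with rfl | rfl | rfl <;> assumption
  have huG : InFace G z u := hy.trans (hu.mono hsub)
  have hut : u t = p t := by rw [hue t hct.symm]; simp
  have hud : u d = p d := by rw [hue d hcd.symm]; simp
  -- `r` agrees with `p` outside `t` and `d`, and with `z'` at `t`
  obtain ⟨r, hrM, hr, hre⟩ := hM.exists_inFace (J := G) (x := z)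
    (y := update p t (z' t)) (i := d) (hp.update ht _) hd
  have hrt : r t = z' t := by rw [hre t htd]; simp
  have hro : ∀ k, k ≠ t → k ≠ d → r k = p k := fun k hk hk' => by rw [hre k hk']; simp [hk]
  have inL : ∀ q, InFace G z q → q t = z' t → InFace (G.erase t) z' q := by
    intro q hq hqt k hk
    by_cases hkt : k = t
    · rw [hkt, hqt]
    · have : k ∉ G := fun h => hk (by simp [hkt, h])
      rw [hq k this, hz' k this]
  have hr₂ := h₂ r (inL r hr hrt) hrM
  set r' := ({t, d} : Finset ι).piecewise r u with hr'
  have hr'G : InFace G z r' := hr.piecewise huG _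
  have hr'M : r' ∈ M := by
    refine hs p r' hp hr'G hpM ?_ ?_
    · convert hrM using 1
      ext1 k
      by_cases hkt : k = t
      · subst hkt; simp [hr']
      by_cases hkd : k = d
      · subst hkd; simp [hr']
      · simp [hkt, hkd, hro]
    · convert huM using 1
      ext1 k
      by_cases hkt : k = t
      · subst hkt; simp [hut]
      by_cases hkd : k = d
      · subst hkd; simp [hud]
      · simp [hr', hkt, hkd]
  have hr'' := h r' (inL r' hr'G (by simp [hr', hrt])) hr'M
  refine hs _ _ (inFace_lk hr'G hc hd) (inFace_lk hp hc₂ hd) hr'' ?_ ?_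
  · convert h3 u hu huM using 1
    ext1 k
    by_cases hkt : k = t
    · subst hkt; simp [lk_other hct.symm htd, lk_other hct₂.symm htd, hut]
    by_cases hkd : k = d
    · subst hkd; simp [lk_right hcd, lk_right hcd₂, hud]
    · simp [hr', hkt, hkd]
  · convert hr₂ using 1
    ext1 k
    by_cases hkt : k = t
    · subst hkt; simp [lk_other hct.symm htd, lk_other hct₂.symm htd, hr']
    by_cases hkd : k = d
    · subst hkd; simp [lk_right hcd, lk_right hcd₂, hr']
    · simp [hkt, hkd, hro]

end Critical

/-! ### A layer with a large minimal part -/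

section Large

variable {ι : Type*} [DecidableEq ι]
variable {M : Set (ι → V)} {J I A S G : Finset ι} {x y z : ι → V} {i j a a' t w c d : ι} {π ρ : V}

theorem Layer.t_notMem (h : Layer M J x t S) : t ∉ S := fun hS => by
  simpa using h.subset hS

theorem Layer.insert_subset (h : Layer M J x t S) (hw : w ∈ J.erase t \ S) :
    insert w S ⊆ J.erase t :=
  Finset.insert_subset (Finset.mem_sdiff.1 hw).1 h.subset

/-- The face spanned by `S`, `t` and one more direction. -/
theorem Layer.block_ssubset (h : Layer M J x t S) (hw : w ∈ J.erase t \ S) :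
    insert t (insert w S) ⊂ J := by
  have hsub : insert t (insert w S) ⊆ J :=
    Finset.insert_subset h.mem ((h.insert_subset hw).trans (Finset.erase_subset t J))
  refine hsub.ssubset_of_ne fun e => ?_
  obtain ⟨w', hw', hne⟩ := exists_mem_of_card_lt (J := J.erase t \ S) {w}
    (by have := h.two_le_compl; simp; omega)
  rw [Finset.mem_sdiff, Finset.mem_erase] at hw'
  have := hw'.1.2
  rw [← e] at this
  simp at this hne
  tauto

theorem inFace_update_layer (ht : t ∈ G) (hz : InFace J x z) :
    InFace (J.erase t) x (update z t (x t)) ∧ InFace G z (update z t (x t)) := by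
  refine ⟨fun k hk => ?_, (InFace.refl G z).update ht _⟩
  by_cases hkt : k = t
  · subst hkt; simp
  · rw [update_of_ne hkt, hz k fun h => hk (by simp [hkt, h])]

/-- By minimality of `S`, the faces of the layer spanned by `S` and one more direction are
irreducible. -/
theorem Layer.not_red (h : Layer M J x t S) (hw : w ∈ J.erase t \ S)
    (hz : InFace (J.erase t) x z) : ¬Red M (insert w S) z := by
  rintro ⟨A, hA, h2, h3, hs⟩
  have hwS : w ∉ S := (Finset.mem_sdiff.1 hw).2
  -- the part not containing `w`
  obtain ⟨D, hD, hwD, hD2, hD3, hDs⟩ : ∃ D ⊆ insert w S, w ∉ D ∧ 2 ≤ D.card ∧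
      2 ≤ (insert w S \ D).card ∧ Split M (insert w S) z D := by
    by_cases hwA : w ∈ A
    · refine ⟨insert w S \ A, Finset.sdiff_subset, by simp [hwA], h3, ?_, hs.compl⟩
      rwa [Finset.sdiff_sdiff_eq_self hA]
    · exact ⟨A, hA, hwA, h2, h3, hs⟩
  have hDS : D ⊆ S := fun k hk => Finset.mem_of_mem_insert_of_ne (hD hk) fun e => hwD (e ▸ hk)
  have hsp := h.split.comp h.crit.isCode h.subset (Finset.mem_sdiff.1 hw).1 hwS hDS hz hDs
  have hlt : D.card < S.card := by
    rw [Finset.card_sdiff_of_subset hD, Finset.card_insert_of_notMem hwS] at hD3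
    omega
  refine absurd (h.minimal D (hDS.trans h.subset) hD2 ?_ hsp) (by omega)
  exact h.two_le_compl.trans (Finset.card_le_card (Finset.sdiff_subset_sdiff subset_rfl hDS))

theorem Layer.exists_compl (h : Layer M J x t S) : ∃ w, w ∈ J.erase t \ S :=
  Finset.card_pos.1 (by have := h.two_le_compl; omega)

/-- If `S` has at least three elements, its directions are linked in the layer, and every class of a
larger face extends these links. -/
theorem Layer.exists_class (h : Layer M J x t S) (h3 : 3 ≤ S.card) : ∃ X : ι → V,
    IsClass M S x X ∧ (∀ i ∈ S, ∀ j ∈ S, i ≠ j → Stab M (J.erase t) x (lk i (X i) j (X j))) ∧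
    ∀ w ∈ J.erase t \ S, ∀ z, InFace (J.erase t) x z → ∀ Z, IsClass M (insert w S) z Z →
      ∀ i ∈ S, Z i = X i := by
  have hM := h.crit.isCode
  obtain ⟨w₀, hw₀⟩ := h.exists_compl
  have hsm : ∀ w ∈ J.erase t \ S, insert w S ⊂ J := fun w hw =>
    (Finset.subset_insert t _).trans_ssubset (h.block_ssubset hw)
  obtain ⟨X, hX⟩ := (h.crit.smaller _ (hsm w₀ hw₀) x).resolve_left
    (h.not_red hw₀ (InFace.refl _ x))
  have links : ∀ i ∈ S, ∀ j ∈ S, i ≠ j → Stab M (J.erase t) x (lk i (X i) j (X j)) := by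
    intro i hi j hj hij
    exact h.split.stab hM h.subset (Finset.mem_sdiff.1 hw₀).1 (Finset.mem_sdiff.1 hw₀).2
      (lk_supp hi hj) (hX.2 i (by simp [hi]) j (by simp [hj]) hij)
  refine ⟨X, hX.mono (Finset.subset_insert _ _) (InFace.refl _ _), links,
    fun w hw z hz Z hZ i hi => ?_⟩
  obtain ⟨j, hj, hji⟩ := exists_mem_of_card_lt (J := S) {i} (by simp; omega)
  have hij : i ≠ j := fun e => hji (by simp [e])
  refine link_unique_of_not_red hM ?_ (h.not_red hw hz) hij (by simp [hi]) (by simp [hj])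
    (hZ.2 i (by simp [hi]) j (by simp [hj]) hij) ((links i hi j hj hij).mono (h.insert_subset hw) hz)
    (hZ.1 i (by simp [hi])) (hX.1 i (by simp [hi]))
  rw [Finset.card_insert_of_notMem (Finset.mem_sdiff.1 hw).2]
  omega

/-- A decomposition of `insert t K` with `K` irreducible in the layer separates `t` and one more
direction. -/
theorem exists_split_pair {K : Finset ι} (htK : t ∉ K) (hz : InFace (insert t K) y z)
    (hK : ¬Red M K z) (hr : Red M (insert t K) y) : ∃ d ∈ K, Split M (insert t K) y {t, d} := by
  obtain ⟨A, hA, h2, h3, hs⟩ := hr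
  obtain ⟨D, hD, htD, hD2, hD3, hDs⟩ : ∃ D ⊆ insert t K, t ∈ D ∧ 2 ≤ D.card ∧
      2 ≤ (insert t K \ D).card ∧ Split M (insert t K) y D := by
    by_cases htA : t ∈ A
    · exact ⟨A, hA, htA, h2, h3, hs⟩
    · refine ⟨insert t K \ A, Finset.sdiff_subset, by simp [htA], h3, ?_, hs.compl⟩
      rwa [Finset.sdiff_sdiff_eq_self hA]
  have e1 : K ∩ D = D.erase t := by
    ext k
    simp only [Finset.mem_inter, Finset.mem_erase]
    refine ⟨fun hk => ⟨fun e => htK (e ▸ hk.1), hk.2⟩, fun hk => ⟨?_, hk.2⟩⟩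
    exact Finset.mem_of_mem_insert_of_ne (hD hk.2) hk.1
  have e2 : K \ D = insert t K \ D := by
    ext k
    simp only [Finset.mem_sdiff, Finset.mem_insert]
    refine ⟨fun hk => ⟨.inr hk.1, hk.2⟩, fun hk => ⟨hk.1.resolve_left fun e => hk.2 (e ▸ htD), hk.2⟩⟩
  have hcard : (D.erase t).card = 1 := by
    have h1 : (D.erase t).card = D.card - 1 := Finset.card_erase_of_mem htD
    by_contra hne
    refine hK (Red.of_split (hDs.mono (Finset.subset_insert t K) hz) ?_ ?_)
    · rw [e1]; omega
    · rw [e2]; exact hD3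
  obtain ⟨d, hd⟩ := Finset.card_eq_one.1 hcard
  have hdD : d ∈ D.erase t := by simp [hd]
  have hDe : D = {t, d} := by rw [← Finset.insert_erase htD, hd]
  refine ⟨d, ?_, hDe ▸ hDs⟩
  rw [← e1] at hdD
  exact (Finset.mem_inter.1 hdD).1

/-- The minimal part of a layer of a minimal counterexample has two elements. -/
theorem Layer.card_eq_two (h : Layer M J x t S) : S.card = 2 := by
  by_contra hne
  have h3 : 3 ≤ S.card := by have := h.two_le; omega
  have hM := h.crit.isCode
  have htS := h.t_notMem
  obtain ⟨X, hX, links, huniq⟩ := h.exists_class h3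
  have hSJ : ∀ {i}, i ∈ S → i ∈ J := fun hi => (Finset.mem_erase.1 (h.subset hi)).2
  have htw : ∀ {w}, w ∈ J.erase t \ S → w ≠ t ∧ w ∈ J ∧ w ∉ S := fun hw => by
    simp at hw; tauto
  have htK : ∀ {w}, w ∈ J.erase t \ S → t ∉ insert w S := fun hw => by
    simp [htS, (htw hw).1.symm]
  have linkG : ∀ w ∈ J.erase t \ S, ∀ z, InFace J x z → ∀ i ∈ S, ∀ j ∈ S, i ≠ j →
      Stab M (insert w S) (update z t (x t)) (lk i (X i) j (X j)) := fun w hw z hz i hi j hj hij =>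
    (links i hi j hj hij).mono (h.insert_subset hw)
      (inFace_update_layer (G := J) h.mem hz).1
  -- each block is good or decomposed by `t` and some `d ∈ S`
  have block : ∀ w ∈ J.erase t \ S, ∀ z, InFace J x z →
      (∀ i ∈ S, ∀ j ∈ S, i ≠ j → Stab M (insert t (insert w S)) z (lk i (X i) j (X j))) ∨
      ∃ d ∈ S, Split M (insert t (insert w S)) z {t, d} := by
    intro w hw z hz
    obtain ⟨f1, f2⟩ := inFace_update_layer (G := insert t (insert w S))
      (Finset.mem_insert_self t _) hz
    rcases h.crit.smaller _ (h.block_ssubset hw) z with hr | ⟨Z, hZ⟩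
    · obtain ⟨d, hd, hs⟩ := exists_split_pair (htK hw) f2 (h.not_red hw f1) hr
      rcases Finset.mem_insert.1 hd with rfl | hd
      · left
        intro i hi j hj hij
        have hs' : Split M (insert t (insert d S)) (update z t (x t)) S :=
          (hs.compl.congr fun k hk => by
            have : d ∉ S := (htw hw).2.2
            simp at hk ⊢
            rcases hk with rfl | rfl | hk
            · simp [htS]
            · simp [this]
            · simp [hk]
              exact ⟨fun e => htS (e ▸ hk), fun e => this (e ▸ hk)⟩).mono subset_rfl f2
        exact (hs'.stab hM (fun k hk => by simp [hk]) (by simp) (htw hw).2.2 (lk_supp hi hj)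
          (linkG d hw z hz i hi j hj hij)).mono subset_rfl f2.symm
      · exact .inr ⟨d, hd, hs⟩
    · left
      intro i hi j hj hij
      have := huniq w hw _ f1 Z (hZ.mono (Finset.subset_insert _ _) f2)
      rw [← this i hi, ← this j hj]
      exact hZ.2 i (by simp [hi]) j (by simp [hj]) hij
  -- in the second case, the remaining directions of `S` are linked
  have rest : ∀ w ∈ J.erase t \ S, ∀ z, InFace J x z → ∀ d ∈ S,
      Split M (insert t (insert w S)) z {t, d} → ∀ i ∈ S, ∀ j ∈ S, i ≠ j → i ≠ d → j ≠ d →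
      Stab M (insert t (insert w S)) z (lk i (X i) j (X j)) := by
    intro w hw z hz d hd hs i hi j hj hij hid hjd
    obtain ⟨f1, f2⟩ := inFace_update_layer (G := insert t (insert w S))
      (Finset.mem_insert_self t _) hz
    have hs' := (hs.compl.mono subset_rfl f2)
    have e : insert d (insert t (insert w S) \ {t, d}) = insert w S := by
      ext k
      have := htK hw
      by_cases hkd : k = d
      · subst hkd; simp [hd]
      by_cases hkt : k = t
      · subst hkt; simp only [this]; simp [hkd]
      · simp [hkd, hkt]
    have mem : ∀ i ∈ S, i ≠ d → i ∈ insert t (insert w S) \ {t, d} := by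
      intro i hi hid
      simp [hi, hid]
      exact fun e => htS (e ▸ hi)
    refine (hs'.stab hM Finset.sdiff_subset (k := d) (by simp [hd]) (by simp)
      (lk_supp (mem i hi hid) (mem j hj hjd)) ?_).mono subset_rfl f2.symm
    rw [e]
    exact linkG w hw z hz i hi j hj hij
  have extend : ∀ w ∈ J.erase t \ S, ∀ z, InFace J x z → ∀ d ∈ S,
      Split M (insert t (insert w S)) z {t, d} → ∀ y, InFace (insert t (insert w S)) z y →
      ∀ c ∈ S, c ≠ d → Stab M {c, d, t} y (lk c (X c) d (X d)) → ∀ j ∈ S, j ≠ d →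
      Stab M (insert t (insert w S)) z (lk j (X j) d (X d)) := by
    intro w hw z hz d hd hs y hy c hc hcd hst j hj hjd
    obtain ⟨f1, f2⟩ := inFace_update_layer (G := insert t (insert w S))
      (Finset.mem_insert_self t _) hz
    have e : (insert t (insert w S)).erase t = insert w S := Finset.erase_insert (htK hw)
    have nt : ∀ {k}, k ∈ S → k ≠ t := fun hk e => htS (e ▸ hk)
    refine hs.stab_of_triple hM (by simp) (by simp [hd]) (by simp [hc]) (nt hd).symm (nt hc) hcd
      (nt hj) hjd (by simp [hj]) f2 hy ?_ ?_ hst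
    · rw [e]; exact linkG w hw z hz c hc d hd hcd
    · rw [e]; exact linkG w hw z hz j hj d hd hjd
  let Φ : ι → (ι → V) → Prop := fun d y =>
    ∀ c ∈ S, c ≠ d → ¬Stab M {c, d, t} y (lk c (X c) d (X d))
  have sub3 : ∀ {w c d}, c ∈ S → d ∈ S → ({c, d, t} : Finset ι) ⊆ insert t (insert w S) := by
    intro w c d hc hd k hk
    simp at hk
    rcases hk with rfl | rfl | rfl <;> simp [*]
  have split_of : ∀ d ∈ S, ∀ y, InFace J x y → Φ d y → ∀ w ∈ J.erase t \ S,
      Split M (insert t (insert w S)) y {t, d} := by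
    intro d hd y hy hΦ w hw
    rcases block w hw y hy with hg | ⟨d', hd', hs⟩
    · obtain ⟨c, hc, hcd⟩ := exists_mem_of_card_lt (J := S) {d} (by simp; omega)
      have hcd : c ≠ d := by simpa using hcd
      exact absurd ((hg c hc d hd hcd).mono (sub3 hc hd) (InFace.refl _ _)) (hΦ c hc hcd)
    · by_cases hdd : d' = d
      · exact hdd ▸ hs
      · obtain ⟨c, hc, hcd⟩ := exists_mem_of_card_lt (J := S) {d, d'}
          (lt_of_le_of_lt Finset.card_le_two (by omega))
        simp only [Finset.mem_insert, Finset.mem_singleton, not_or] at hcd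
        exact absurd ((rest w hw y hy d' hd' hs c hc d hd hcd.1 hcd.2 (Ne.symm hdd)).mono
          (sub3 hc hd) (InFace.refl _ _)) (hΦ c hc hcd.1)
  have move : ∀ d ∈ S, ∀ y, InFace J x y → Φ d y → ∀ w ∈ J.erase t \ S, ∀ y',
      InFace (insert t (insert w S)) y y' → Φ d y' := by
    intro d hd y hy hΦ w hw y' hy' c hc hcd hst
    have := extend w hw y hy d hd (split_of d hd y hy hΦ w hw) y' hy' c hc hcd hst c hc hcd
    exact hΦ c hc hcd (this.mono (sub3 hc hd) (InFace.refl _ _))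
  have all : ∀ d ∈ S, ∀ y, InFace J x y → Φ d y → ∀ T ⊆ J.erase t \ S, ∀ y',
      InFace (insert t S ∪ T) y y' → Φ d y' := by
    intro d hd y hy hΦ T
    induction T using Finset.induction_on with
    | empty =>
      intro _ y' hy'
      obtain ⟨w, hw⟩ := h.exists_compl
      refine move d hd y hy hΦ w hw y' (hy'.mono ?_)
      intro k hk
      simp at hk ⊢
      tauto
    | insert w T hwT ih =>
      intro hT y' hy'
      have hw := hT (Finset.mem_insert_self w T)
      have hT' := (Finset.subset_insert w T).trans hT
      have hy'' : InFace (insert t S ∪ T) y (update y' w (y w)) := by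
        intro k hk
        by_cases hkw : k = w
        · subst hkw; simp
        · rw [update_of_ne hkw]
          refine hy' k fun h' => hk ?_
          simp at h' ⊢
          tauto
      have hsubJ : insert t S ∪ T ⊆ J := by
        intro k hk
        simp at hk
        rcases hk with rfl | hk | hk
        · exact h.mem
        · exact hSJ hk
        · exact (htw (hT' hk)).2.1
      refine move d hd _ (hy.trans (hy''.mono hsubJ)) (ih hT' _ hy'') w hw y' ?_
      intro k hk
      have : k ≠ w := fun e => hk (by simp [e])
      simp [this]
  -- a bad point exists
  obtain ⟨c₀, hc₀⟩ : S.Nonempty := Finset.card_pos.1 (by omega)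
  obtain ⟨c₁, hc₁, hne₁⟩ := exists_mem_of_card_lt (J := S) {c₀} (by simp; omega)
  have hne₁ : c₀ ≠ c₁ := fun e => hne₁ (by simp [e])
  have hnl := h.crit.not_link hne₁ (hSJ hc₀) (hSJ hc₁) (hX.1 c₀ hc₀) (ρ := X c₁)
  unfold Stab at hnl
  push Not at hnl
  obtain ⟨y, hy, hyM, hyn⟩ := hnl
  obtain ⟨w, hw⟩ := h.exists_compl
  obtain ⟨d, hd, hs⟩ := (block w hw y hy).resolve_left fun hg =>
    hyn (hg c₀ hc₀ c₁ hc₁ hne₁ y (InFace.refl _ _) hyM)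
  have hΦ : Φ d y := by
    intro c hc hcd hst
    have hex := extend w hw y hy d hd hs y (InFace.refl _ _) c hc hcd hst
    refine hyn ?_
    have key : Stab M (insert t (insert w S)) y (lk c₀ (X c₀) c₁ (X c₁)) := by
      by_cases h0 : c₀ = d
      · subst h0; exact (hex c₁ hc₁ hne₁.symm).lk_symm hne₁.symm
      · by_cases h1 : c₁ = d
        · subst h1; exact hex c₀ hc₀ hne₁
        · exact rest w hw y hy d hd hs c₀ hc₀ c₁ hc₁ hne₁ h0 h1
    exact key y (InFace.refl _ _) hyM
  -- it propagates to the whole face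
  obtain ⟨c, hc, hcd⟩ := exists_mem_of_card_lt (J := S) {d} (by simp; omega)
  obtain ⟨c', hc', hcd'⟩ := exists_mem_of_card_lt (J := S) {d, c}
    (lt_of_le_of_lt Finset.card_le_two (by omega))
  simp only [Finset.mem_insert, Finset.mem_singleton, not_or] at hcd hcd'
  refine h.crit.not_link (Ne.symm hcd'.2) (hSJ hc) (hSJ hc') (hX.1 c hc) (ρ := X c') ?_
  intro p hp hpM
  have hpf : InFace (insert t S ∪ (J.erase t \ S)) y p := by
    intro k hk
    have : k ∉ J := by
      intro hkJ
      simp at hk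
      tauto
    rw [hp k this, hy k this]
  have hs := split_of d hd p hp (all d hd y hy hΦ _ subset_rfl p hpf) w hw
  exact rest w hw p hp d hd hs c hc c' hc' (Ne.symm hcd'.2) hcd hcd'.1 p (InFace.refl _ _) hpM

end Large

/-! ### The permutation between two coordinates -/

section Perm

variable {ι : Type*} [DecidableEq ι]
variable {M : Set (ι → V)} {J I A S G : Finset ι} {x y z : ι → V} {i j a a' t w c d : ι} {π ρ : V}

theorem IsCode.sol_eq_iff (hM : IsCode M) {v : V} : hM.sol y i = v ↔ update y i v ∈ M :=
  ⟨fun h => h ▸ hM.sol_mem y i, fun h => (hM y i).unique (hM.sol_mem y i) h⟩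

/-- The bijection between the values at `a` and at `a'`, the other coordinates being fixed. -/
noncomputable def IsCode.perm (hM : IsCode M) (haa : a ≠ a') (y : ι → V) : Equiv.Perm V where
  toFun u := hM.sol (update y a u) a'
  invFun v := hM.sol (update y a' v) a
  left_inv u := by
    rw [hM.sol_eq_iff, update_comm haa.symm]
    exact hM.sol_mem _ _
  right_inv v := by
    rw [hM.sol_eq_iff, update_comm haa]
    exact hM.sol_mem _ _

theorem IsCode.perm_apply_eq_iff (hM : IsCode M) (haa : a ≠ a') {u v : V} :
    hM.perm haa y u = v ↔ update (update y a u) a' v ∈ M := hM.sol_eq_iff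

theorem IsCode.mem_iff_perm (hM : IsCode M) (haa : a ≠ a') :
    y ∈ M ↔ y a' = hM.perm haa y (y a) := by
  rw [eq_comm, hM.perm_apply_eq_iff, update_eq_self, update_eq_self]

theorem IsCode.perm_congr (hM : IsCode M) (haa : a ≠ a') (h : ∀ k, k ≠ a → k ≠ a' → y k = z k) :
    hM.perm haa y = hM.perm haa z := by
  ext1 u
  refine hM.sol_congr fun k hk => ?_
  by_cases hka : k = a
  · subst hka; simp
  · simp [hka, h k hka hk]

theorem IsCode.perm_ne (hM : IsCode M) (haa : a ≠ a') (hwa : w ≠ a) (hwa' : w ≠ a') {v : V}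
    (hv : v ≠ y w) (u : V) : hM.perm haa (update y w v) u ≠ hM.perm haa y u := by
  intro h
  rw [hM.perm_apply_eq_iff] at h
  have h' := (hM.perm_apply_eq_iff haa (y := y) (u := u)).1 rfl
  rw [update_comm hwa, update_comm hwa'] at h
  refine hv (hM.eq_of_update h ?_)
  rw [update_comm hwa'.symm, update_comm hwa.symm, update_eq_self]
  exact h'

theorem stab_lk_iff (hM : IsCode M) (haa : a ≠ a') (ha : a ∈ J) (ha' : a' ∈ J) :
    Stab M J x (lk a π a' ρ) ↔
      ∀ y, InFace J x y → ∀ u, hM.perm haa y (u + π) = hM.perm haa y u + ρ := by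
  have hp : ∀ y : ι → V, hM.perm haa (y + lk a π a' ρ) = hM.perm haa y := fun y =>
    hM.perm_congr haa fun k hk hk' => by simp [lk_other hk hk']
  constructor
  · intro h y hy u
    rw [hM.perm_apply_eq_iff]
    have := h _ ((hy.update ha u).update ha' _) ((hM.perm_apply_eq_iff haa (u := u)).1 rfl)
    convert this using 1
    ext1 k
    by_cases hk : k = a
    · subst hk; simp [lk_left, haa]
    · by_cases hk' : k = a'
      · subst hk'; simp [lk_right haa]
      · simp [lk_other hk hk', hk, hk']
  · intro h y hy hyM
    rw [hM.mem_iff_perm haa] at hyM ⊢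
    rw [hp]
    simp [lk_left, lk_right haa, h y hy, ← hyM]

set_option synthInstance.maxSize 1000 in
theorem V.eq_of_avoid : ∀ α β γ u v : V, α ≠ β → α ≠ γ → β ≠ γ → u ≠ α → u ≠ β → u ≠ γ →
    v ≠ α → v ≠ β → v ≠ γ → u = v := by decide

/-- If two of the permutations along a line differ by a translation, then there is a link. -/
theorem stab_lk_of_perm (hM : IsCode M) (haa : a ≠ a') (hwa : w ≠ a) (hwa' : w ≠ a') {v δ : V}
    (hδ : δ ≠ 0) (hv : v ≠ y w)
    (h : ∀ u, hM.perm haa (update y w v) u = hM.perm haa y (u + δ)) :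
    Stab M {a, w, a'} y (lk a δ w (v + y w)) := by
  set F : V → Equiv.Perm V := fun k => hM.perm haa (update y w k) with hF
  have h : ∀ u, F v u = F (y w) (u + δ) := fun u => by simpa [hF] using h u
  have hne : ∀ k l u, k ≠ l → F k u ≠ F l u := by
    intro k l u hkl
    have := hM.perm_ne haa hwa hwa' (y := update y w l) (v := k) (by simpa using hkl) u
    simpa [hF] using this
  have key : ∀ k u, F (k + (v + y w)) (u + δ) = F k u := by
    intro k u
    by_cases hk : k = v
    · rw [hk, ← add_assoc, V.add_self, zero_add, h]
    by_cases hk' : k = y w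
    · rw [hk', add_comm v, ← add_assoc, V.add_self, zero_add, h, V.add_add_cancel]
    have hk1 : k + (v + y w) ≠ v := by
      intro e
      rw [← add_assoc, add_right_comm] at e
      exact hk' (by rw [← V.add_add_cancel k (y w), add_eq_right.1 e, zero_add])
    have hk2 : k + (v + y w) ≠ y w := by
      intro e
      rw [← add_assoc] at e
      exact hk (by rw [← V.add_add_cancel k v, add_eq_right.1 e, zero_add])
    have hk3 : k + (v + y w) ≠ k := by
      intro e
      have := add_eq_left.1 e
      exact hv (by rw [← V.add_add_cancel v (y w), this, zero_add])
    have e1 : F v (u + δ) = F (y w) u := by rw [h, V.add_add_cancel]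
    refine V.eq_of_avoid (F v u) (F (y w) u) (F k (u + δ)) _ _ (hne _ _ _ hv) ?_ ?_ ?_ ?_ ?_
      (hne _ _ _ hk) (hne _ _ _ hk') ?_
    · rw [h]; exact hne _ _ _ (Ne.symm hk')
    · rw [← e1]; exact hne _ _ _ (Ne.symm hk)
    · rw [h]; exact hne _ _ _ hk2
    · rw [← e1]; exact hne _ _ _ hk1
    · exact hne _ _ _ hk3
    · exact fun e => hδ (by simpa using (F k).injective e)
  intro p hp hpM
  rw [hM.mem_iff_perm haa] at hpM ⊢
  have ep : ∀ q : ι → V, (∀ k, k ≠ a → k ≠ a' → k ≠ w → q k = y k) → hM.perm haa q = F (q w) := by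
    intro q hq
    refine hM.perm_congr haa fun k hk hk' => ?_
    by_cases hkw : k = w
    · subst hkw; simp
    · simp [hkw, hq k hk hk' hkw]
  rw [ep p fun k hk hk' hkw => hp k (by simp [hk, hk', hkw])] at hpM
  rw [ep _ fun k hk hk' hkw => by
    rw [Pi.add_apply, lk_other hk hkw, add_zero]; exact hp k (by simp [hk, hk', hkw])]
  simp only [Pi.add_apply, lk_left, lk_right hwa.symm, lk_other haa.symm hwa'.symm, add_zero]
  rw [key, ← hpM]

/-- The cyclic group of permutations of `V` containing the translation by `c` as a square. -/
def rot (c p u : V) : V :=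
  if p = 0 ∨ p = c then u + p else if u = 0 ∨ u = c then u + p else u + p + c

theorem rot_rot : ∀ c p q u : V, c ≠ 0 → rot c p (rot c q u) = rot c (rot c p q) u := by decide

theorem rot_zero (c u : V) : rot c 0 u = u := by simp [rot]

theorem exists_rot_eq_zero : ∀ c p : V, c ≠ 0 → ∃ q, rot c q p = 0 := by decide

set_option synthInstance.maxSize 1000 in
theorem rot_eq_add : ∀ c p : V, c ≠ 0 → p ≠ 0 → (∀ u, rot c p u = u + c) ∨
    ∀ u, rot c p (rot c p u) = u + c := by decide

def IsRot (c : V) (s : Equiv.Perm V) : Prop := ∃ p, ∀ u, s u = rot c p u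

theorem IsRot.mul {s r : Equiv.Perm V} (hc : π ≠ 0) (hs : IsRot π s) (hr : IsRot π r) :
    IsRot π (s * r) := by
  obtain ⟨p, hp⟩ := hs
  obtain ⟨q, hq⟩ := hr
  exact ⟨rot π p q, fun u => by rw [Equiv.Perm.mul_apply, hq, hp, rot_rot π p q u hc]⟩

theorem isRot_one : IsRot π 1 := ⟨0, fun u => by simp [rot_zero]⟩

theorem IsRot.inv {s : Equiv.Perm V} (hc : π ≠ 0) (hs : IsRot π s) : IsRot π s⁻¹ := by
  obtain ⟨p, hp⟩ := hs
  obtain ⟨q, hq⟩ := exists_rot_eq_zero π p hc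
  refine ⟨q, fun u => ?_⟩
  obtain ⟨v, rfl⟩ := s.surjective u
  change s.symm (s v) = _
  rw [Equiv.symm_apply_apply, hp, rot_rot π q p v hc, hq, rot_zero]

/-- A permutation commuting with a nontrivial rotation commutes with the translation. -/
theorem IsRot.commute {s f : Equiv.Perm V} (hc : π ≠ 0) (hs : IsRot π s) (h1 : s ≠ 1)
    (hf : f * s = s * f) (u : V) : f (u + π) = f u + π := by
  obtain ⟨p, hp⟩ := hs
  have hp0 : p ≠ 0 := by
    rintro rfl
    exact h1 (by ext1 u; simp [hp, rot_zero])
  have hf' : ∀ u, f (s u) = s (f u) := fun u => by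
    have := congrArg (fun g : Equiv.Perm V => g u) hf
    simpa using this
  rcases rot_eq_add π p hc hp0 with h | h
  · have := hf' u
    rwa [hp, hp, h, h] at this
  · have h2 : f (s (s u)) = s (s (f u)) := by rw [hf', hf']
    rwa [hp u, hp, h, hp (f u), hp, h] at h2

set_option synthInstance.maxSize 1000 in
theorem rot_cases : ∀ c e p q : V, c ≠ 0 → e ≠ 0 → e ≠ c → p ≠ 0 → q ≠ e → q ≠ p → q ≠ p + c →
    (q = rot c p e) ∨ (q = e + p ∧ p ≠ c) := by decide

theorem rot_add : ∀ c p u : V, c ≠ 0 → rot c p (u + c) = rot c p u + c := by decide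

theorem rot_zero_right (c p : V) : rot c p 0 = p := by
  unfold rot; split_ifs <;> simp_all

theorem V.exists_coset : ∀ c : V, c ≠ 0 → ∃ e, e ≠ 0 ∧ e ≠ c ∧
    ∀ u, u = 0 ∨ u = c ∨ u = e ∨ u = e + c := by decide

/-- A derangement commuting with a translation is a rotation or another translation. -/
theorem isRot_or_translation {s : Equiv.Perm V} (hc : π ≠ 0) (hs : ∀ u, s (u + π) = s u + π)
    (hd : ∀ u, s u ≠ u) : IsRot π s ∨ ∃ δ, δ ≠ 0 ∧ δ ≠ π ∧ ∀ u, s u = u + δ := by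
  obtain ⟨e, he0, hec, hcov⟩ := V.exists_coset π hc
  have hs0 : s π = s 0 + π := by simpa using hs 0
  have ext : ∀ f : V → V, (∀ u, f (u + π) = f u + π) → f 0 = s 0 → f e = s e → ∀ u, s u = f u := by
    intro f hf h0 he u
    have hf0 : f π = f 0 + π := by simpa using hf 0
    rcases hcov u with rfl | rfl | rfl | rfl
    · exact h0.symm
    · rw [hs0, hf0, h0]
    · exact he.symm
    · rw [hs, hf, he]
  rcases rot_cases π e (s 0) (s e) hc he0 hec (hd 0) (hd e) (fun h => he0 (s.injective h))
    (fun h => hec (s.injective (h.trans hs0.symm))) with h | ⟨h, h'⟩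
  · exact .inl ⟨s 0, ext _ (fun u => rot_add π (s 0) u hc) (rot_zero_right _ _) h.symm⟩
  · exact .inr ⟨s 0, hd 0, h', ext _ (fun u => add_right_comm _ _ _) (zero_add _) h.symm⟩

/-- A function invariant under changes of the coordinates in `T` depends only on the others. -/
theorem eq_of_forall_update {α : Type*} {F : (ι → V) → α} {T : Finset ι}
    (hT : T ⊆ J) (h : ∀ y, InFace J x y → ∀ w ∈ T, ∀ v, F (update y w v) = F y)
    (hy : InFace J x y) (hz : InFace T y z) : F z = F y := by
  induction T using Finset.induction_on generalizing z with
  | empty =>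
    have : z = y := by ext1 k; exact hz k (by simp)
    rw [this]
  | insert w T hwT ih =>
    have hw := hT (Finset.mem_insert_self w T)
    have hz' : InFace T y (update z w (y w)) := by
      intro k hk
      by_cases hkw : k = w
      · subst hkw; simp
      · rw [update_of_ne hkw]
        exact hz k fun h' => hk (Finset.mem_of_mem_insert_of_ne h' hkw)
    have h1 := ih ((Finset.subset_insert w T).trans hT)
      (fun y hy w hw => h y hy w (Finset.mem_insert_of_mem hw)) hz'
    rw [← h1, h z (hy.trans (hz.mono hT)) w (Finset.mem_insert_self w T)]

end Perm

/-! ### A layer with a part of two elements and a unique link -/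

section Strict

variable {ι : Type*} [DecidableEq ι]
variable {M : Set (ι → V)} {J I A S G : Finset ι} {x y z : ι → V} {i j a a' t w c d : ι} {π ρ : V}

/-- In a decomposition, the permutations between the two parts multiply. -/
theorem Split.perm_eq (hM : IsCode M) (haa : a ≠ a') (hs : Split M J x A) (ha : a ∈ J)
    (ha' : a' ∈ J) (haA : a ∈ A) (ha'A : a' ∉ A) {p q : ι → V} (hp : InFace J x p)
    (hq : InFace J x q) : (hM.perm haa p)⁻¹ * hM.perm haa (A.piecewise q p) =
      (hM.perm haa (A.piecewise p q))⁻¹ * hM.perm haa q := by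
  ext1 u
  rw [Equiv.Perm.mul_apply, Equiv.Perm.mul_apply]
  set u' := (hM.perm haa p)⁻¹ (hM.perm haa (A.piecewise q p) u) with hu'
  have hu : hM.perm haa p u' = hM.perm haa (A.piecewise q p) u := Equiv.apply_symm_apply _ _
  symm
  change (Equiv.symm _) _ = _
  rw [Equiv.symm_apply_eq]
  refine (hM.perm_apply_eq_iff haa).2 ?_
  refine hs (update (update p a u') a' (hM.perm haa p u')) _ ((hp.update ha _).update ha' _)
    ((hq.update ha _).update ha' _) ((hM.perm_apply_eq_iff haa).1 rfl) ?_ ?_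
  · convert (hM.perm_apply_eq_iff haa).1 hu.symm using 1
    ext1 k
    by_cases hk' : k = a'
    · subst hk'; simp [ha'A]
    by_cases hk : k = a
    · subst hk; simp [haA, hk']
    · by_cases hkA : k ∈ A <;> simp [hk, hk', hkA]
  · convert (hM.perm_apply_eq_iff haa).1
      (rfl : hM.perm haa (A.piecewise p q) u' = _) using 1
    ext1 k
    by_cases hk' : k = a'
    · subst hk'; simp [ha'A]
    by_cases hk : k = a
    · subst hk; simp [haA, hk']
    · by_cases hkA : k ∈ A <;> simp [hk, hk', hkA]

theorem split_of_perm_eq (hM : IsCode M) (haa : a ≠ a') (haA : a ∈ A) (ha'A : a' ∉ A)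
    (h : ∀ p q, InFace J x p → InFace J x q →
      (hM.perm haa p)⁻¹ * hM.perm haa (A.piecewise q p) =
      (hM.perm haa (A.piecewise p q))⁻¹ * hM.perm haa q) : Split M J x A := by
  intro p q hp hq hpM h1 h2
  rw [hM.mem_iff_perm haa] at hpM h1 h2 ⊢
  simp only [haA, ha'A, Finset.piecewise_eq_of_mem, Finset.piecewise_eq_of_notMem,
    not_false_eq_true] at h1 h2
  have := congrArg (fun s : Equiv.Perm V => s (q a)) (h p q hp hq)
  simp only [Equiv.Perm.mul_apply] at this
  rw [← h1, hpM] at this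
  change (Equiv.symm _) _ = (Equiv.symm _) _ at this
  rw [Equiv.symm_apply_apply, eq_comm, Equiv.symm_apply_eq] at this
  rw [this, h2]

/-- Translations of the minimal part extend to the layer. -/
theorem Layer.stab_layer (h : Layer M J x t S) (hw : w ∈ J.erase t \ S)
    (hz : InFace (J.erase t) x z) {v : ι → V} (hv : ∀ i, i ∉ S → v i = 0)
    (hs : Stab M (insert w S) z v) : Stab M (J.erase t) x v :=
  ((h.split.mono subset_rfl hz).stab h.crit.isCode h.subset (Finset.mem_sdiff.1 hw).1
    (Finset.mem_sdiff.1 hw).2 hv hs).mono subset_rfl hz.symm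

theorem Layer.split_of_red (h : Layer M J x t {a, a'}) (hw : w ∈ J.erase t \ {a, a'})
    (hz : InFace J x z) (hr : Red M (insert t (insert w {a, a'})) z) :
      Split M (insert t (insert w {a, a'})) z {a, a'} ∨
      Split M (insert t (insert w {a, a'})) z {t, a} ∨
      Split M (insert t (insert w {a, a'})) z {t, a'} := by
  obtain ⟨f1, f2⟩ := inFace_update_layer (G := insert t (insert w {a, a'}))
    (Finset.mem_insert_self t _) hz
  have htS := h.t_notMem
  have hwt : w ≠ t := (Finset.mem_erase.1 (Finset.mem_sdiff.1 hw).1).1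
  have hwS := (Finset.mem_sdiff.1 hw).2
  obtain ⟨d, hd, hs⟩ := exists_split_pair (by rw [Finset.mem_insert]; tauto) f2
    (h.not_red hw f1) hr
  simp only [Finset.mem_insert, Finset.mem_singleton] at hd
  rcases hd with rfl | rfl | rfl
  · left
    refine hs.compl.congr fun k hk => ?_
    simp only [Finset.mem_insert, Finset.mem_singleton, Finset.mem_sdiff] at hk htS hwS ⊢
    grind
  · exact .inr (.inl hs)
  · exact .inr (.inr hs)

theorem pigeonhole_two {P Q : V → Prop} (h : ∀ c, P c ∨ Q c) :
    ∃ c d, c ≠ d ∧ ((P c ∧ P d) ∨ (Q c ∧ Q d)) := by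
  by_contra! hcon
  have h1 := hcon 0 (0, 1) (by decide)
  have h2 := hcon 0 (1, 0) (by decide)
  have h3 := hcon (0, 1) (1, 0) (by decide)
  have := h 0
  have := h (0, 1)
  have := h (1, 0)
  tauto

theorem conj_commute {Γ : Type*} [Group Γ] {e₁ e₂ e₃ e₄ s r : Γ}
    (h : e₁ * s * e₁⁻¹ = e₂ * r * e₂⁻¹) (h' : e₃ * s * e₃⁻¹ = e₄ * r * e₄⁻¹) :
    s * ((e₃⁻¹ * e₄) * (e₁⁻¹ * e₂)⁻¹) = ((e₃⁻¹ * e₄) * (e₁⁻¹ * e₂)⁻¹) * s := by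
  have h1 : s = (e₁⁻¹ * e₂) * r * (e₁⁻¹ * e₂)⁻¹ := by
    calc s = e₁⁻¹ * (e₁ * s * e₁⁻¹) * e₁ := by group
      _ = _ := by rw [h]; group
  have h2 : s = (e₃⁻¹ * e₄) * r * (e₃⁻¹ * e₄)⁻¹ := by
    calc s = e₃⁻¹ * (e₃ * s * e₃⁻¹) * e₃ := by group
      _ = _ := by rw [h']; group
  calc s * ((e₃⁻¹ * e₄) * (e₁⁻¹ * e₂)⁻¹)
      = ((e₃⁻¹ * e₄) * r * (e₃⁻¹ * e₄)⁻¹) * ((e₃⁻¹ * e₄) * (e₁⁻¹ * e₂)⁻¹) := by rw [← h2]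
    _ = ((e₃⁻¹ * e₄) * (e₁⁻¹ * e₂)⁻¹) * ((e₁⁻¹ * e₂) * r * (e₁⁻¹ * e₂)⁻¹) := by group
    _ = _ := by rw [← h1]

/-- The two directions of a minimal part of a layer have more than one link. -/
theorem Layer.not_strict (h : Layer M J x t {a, a'}) (haa : a ≠ a') (hπ : π ≠ 0)
    (lnk : Stab M (J.erase t) x (lk a π a' ρ))
    (hstr : ∀ δ ε, δ ≠ 0 → Stab M (J.erase t) x (lk a δ a' ε) → δ = π) : False := by
  have hM := h.crit.isCode
  have htS := h.t_notMem
  simp only [Finset.mem_insert, Finset.mem_singleton, not_or] at htS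
  obtain ⟨hta, hta'⟩ : t ≠ a ∧ t ≠ a' := htS
  have haL : a ∈ J.erase t := h.subset (by simp)
  have haL' : a' ∈ J.erase t := h.subset (by simp)
  have haJ := (Finset.mem_erase.1 haL).2
  have haJ' := (Finset.mem_erase.1 haL').2
  have htJ := h.mem
  have hLJ := Finset.erase_subset t J
  have hB : ∀ {w}, w ∈ J.erase t \ {a, a'} → w ≠ t ∧ w ≠ a ∧ w ≠ a' ∧ w ∈ J := fun hw => by
    simp at hw; tauto
  have toL : ∀ {y}, InFace J x y → InFace (J.erase t) x (update y t (x t)) := fun hy =>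
    (inFace_update_layer htJ hy).1
  -- the face where the link fails
  set T : (ι → V) → Prop := fun y => Stab M {a, a', t} y (lk a π a' ρ) with hT
  have lnkG : ∀ w ∈ J.erase t \ {a, a'}, ∀ y, InFace J x y →
      Stab M (insert w {a, a'}) (update y t (x t)) (lk a π a' ρ) := fun w hw y hy =>
    lnk.mono (h.insert_subset hw) (toL hy)
  have block : ∀ w ∈ J.erase t \ {a, a'}, ∀ y, InFace J x y →
      Stab M (insert t (insert w {a, a'})) y (lk a π a' ρ) ∨
      Split M (insert t (insert w {a, a'})) y {t, a} ∨
      Split M (insert t (insert w {a, a'})) y {t, a'} := by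
    intro w hw y hy
    obtain ⟨f1, f2⟩ := inFace_update_layer (G := insert t (insert w {a, a'}))
      (Finset.mem_insert_self t _) hy
    obtain ⟨hwt, hwa, hwa', hwJ⟩ := hB hw
    rcases (h.crit.smaller _ (h.block_ssubset hw) y).symm.imp_right (h.split_of_red hw hy) with
      ⟨Z, hZ⟩ | hs | hs
    · left
      have hl := hZ.2 a (by simp) a' (by simp) haa
      have hl' := h.stab_layer hw f1 (lk_supp (by simp) (by simp))
        (hl.mono (Finset.subset_insert _ _) f2)
      have e := hstr _ _ (hZ.1 a (by simp)) hl'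
      rw [e] at hl hl'
      rwa [← lk_unique hM hl' lnk haa (InFace.refl _ _) (InFace.refl _ _) haL haL]
    · left
      have hs' := (hs.mono subset_rfl f2).stab hM (k := w) (v := lk a π a' ρ) (by grind) (by simp)
        (by simp [hwa, hwa']) (lk_supp (by simp) (by simp)) (lnkG w hw y hy)
      exact hs'.mono subset_rfl f2.symm
    · exact .inr hs
  have extend : ∀ w ∈ J.erase t \ {a, a'}, ∀ y, InFace J x y → T y →
      Stab M (insert t (insert w {a, a'})) y (lk a π a' ρ) := by
    intro w hw y hy hTy
    obtain ⟨f1, f2⟩ := inFace_update_layer (G := insert t (insert w {a, a'}))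
      (Finset.mem_insert_self t _) hy
    obtain ⟨hwt, hwa, hwa', hwJ⟩ := hB hw
    have e : (insert t (insert w {a, a'}) : Finset ι).erase t = insert w {a, a'} :=
      Finset.erase_insert (by simp [hta, hta', hwt.symm])
    have hl := lnkG w hw y hy
    rw [← e] at hl
    rcases block w hw y hy with hg | hs | hs
    · exact hg
    · refine (hs.stab_of_triple hM (z' := update y t (x t)) (y := y) (c := a') (c₂ := a')
        (π := ρ) (ρ := π) (π₂ := ρ) (by simp) (by simp) (by simp) hta hta'.symm haa.symm
        hta'.symm haa.symm (by simp) f2 (InFace.refl _ _) (hl.lk_symm haa) (hl.lk_symm haa)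
        ?_).lk_symm haa.symm
      rw [show ({a', a, t} : Finset ι) = {a, a', t} from Finset.insert_comm _ _ _]
      exact hTy.lk_symm haa
    · exact hs.stab_of_triple hM (z' := update y t (x t)) (y := y) (c := a) (c₂ := a)
        (by simp) (by simp) (by simp) hta' hta.symm haa
        hta.symm haa (by simp) f2 (InFace.refl _ _) hl hl hTy
  have Tmove : ∀ y, InFace J x y → ∀ w ∈ J, ∀ v, T y → T (update y w v) := by
    intro y hy w hw v hTy
    by_cases hwS : w ∈ ({a, a', t} : Finset ι)
    · exact Stab.mono hTy subset_rfl ((InFace.refl _ y).update hwS v)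
    · have hw' : w ∈ J.erase t \ {a, a'} := by simp at hwS ⊢; tauto
      exact (extend w hw' y hy hTy).mono (by intro k hk; simp at hk ⊢; tauto)
        ((InFace.refl _ y).update (by simp) v)
  have Tnot : ∀ y, InFace J x y → ¬T y := by
    intro y hy hTy
    refine h.crit.not_link haa haJ haJ' hπ (ρ := ρ) fun p hp hpM => ?_
    have := eq_of_forall_update (F := T) (J := J) (x := x) (T := J) subset_rfl ?_ hy
      (hy.congr.1 hp)
    · exact (this ▸ hTy : T p) p (InFace.refl _ _) hpM
    · intro y hy w hw v
      refine propext ⟨fun h' => ?_, Tmove y hy w hw v⟩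
      have := Tmove _ (hy.update hw v) w hw (y w) h'
      simpa using this
  -- the permutations
  set e : (ι → V) → Equiv.Perm V := fun y => hM.perm haa y with he
  set o : (ι → V) → Equiv.Perm V := fun y => e (update y t (x t)) with ho
  set sig : V → (ι → V) → Equiv.Perm V := fun b y => (o y)⁻¹ * e (update y t b) with hsig
  set rho : V → (ι → V) → Equiv.Perm V := fun b y => e (update y t b) * (o y)⁻¹ with hrho
  have e_eq : ∀ y, e y = o y * sig (y t) y := fun y => by simp [hsig]
  have rho_eq : ∀ b y, rho b y = o y * sig b y * (o y)⁻¹ := fun b y => by simp [hrho, hsig]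
  have econgr : ∀ {y z : ι → V}, (∀ k, k ≠ a → k ≠ a' → y k = z k) → e y = e z := fun hk =>
    hM.perm_congr haa hk
  have olink : ∀ z, InFace (J.erase t) x z → ∀ u, e z (u + π) = e z u + ρ :=
    (stab_lk_iff hM haa haL haL').1 lnk
  have olink' : ∀ z, InFace (J.erase t) x z → ∀ u, (e z)⁻¹ (u + ρ) = (e z)⁻¹ u + π := by
    intro z hz u
    change (e z).symm _ = (e z).symm _ + _
    rw [Equiv.symm_apply_eq, olink z hz, Equiv.apply_symm_apply]
  have T_of : ∀ y, InFace J x y → (∀ b u, sig b y (u + π) = sig b y u + π) → T y := by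
    intro y hy hb
    refine (stab_lk_iff hM haa (by simp) (by simp)).2 fun y' hy' u => ?_
    have : hM.perm haa y' = o y * sig (y' t) y := by
      rw [hsig]
      simp only [mul_inv_cancel_left]
      refine econgr fun k hk hk' => ?_
      by_cases hkt : k = t
      · subst hkt; simp
      · rw [update_of_ne hkt]; exact hy' k (by simp [hk, hk', hkt])
    rw [this, Equiv.Perm.mul_apply, hb, Equiv.Perm.mul_apply]
    exact olink _ (toL hy) _
  have rot_line : ∀ z, InFace (J.erase t) x z → ∀ w ∈ J.erase t, ∀ v,
      IsRot π ((e z)⁻¹ * e (update z w v)) := by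
    intro z hz w hw v
    by_cases hwS : w ∈ ({a, a'} : Finset ι)
    · have : e (update z w v) = e z := econgr fun k hk hk' => by
        rw [update_of_ne]; rintro rfl; simp at hwS; tauto
      rw [this, inv_mul_cancel]
      exact isRot_one
    have hwB : w ∈ J.erase t \ {a, a'} := Finset.mem_sdiff.2 ⟨hw, hwS⟩
    obtain ⟨hwt, hwa, hwa', hwJ⟩ := hB hwB
    by_cases hv : v = z w
    · rw [hv, update_eq_self, inv_mul_cancel]
      exact isRot_one
    refine (isRot_or_translation hπ ?_ ?_).resolve_right ?_
    · intro u
      rw [Equiv.Perm.mul_apply, olink _ (hz.update hw v), olink' z hz, Equiv.Perm.mul_apply]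
    · intro u hu
      rw [Equiv.Perm.mul_apply] at hu
      change (e z).symm _ = u at hu
      rw [Equiv.symm_apply_eq] at hu
      exact hM.perm_ne haa hwa hwa' hv u hu
    · rintro ⟨δ, hδ, hδπ, hδu⟩
      have h1 : ∀ u, hM.perm haa (update z w v) u = hM.perm haa z (u + δ) := by
        intro u
        rw [← hδu u, Equiv.Perm.mul_apply]
        exact (Equiv.apply_symm_apply _ _).symm
      obtain ⟨θ, -, h2, -⟩ := exists_link_third hM hwa.symm haa hwa'
        (stab_lk_of_perm hM haa hwa hwa' hδ hv h1) hδ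
      refine hδπ (hstr δ θ hδ (h.stab_layer hwB hz (lk_supp (by simp) (by simp)) ?_))
      rwa [Finset.insert_comm]
  have rot_all : ∀ z z', InFace (J.erase t) x z → InFace (J.erase t) x z' →
      IsRot π ((e z)⁻¹ * e z') := by
    intro z z' hz hz'
    have hmv : ∀ y, InFace (J.erase t) x y → ∀ w ∈ J.erase t, ∀ v,
        IsRot π ((e z)⁻¹ * e y) → IsRot π ((e z)⁻¹ * e (update y w v)) := by
      intro y hy w hw v hr
      have := hr.mul hπ (rot_line y hy w hw v)
      rwa [mul_assoc, mul_inv_cancel_left] at this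
    have := eq_of_forall_update (F := fun y => IsRot π ((e z)⁻¹ * e y)) (J := J.erase t) (x := x)
      (T := J.erase t) subset_rfl ?_ hz (hz.congr.1 hz')
    · rw [this, inv_mul_cancel]
      exact isRot_one
    · intro y hy w hw v
      refine propext ⟨fun h' => ?_, hmv y hy w hw v⟩
      have := hmv _ (hy.update hw v) w hw (y w) h'
      simpa using this
  have rot_eq_one : ∀ y, InFace J x y → ∀ n, IsRot π n → (∀ b, sig b y * n = n * sig b y) →
      n = 1 := by
    intro y hy n hn hc
    by_contra h1
    exact Tnot y hy (T_of y hy fun b u => hn.commute hπ h1 (hc b) u)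
  have not_both : ∀ y, InFace J x y → ∀ w ∈ J.erase t \ {a, a'}, ∀ v,
      (∀ b, sig b (update y w v) = sig b y) → (∀ b, rho b (update y w v) = rho b y) →
      v = y w := by
    intro y hy w hw v h1 h2
    by_contra hv
    obtain ⟨hwt, hwa, hwa', hwJ⟩ := hB hw
    have hn := rot_eq_one y hy _ (rot_all _ _ (toL hy) (toL (hy.update hwJ v))) (fun b => by
      have h3 := h2 b
      rw [rho_eq, rho_eq, h1] at h3
      have := conj_commute (e₁ := (1 : Equiv.Perm V)) (e₂ := 1) (r := sig b y) rfl h3.symm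
      simpa using this)
    have h3 : o (update y w v) = o y := by
      have : (o y)⁻¹ * o (update y w v) = 1 := hn
      rw [inv_mul_eq_one] at this
      exact this.symm
    refine hM.perm_ne haa hwa hwa' (y := update y t (x t)) (v := v) ?_ 0 ?_
    · rwa [update_of_ne hwt]
    · rw [update_comm hwt.symm]
      exact congrArg (fun s : Equiv.Perm V => s 0) h3
  -- each direction preserves `sig` or `rho`
  set Sg : ι → (ι → V) → Prop := fun w y => ∀ b v, sig b (update y w v) = sig b y with hSg
  set Rh : ι → (ι → V) → Prop := fun w y => ∀ b v, rho b (update y w v) = rho b y with hRh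
  have Sg_or_Rh : ∀ w ∈ J.erase t \ {a, a'}, ∀ y, InFace J x y → Sg w y ∨ Rh w y := by
    intro w hw y hy
    obtain ⟨hwt, hwa, hwa', hwJ⟩ := hB hw
    have f : ∀ b v, InFace (insert t (insert w {a, a'})) y (update (update y t b) w v) :=
      fun b v => ((InFace.refl _ y).update (by simp) b).update (by simp) v
    have f' : InFace (insert t (insert w {a, a'})) y (update y t (x t)) :=
      (InFace.refl _ y).update (by simp) _
    rcases block w hw y hy with hg | hs | hs
    · exact absurd (hg.mono (by intro k hk; simp at hk ⊢; tauto) (InFace.refl _ _)) (Tnot y hy)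
    · left
      intro b v
      have := hs.perm_eq hM haa (by simp) (by simp) (by simp) (by simp [hta'.symm, haa.symm])
        f' (f b v)
      have e1 : ({t, a} : Finset ι).piecewise (update (update y t b) w v) (update y t (x t)) =
          update y t b := by
        ext1 k
        simp only [Finset.piecewise, update_apply, Finset.mem_insert, Finset.mem_singleton]
        grind
      have e2 : ({t, a} : Finset ι).piecewise (update y t (x t)) (update (update y t b) w v) =
          update (update y w v) t (x t) := by
        ext1 k
        simp only [Finset.piecewise, update_apply, Finset.mem_insert, Finset.mem_singleton]
        grind
      rw [e1, e2, update_comm hwt.symm] at this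
      exact this.symm
    · right
      intro b v
      have := hs.compl.perm_eq hM haa (by simp) (by simp) (by simp [haa, hta.symm]) (by simp)
        f' (f b v)
      have e1 : (insert t (insert w {a, a'}) \ {t, a'} : Finset ι).piecewise
          (update (update y t b) w v) (update y t (x t)) = update (update y w v) t (x t) := by
        ext1 k
        simp only [Finset.piecewise, update_apply, Finset.mem_insert, Finset.mem_singleton,
          Finset.mem_sdiff]
        grind
      have e2 : (insert t (insert w {a, a'}) \ {t, a'} : Finset ι).piecewise
          (update y t (x t)) (update (update y t b) w v) = update y t b := by
        ext1 k
        simp only [Finset.piecewise, update_apply, Finset.mem_insert, Finset.mem_singleton,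
          Finset.mem_sdiff]
        grind
      rw [e1, e2, update_comm hwt.symm] at this
      change e (update (update y w v) t b) * (o (update y w v))⁻¹ = e (update y t b) * (o y)⁻¹
      have h3 : e (update (update y w v) t b) = e (update y t b) * ((o y)⁻¹ * o (update y w v)) :=
        inv_mul_eq_iff_eq_mul.1 this.symm
      rw [h3, mul_assoc, mul_assoc, mul_inv_cancel, mul_one]
  have inv : ∀ k ∈ ({a, a', t} : Finset ι), ∀ b y v, sig b (update y k v) = sig b y ∧
      rho b (update y k v) = rho b y := by
    intro k hk b y v
    have h1 : ∀ c, e (update (update y k v) t c) = e (update y t c) := by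
      intro c
      refine econgr fun l hl hl' => ?_
      by_cases hlt : l = t
      · subst hlt; simp
      · have : l ≠ k := by rintro rfl; simp at hk; tauto
        simp [hlt, this]
    simp only [hsig, hrho, ho, h1, and_self]
  have Sg_move : ∀ w ∈ J.erase t \ {a, a'}, ∀ y, InFace J x y → ∀ w' ∈ J, ∀ v', Sg w y →
      Sg w (update y w' v') := by
    intro w hw y hy w' hw' v' hS
    obtain ⟨hwt, hwa, hwa', hwJ⟩ := hB hw
    by_cases hww : w = w'
    · subst hww
      intro b v
      rw [update_idem, hS, hS]
    by_cases hwS : w' ∈ ({a, a', t} : Finset ι)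
    · intro b v
      rw [update_comm (Ne.symm hww), (inv w' hwS _ _ _).1, (inv w' hwS _ _ _).1, hS]
    have hwB : w' ∈ J.erase t \ {a, a'} := by simp at hwS ⊢; tauto
    by_contra hn
    have hR := (Sg_or_Rh w hw _ (hy.update hw' v')).resolve_left hn
    obtain ⟨c, d, hcd, hc⟩ := pigeonhole_two fun c => Sg_or_Rh w' hwB _ (hy.update hwJ c)
    rcases hc with ⟨hc, hd⟩ | ⟨hc, hd⟩
    · have := not_both (update (update y w' v') w c) ((hy.update hw' v').update hwJ c) w hw d
        (fun b => by
          rw [update_idem, update_comm (Ne.symm hww), update_comm (Ne.symm hww), hc, hd, hS, hS])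
        (fun b => by rw [update_idem, hR, hR])
      simp at this
      exact hcd this.symm
    · have := not_both (update y w c) (hy.update hwJ c) w hw d
        (fun b => by rw [update_idem, hS, hS])
        (fun b => by
          rw [update_idem, ← hc b v', ← hd b v', update_comm hww, update_comm hww, hR, hR])
      simp at this
      exact hcd this.symm
  have Sg_all : ∀ w ∈ J.erase t \ {a, a'}, ∀ y, InFace J x y → (Sg w y ↔ Sg w x) := by
    intro w hw y hy
    refine iff_of_eq (eq_of_forall_update (F := Sg w) (J := J) (x := x) (T := J) subset_rfl ?_
      (InFace.refl _ _) hy)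
    intro y hy w' hw' v
    refine propext ⟨fun h' => ?_, Sg_move w hw y hy w' hw' v⟩
    have := Sg_move w hw _ (hy.update hw' v) w' hw' (y w') h'
    simpa using this
  classical
  set Bs := (J.erase t \ {a, a'}).filter fun w => Sg w x with hBs
  have sig_congr : ∀ b y z, InFace J x y → InFace (Bs ∪ {a, a', t}) y z → sig b z = sig b y := by
    intro b y z hy hz
    refine eq_of_forall_update (J := J) (x := x) (T := Bs ∪ {a, a', t}) ?_ ?_ hy hz
    · intro k hk
      simp [hBs] at hk
      rcases hk with rfl | rfl | rfl | hk
      · exact haJ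
      · exact haJ'
      · exact htJ
      · exact hk.1.1.2
    · intro y hy w hw v
      rcases Finset.mem_union.1 hw with hw | hw
      · rw [hBs, Finset.mem_filter] at hw
        exact (Sg_all w hw.1 y hy).2 hw.2 b v
      · exact (inv w hw b y v).1
  have rho_congr : ∀ b y z, InFace J x y → InFace (J \ Bs) y z → rho b z = rho b y := by
    intro b y z hy hz
    refine eq_of_forall_update (J := J) (x := x) (T := J \ Bs) Finset.sdiff_subset ?_ hy hz
    intro y hy w hw v
    by_cases hwS : w ∈ ({a, a', t} : Finset ι)
    · exact (inv w hwS b y v).2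
    have hwB : w ∈ J.erase t \ {a, a'} := by simp at hwS hw ⊢; tauto
    refine ((Sg_or_Rh w hwB y hy).resolve_left fun hS => ?_) b v
    rw [Sg_all w hwB y hy] at hS
    rw [Finset.mem_sdiff, hBs, Finset.mem_filter] at hw
    exact hw.2 ⟨hwB, hS⟩
  have hBsJ : ∀ k ∈ Bs, k ≠ t ∧ k ≠ a ∧ k ≠ a' ∧ k ∈ J := fun k hk =>
    hB (Finset.mem_filter.1 hk).1
  by_cases hBe : Bs = ∅
  · -- `rho` is constant
    refine h.crit.not_red ⟨J \ {t, a'}, Finset.sdiff_subset, ?_, ?_, ?_⟩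
    · have := h.crit.five_le
      rw [Finset.card_sdiff_of_subset (by grind)]
      have : ({t, a'} : Finset ι).card ≤ 2 := Finset.card_le_two
      omega
    · rw [Finset.sdiff_sdiff_eq_self (by grind), Finset.card_pair hta']
    · refine split_of_perm_eq hM haa (by simp [haJ, hta.symm, haa]) (by simp) fun p q hp hq => ?_
      have hR : ∀ b y, InFace J x y → rho b y = rho b x := fun b y hy =>
        rho_congr b x y (InFace.refl _ _) (by simpa [hBe] using hy)
      have hE : ∀ y, InFace J x y → e y = rho (y t) x * o y := fun y hy => by
        rw [← hR _ y hy]; simp [hrho]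
      have o1 : o ((J \ {t, a'}).piecewise q p) = o q := econgr fun k hk hk' => by
        by_cases hkt : k = t
        · subst hkt; simp
        · by_cases hkJ : k ∈ J
          · simp [hkt, hk', hkJ]
          · simp [hkt, hkJ, hp k hkJ, hq k hkJ]
      have o2 : o ((J \ {t, a'}).piecewise p q) = o p := econgr fun k hk hk' => by
        by_cases hkt : k = t
        · subst hkt; simp
        · by_cases hkJ : k ∈ J
          · simp [hkt, hk', hkJ]
          · simp [hkt, hkJ, hp k hkJ, hq k hkJ]
      change (e _)⁻¹ * e _ = (e _)⁻¹ * e _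
      rw [hE p hp, hE q hq, hE _ (hp.piecewise hq _), hE _ (hq.piecewise hp _), o1, o2]
      simp [mul_assoc]
  · obtain ⟨w₀, hw₀⟩ := Finset.nonempty_iff_ne_empty.2 hBe
    refine h.crit.not_red ⟨J \ insert a' Bs, Finset.sdiff_subset, ?_, ?_, ?_⟩
    · have : ({a, t} : Finset ι) ⊆ J \ insert a' Bs := by
        intro k hk
        simp only [Finset.mem_insert, Finset.mem_singleton] at hk
        rcases hk with rfl | rfl
        · simp only [Finset.mem_sdiff, Finset.mem_insert, not_or]
          exact ⟨haJ, haa, fun hk => (hBsJ _ hk).2.1 rfl⟩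
        · simp only [Finset.mem_sdiff, Finset.mem_insert, not_or]
          exact ⟨htJ, hta', fun hk => (hBsJ _ hk).1 rfl⟩
      have := Finset.card_le_card this
      rwa [Finset.card_pair hta.symm] at this
    · rw [Finset.sdiff_sdiff_eq_self (Finset.insert_subset haJ' fun k hk => (hBsJ k hk).2.2.2),
        Finset.card_insert_of_notMem fun hk => (hBsJ _ hk).2.2.1 rfl]
      have : 0 < Bs.card := Finset.card_pos.2 ⟨w₀, hw₀⟩
      omega
    · refine split_of_perm_eq hM haa ?_ (by simp) fun p q hp hq => ?_
      · simp only [Finset.mem_sdiff, Finset.mem_insert, not_or]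
        exact ⟨haJ, haa, fun hk => (hBsJ _ hk).2.1 rfl⟩
      have hqp := hq.piecewise hp (J \ insert a' Bs)
      have hpq := hp.piecewise hq (J \ insert a' Bs)
      have htA : t ∈ J \ insert a' Bs := by
        simp only [Finset.mem_sdiff, Finset.mem_insert, not_or]
        exact ⟨htJ, hta', fun hk => (hBsJ _ hk).1 rfl⟩
      have hfs : ∀ p q, InFace J x p → InFace J x q → InFace (Bs ∪ {a, a', t}) p
          ((J \ insert a' Bs).piecewise p q) := by
        intro p q hp hq k hk
        by_cases hkJ : k ∈ J
        · have : k ∈ J \ insert a' Bs := by simp at hk ⊢; tauto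
          simp only [this, Finset.piecewise_eq_of_mem]
        · rw [hp.piecewise hq _ k hkJ, hp k hkJ]
      have hfr : ∀ p q, InFace J x p → InFace J x q → InFace (J \ Bs) p
          ((J \ insert a' Bs).piecewise q p) := by
        intro p q hp hq k hk
        by_cases hkJ : k ∈ J
        · have : k ∉ J \ insert a' Bs := by simp at hk ⊢; tauto
          simp only [this, Finset.piecewise_eq_of_notMem, not_false_eq_true]
        · rw [hq.piecewise hp _ k hkJ, hp k hkJ]
      have s1 := fun b => sig_congr b p _ hp (hfs p q hp hq)
      have s2 := fun b => sig_congr b q _ hq (hfs q p hq hp)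
      have r1 := fun b => rho_congr b p _ hp (hfr p q hp hq)
      have r2 := fun b => rho_congr b q _ hq (hfr q p hq hp)
      have t1 : (J \ insert a' Bs).piecewise p q t = p t := by
        simp only [htA, Finset.piecewise_eq_of_mem]
      have t2 : (J \ insert a' Bs).piecewise q p t = q t := by
        simp only [htA, Finset.piecewise_eq_of_mem]
      change (e _)⁻¹ * e _ = (e _)⁻¹ * e _
      rw [e_eq p, e_eq q, e_eq ((J \ insert a' Bs).piecewise p q),
        e_eq ((J \ insert a' Bs).piecewise q p), t1, t2, s1, s2]
      have key := rot_eq_one p hp (((o ((J \ insert a' Bs).piecewise p q))⁻¹ * o q) *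
        ((o p)⁻¹ * o ((J \ insert a' Bs).piecewise q p))⁻¹)
        ((rot_all _ _ (toL hpq) (toL hq)).mul hπ ((rot_all _ _ (toL hp) (toL hqp)).inv hπ))
        (fun b => conj_commute (r := sig b q)
          (by have := (r1 b).symm; rwa [rho_eq, rho_eq, s2] at this)
          (by have := r2 b; rwa [rho_eq, rho_eq, s1] at this))
      rw [mul_inv_eq_one] at key
      simp only [mul_inv_rev, mul_assoc] at key ⊢
      rw [← mul_assoc (o p)⁻¹, ← mul_assoc (o _)⁻¹ (o q), key]

end Strict

/-! ### A layer with a part of two elements and all links -/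

section Full

variable {ι : Type*} [DecidableEq ι]
variable {M : Set (ι → V)} {J I A S G : Finset ι} {x y y' z : ι → V} {i j k a a' t w c d : ι}
variable {π ρ σ σ' : V} {φ : V → V}

/-- If all links between `i` and `k` exist, then there is one with any given entry at `k`. -/
theorem exists_link_to (hM : IsCode M) (hik : i ≠ k) (hi : i ∈ J)
    (h : ∀ π, π ≠ 0 → ∃ θ, Stab M J x (lk i π k θ)) (θ : V) : ∃ π, Stab M J x (lk i π k θ) := by
  by_cases h0 : hM.sol x i = hM.sol (update x k (x k + θ)) i
  · have := hM.sol_injective (j := k) hik.symm (fun l hl => by simp [hl]) h0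
    have hθ : θ = 0 := by simpa using this
    refine ⟨0, fun y _ hy => ?_⟩
    have : (lk i 0 k θ : ι → V) = 0 := by ext1 l; simp [lk, hθ]
    simpa [this] using hy
  · set π := hM.sol x i + hM.sol (update x k (x k + θ)) i with hπ
    have hπ0 : π ≠ 0 := fun e => h0 (by
      rw [← V.add_add_cancel (hM.sol x i) (hM.sol (update x k (x k + θ)) i), ← hπ, e, zero_add])
    obtain ⟨θ', hlk⟩ := h π hπ0
    have h1 := hlk _ ((InFace.refl J x).update hi _) (hM.sol_mem x i)
    have h2 := hM.sol_mem (update x k (x k + θ)) i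
    have := congrFun (hM.eq h1 h2 k fun l hl => by
      by_cases hli : l = i
      · subst hli; simp [lk_left, hπ, ← add_assoc, V.add_self]
      · simp [hl, hli, lk_other hli hl]) k
    simp [lk_right hik, hik.symm] at this
    exact ⟨π, this ▸ hlk⟩

/-- The directions `a` and `b` are linked on the face spanned by `a`, `b` and `t`. -/
def Linked (M : Set (ι → V)) (t a b : ι) (φ : V → V) (σ : V) (y : ι → V) : Prop :=
  Stab M {a, b, t} y (lk a σ b (φ σ))

/-- A layer of a minimal counterexample with all links between `a` and `a'`. -/
structure Full (M : Set (ι → V)) (J : Finset ι) (x : ι → V) (t a a' : ι) (φ : V → V) : Prop where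
  layer : Layer M J x t {a, a'}
  ne : a ≠ a'
  links : ∀ δ, Stab M (J.erase t) x (lk a δ a' (φ δ))

theorem Full.mems (h : Full M J x t a a' φ) : t ≠ a ∧ t ≠ a' ∧ a ∈ J ∧ a' ∈ J ∧ t ∈ J ∧
    a ∈ J.erase t ∧ a' ∈ J.erase t := by
  have htS := h.layer.t_notMem
  simp only [Finset.mem_insert, Finset.mem_singleton, not_or] at htS
  have haL : a ∈ J.erase t := h.layer.subset (by simp)
  have haL' : a' ∈ J.erase t := h.layer.subset (by simp)
  exact ⟨htS.1, htS.2, (Finset.mem_erase.1 haL).2, (Finset.mem_erase.1 haL').2, h.layer.mem,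
    haL, haL'⟩

theorem Full.mem_rest (hw : w ∈ J.erase t \ {a, a'}) : w ≠ t ∧ w ≠ a ∧ w ≠ a' ∧ w ∈ J := by
  simp at hw; tauto

theorem Full.map_ne_zero (h : Full M J x t a a' φ) {δ : V} (hδ : δ ≠ 0) : φ δ ≠ 0 :=
  lk_ne_zero h.layer.crit.isCode (h.links δ) h.ne h.mems.2.2.2.2.2.1 hδ

theorem Full.map_add (h : Full M J x t a a' φ) (δ ε : V) : φ (δ + ε) = φ δ + φ ε := by
  obtain ⟨-, -, -, -, -, haL, haL'⟩ := h.mems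
  exact lk_unique h.layer.crit.isCode (h.links _) ((h.links δ).lk_add (h.links ε) haL haL') h.ne
    (InFace.refl _ _) (InFace.refl _ _) haL haL

theorem Full.map_ne (h : Full M J x t a a' φ) (hne : σ ≠ σ') : φ σ ≠ φ σ' := by
  intro e
  have h0 : σ + σ' ≠ 0 := fun e' => hne (by rw [← V.add_add_cancel σ σ', e', zero_add])
  exact h.map_ne_zero h0 (by rw [h.map_add, e, V.add_self])

/-- Links on a face meeting the layer are given by `φ`. -/
theorem Full.eq_map (h : Full M J x t a a' φ) (hy : InFace J x y) (ha : a ∈ I)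
    (ht : t ∈ I) {δ ε : V} (hs : Stab M I y (lk a δ a' ε)) : ε = φ δ :=
  lk_unique h.layer.crit.isCode hs (h.links δ) h.ne ((InFace.refl I y).update ht (x t))
    (inFace_update_layer h.layer.mem hy).1 ha h.mems.2.2.2.2.2.1

theorem Full.exists_linked (h : Full M J x t a a' φ) (hy : InFace J x y) :
    ∃ σ, σ ≠ 0 ∧ Linked M t a a' φ σ y := by
  obtain ⟨hta, hta', -⟩ := h.mems
  obtain ⟨Z, hZ⟩ := semi_triple h.layer.crit.isCode h.ne hta.symm hta'.symm (x := y)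
  have hl := hZ.2 a (by simp) a' (by simp) h.ne
  refine ⟨Z a, hZ.1 a (by simp), ?_⟩
  rw [h.eq_map hy (by simp) (by simp) hl] at hl
  exact hl

theorem Full.linked_of_two (h : Full M J x t a a' φ) (hσ : σ ≠ 0) (hσ' : σ' ≠ 0) (hne : σ ≠ σ')
    (h1 : Linked M t a a' φ σ y) (h2 : Linked M t a a' φ σ' y) {δ : V} (hδ : δ ≠ 0) :
    Linked M t a a' φ δ y := by
  rcases V.cases_of_ne σ σ' δ hσ hσ' hne with rfl | rfl | rfl | rfl
  · exact absurd rfl hδ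
  · exact h1
  · exact h2
  · unfold Linked
    rw [h.map_add]
    exact Stab.lk_add h1 h2 (by simp) (by simp)

theorem Linked.congr (h : Linked M t a a' φ σ y) (hz : InFace {a, a', t} y z) :
    Linked M t a a' φ σ z := Stab.mono h subset_rfl hz

theorem Full.linked_update_of_red (h : Full M J x t a a' φ) (hw : w ∈ J.erase t \ {a, a'})
    (hy : InFace J x y) (hr : Red M (insert t (insert w {a, a'})) y) (hK : Linked M t a a' φ σ y)
    (v : V) : Linked M t a a' φ σ (update y w v) := by
  have hM := h.layer.crit.isCode
  obtain ⟨hta, hta', haJ, haJ', htJ, haL, haL'⟩ := h.mems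
  obtain ⟨hwt, hwa, hwa', hwJ⟩ := Full.mem_rest hw
  have haa := h.ne
  obtain ⟨f1, f2⟩ := inFace_update_layer (G := insert t (insert w {a, a'}))
    (Finset.mem_insert_self t _) hy
  have hlinks : ∀ δ, Stab M {a, a', w} (update y t (x t)) (lk a δ a' (φ δ)) := fun δ =>
    (h.links δ).mono (by intro k hk; simp at hk; rcases hk with rfl | rfl | rfl <;> simp [*]) f1
  have hsub : ({a, a', t} : Finset ι) ⊆ insert t (insert w {a, a'}) := by
    intro k hk; simp at hk ⊢; tauto
  -- conjugation by a link at `w`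
  have conj : ∀ b, b ∈ ({a, a'} : Finset ι) → b ≠ w → (∀ π, π ≠ 0 → ∃ θ,
      Stab M (insert t (insert w {a, a'})) (update y t (x t)) (lk b π w θ)) →
      Linked M t a a' φ σ (update y w v) := by
    intro b hb hbw hfull
    obtain ⟨π, hπ⟩ := exists_link_to hM hbw (by simp at hb ⊢; tauto) hfull (v + y w)
    refine Stab.conj hπ hsub f2.symm (lk_supp (by simp at hb ⊢; tauto) (by simp))
      (lk_supp (by simp) (by simp)) hK fun k hk => ?_
    by_cases hkw : k = w
    · subst hkw
      rw [lk_right hbw, update_self, add_comm v, ← add_assoc, V.add_self, zero_add]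
    · have : k ≠ b := by rintro rfl; simp at hb hk; tauto
      rw [lk_other this hkw, update_of_ne hkw, add_zero]
  rcases h.layer.split_of_red hw hy hr with hs | hs | hs
  · have := hs.stab hM (k := t) (v := lk a σ a' (φ σ)) (by intro k hk; simp at hk ⊢; tauto)
      (by simp) (by simp [hta, hta']) (lk_supp (by simp) (by simp))
      (by rwa [show insert t ({a, a'} : Finset ι) = {a, a', t} by ext; simp; tauto])
    exact this.mono hsub ((InFace.refl _ y).update (by simp) v)
  · refine conj a' (by simp) hwa'.symm fun π hπ => ?_
    obtain ⟨δ, hδ⟩ := exists_link_to hM haa (by simp) (fun δ _ => ⟨_, hlinks δ⟩) π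
    have hδ0 : δ ≠ 0 := lk_ne_zero hM (hδ.lk_symm haa) haa.symm (by simp) hπ
    obtain ⟨θ, -, -, hθ⟩ := exists_link_third hM haa hwa.symm hwa'.symm hδ hδ0
    refine ⟨θ, (hs.compl.mono subset_rfl f2).stab hM (k := a) Finset.sdiff_subset (by simp)
      (by simp) (lk_supp ?_ ?_) (hθ.mono ?_ (InFace.refl _ _))⟩
    · simp [hta'.symm, haa.symm]
    · simp [hwt, hwa]
    · intro k hk
      simp at hk ⊢
      tauto
  · refine conj a (by simp) hwa.symm fun π hπ => ?_
    obtain ⟨θ, -, hθ, -⟩ := exists_link_third hM haa hwa.symm hwa'.symm (hlinks π) hπ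
    refine ⟨θ, (hs.compl.mono subset_rfl f2).stab hM (k := a') Finset.sdiff_subset (by simp)
      (by simp) (lk_supp ?_ ?_) (hθ.mono ?_ (InFace.refl _ _))⟩
    · simp [hta.symm, haa]
    · simp [hwt, hwa']
    · intro k hk
      simp at hk ⊢
      tauto

/-- The directions outside the block in which two points differ. -/
def gap (J : Finset ι) (t a a' : ι) (y z : ι → V) : Finset ι :=
  (J.erase t \ {a, a'}).filter fun w => y w ≠ z w

theorem gap_comm : gap J t a a' y z = gap J t a a' z y := by
  simp [gap, ne_comm]

/-- A closest pair of points without a common link between `a` and `a'`. -/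
structure Conflict (M : Set (ι → V)) (J : Finset ι) (x : ι → V) (t a a' : ι) (φ : V → V)
    (y y' : ι → V) (σ σ' : V) : Prop extends Full M J x t a a' φ where
  inFace : InFace J x y
  inFace' : InFace (J.erase t \ {a, a'}) y y'
  ne_zero : σ ≠ 0
  ne_zero' : σ' ≠ 0
  linked : Linked M t a a' φ σ y
  linked' : Linked M t a a' φ σ' y'
  unique : ∀ δ, δ ≠ 0 → Linked M t a a' φ δ y → δ = σ
  unique' : ∀ δ, δ ≠ 0 → Linked M t a a' φ δ y' → δ = σ'
  ne_of : σ ≠ σ'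
  close : ∀ z, InFace J x z → (gap J t a a' z y).card < (gap J t a a' y y').card →
    Linked M t a a' φ σ z
  close' : ∀ z, InFace J x z → (gap J t a a' z y').card < (gap J t a a' y y').card →
    Linked M t a a' φ σ' z

theorem Full.rest_subset : J.erase t \ {a, a'} ⊆ J :=
  Finset.sdiff_subset.trans (Finset.erase_subset _ _)

theorem Conflict.symm (h : Conflict M J x t a a' φ y y' σ σ') :
    Conflict M J x t a a' φ y' y σ' σ where
  toFull := h.toFull
  inFace := h.inFace.trans (h.inFace'.mono Full.rest_subset)
  inFace' := h.inFace'.symm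
  ne_zero := h.ne_zero'
  ne_zero' := h.ne_zero
  linked := h.linked'
  linked' := h.linked
  unique := h.unique'
  unique' := h.unique
  ne_of := h.ne_of.symm
  close := by rw [gap_comm (y := y')]; exact h.close'
  close' := by rw [gap_comm (y := y')]; exact h.close

theorem Full.exists_conflict (h : Full M J x t a a' φ) :
    ∃ y y' σ σ', Conflict M J x t a a' φ y y' σ σ' := by
  classical
  obtain ⟨hta, hta', haJ, haJ', htJ, haL, haL'⟩ := h.mems
  set C : (ι → V) → (ι → V) → Prop := fun y y' =>
    ∀ σ, σ ≠ 0 → ¬(Linked M t a a' φ σ y ∧ Linked M t a a' φ σ y') with hC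
  have hex : ∃ y y', InFace J x y ∧ InFace J x y' ∧ C y y' := by
    by_contra! hcon
    have nol : ∀ σ, σ ≠ 0 → ∃ y, InFace J x y ∧ ¬Linked M t a a' φ σ y := by
      intro σ hσ
      by_contra! hall
      exact h.layer.crit.not_link h.ne haJ haJ' hσ (ρ := φ σ) fun p hp hpM =>
        hall p hp p (InFace.refl _ _) hpM
    obtain ⟨y, hy, hny⟩ := nol (1, 0) (by decide)
    obtain ⟨σ, hσ, hK⟩ := h.exists_linked hy
    obtain ⟨z, hz, hnz⟩ := nol σ hσ
    have := hcon y z hy hz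
    simp only [hC] at this
    push Not at this
    obtain ⟨δ, hδ, h1, h2⟩ := this
    refine hny (h.linked_of_two hσ hδ ?_ hK h1 (by decide))
    rintro rfl
    exact hnz h2
  have hex' : ∃ m, ∃ y y', InFace J x y ∧ InFace J x y' ∧ C y y' ∧
      (gap J t a a' y y').card = m := by
    obtain ⟨y, y', h1, h2, h3⟩ := hex
    exact ⟨_, y, y', h1, h2, h3, rfl⟩
  obtain ⟨y, z, hy, hz, hyz, hm⟩ := Nat.find_spec hex'
  have hmin : ∀ u v, InFace J x u → InFace J x v → (gap J t a a' u v).card < Nat.find hex' →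
      ∃ δ, δ ≠ 0 ∧ Linked M t a a' φ δ u ∧ Linked M t a a' φ δ v := by
    intro u v hu hv hlt
    by_contra! hcon
    exact Nat.find_min hex' hlt ⟨u, v, hu, hv, fun δ hδ hc => hcon δ hδ hc.1 hc.2, rfl⟩
  set y' := (J.erase t \ {a, a'}).piecewise z y with hy'
  have hJ' : InFace J x y' := hz.piecewise hy _
  have hzy : InFace {a, a', t} z y' := by
    intro k hk
    by_cases hkB : k ∈ J.erase t \ {a, a'}
    · simp only [hy', hkB, Finset.piecewise_eq_of_mem]
    · have : k ∉ J := by simp at hk hkB; tauto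
      rw [hJ' k this, hz k this]
  have hC' : C y y' := fun δ hδ hc => hyz δ hδ ⟨hc.1, hc.2.congr hzy.symm⟩
  have hgap : gap J t a a' y y' = gap J t a a' y z := by
    refine Finset.filter_congr fun w hw => ?_
    simp only [hy', hw, Finset.piecewise_eq_of_mem]
  obtain ⟨σ, hσ, hK⟩ := h.exists_linked hy
  obtain ⟨σ', hσ', hK'⟩ := h.exists_linked hJ'
  have u1 : ∀ δ, δ ≠ 0 → Linked M t a a' φ δ y → δ = σ := by
    intro δ hδ hl
    by_contra hne
    exact hC' σ' hσ' ⟨h.linked_of_two hδ hσ hne hl hK hσ', hK'⟩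
  have u2 : ∀ δ, δ ≠ 0 → Linked M t a a' φ δ y' → δ = σ' := by
    intro δ hδ hl
    by_contra hne
    exact hC' σ hσ ⟨hK, h.linked_of_two hδ hσ' hne hl hK' hσ⟩
  refine ⟨y, y', σ, σ', h, hy, ?_, hσ, hσ', hK, hK', u1, u2, ?_, ?_, ?_⟩
  · intro k hk
    simp only [hy', hk, Finset.piecewise_eq_of_notMem, not_false_eq_true]
  · rintro rfl
    exact hC' σ hσ ⟨hK, hK'⟩
  · intro u hu hlt
    rw [hgap, hm] at hlt
    obtain ⟨δ, hδ, h1, h2⟩ := hmin u y hu hy hlt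
    exact u1 δ hδ h2 ▸ h1
  · intro u hu hlt
    rw [hgap, hm] at hlt
    obtain ⟨δ, hδ, h1, h2⟩ := hmin u y' hu hJ' hlt
    exact u2 δ hδ h2 ▸ h1

end Full

/-! ### Blocks at a conflict -/

section Blocks

variable {ι : Type*} [DecidableEq ι]
variable {M : Set (ι → V)} {J I A B F K T : Finset ι} {x y y' z v q s : ι → V}
variable {i j k a a' t w b e : ι} {π ρ σ σ' θ : V} {φ : V → V}

/-- If a reducible face contains a triple all of whose one-element extensions are irreducible,
then some part of a decomposition avoids the triple. -/
theorem exists_split_of_not_red (hF : F ⊆ K) (hF3 : F.card = 3) (hr : Red M K z)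
    (h : ∀ w ∈ K \ F, ¬Red M (insert w F) z) :
    ∃ B ⊆ K \ F, 2 ≤ B.card ∧ Split M K z B := by
  have key : ∀ A ⊆ K, 2 ≤ A.card → Split M K z A → (F ∩ A).card ≤ 1 → A ⊆ K \ F := by
    intro A hA hA2 hs hFA i hi
    rw [Finset.mem_sdiff]
    refine ⟨hA hi, fun hiF => ?_⟩
    have hsub : F ∩ A = {i} := by
      refine Finset.eq_singleton_iff_unique_mem.2 ⟨by simp [hi, hiF], fun k hk => ?_⟩
      exact Finset.card_le_one.1 hFA k hk i (by simp [hi, hiF])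
    obtain ⟨w, hwA, hwi⟩ := Finset.exists_mem_ne (s := A) (by omega) i
    have hwF : w ∉ F := fun hw => hwi (by
      have : w ∈ F ∩ A := by simp [hw, hwA]
      simpa [hsub] using this)
    have hc := Finset.card_sdiff_add_card_inter F A
    rw [hsub, Finset.card_singleton] at hc
    refine h w (by simp [hA hwA, hwF]) (Red.of_split (hs.mono ?_ (InFace.refl _ _)) ?_ ?_)
    · exact Finset.insert_subset (hA hwA) hF
    · rw [Finset.insert_inter_of_mem hwA, hsub, Finset.card_pair hwi]
    · rw [Finset.insert_sdiff_of_mem _ hwA]; omega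
  obtain ⟨A, hA, h2, h3, hs⟩ := hr
  by_cases hFA : (F ∩ A).card ≤ 1
  · exact ⟨A, key A hA h2 hs hFA, h2, hs⟩
  · refine ⟨K \ A, key _ Finset.sdiff_subset h3 hs.compl ?_, h3, hs.compl⟩
    have hc := Finset.card_sdiff_add_card_inter F A
    rw [← Finset.inter_sdiff_assoc, Finset.inter_eq_left.2 hF]; omega

/-- For a decomposition with part `B`, links off `B` can be checked at points with prescribed
values on `B`, except at one place. -/
theorem Split.stab_of_modify (hM : IsCode M) (h : Split M K x B) (hB : B ⊆ K) (hI : I ⊆ K \ B)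
    (he : e ∈ B) (hb : b ∈ I) (hq : InFace K x q) (hs : InFace K x s)
    (hv : ∀ i, i ∉ I → v i = 0)
    (H : ∀ r, InFace K x r → (∀ i ∈ K \ B, i ∉ I → r i = q i) → (∀ i ∈ B.erase e, r i = s i) →
      Stab M I r v) : Stab M I q v := by
  have hbK : b ∈ K \ B := hI hb
  obtain ⟨p, hpM, hp, hpe⟩ := hM.exists_inFace hq (Finset.mem_sdiff.1 hbK).1
  obtain ⟨r, hrM, hr, hre⟩ := hM.exists_inFace (J := K) (x := x) (y := B.piecewise s p)
    (hs.piecewise hp _) (hB he)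
  have hrp : ∀ i ∈ K \ B, r i = p i := by
    intro i hi
    have hiB := (Finset.mem_sdiff.1 hi).2
    rw [hre i (fun e' => hiB (e' ▸ he)), Finset.piecewise_eq_of_notMem _ _ _ hiB]
  have hst : Stab M I r v := by
    refine H r hr (fun i hi hiI => ?_) fun i hi => ?_
    · rw [hrp i hi, hpe i (fun e' => hiI (e' ▸ hb))]
    · have := Finset.mem_erase.1 hi
      rw [hre i this.1, Finset.piecewise_eq_of_mem _ _ _ this.2]
  have := h.compl.stab_congr hI hr hp hrM hpM hrp Finset.sdiff_subset hv hst
  refine this.mono subset_rfl fun i hi => ?_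
  rw [hpe i (fun e' => hi (e' ▸ hb))]

theorem Conflict.not_red_block (h : Conflict M J x t a a' φ y y' σ σ')
    (hw : w ∈ gap J t a a' y y') : ¬Red M (insert w {a, a', t}) y := by
  intro hr
  have hset : (insert w {a, a', t} : Finset ι) = insert t (insert w {a, a'}) := by
    ext; simp; tauto
  rw [hset] at hr
  obtain ⟨hwB, hwne⟩ := Finset.mem_filter.1 hw
  have hwJ := (Full.mem_rest hwB).2.2.2
  have hlt : (gap J t a a' (update y w (y' w)) y').card < (gap J t a a' y y').card := by
    refine Finset.card_lt_card ⟨fun k hk => ?_, fun hsub => ?_⟩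
    · simp only [gap, Finset.mem_filter] at hk ⊢
      refine ⟨hk.1, ?_⟩
      by_cases hkw : k = w
      · subst hkw; exact absurd (by simp) hk.2
      · simpa [hkw] using hk.2
    · have := hsub hw
      simp [gap] at this
  have h1 := h.close' _ (h.inFace.update hwJ (y' w)) hlt
  have hr' := hr.congr ((InFace.refl _ y).update (i := w) (by simp) (y' w))
  have := h.toFull.linked_update_of_red hwB (h.inFace.update hwJ (y' w)) hr' h1 (y w)
  rw [update_idem, update_eq_self] at this
  exact h.ne_of (h.unique _ h.ne_zero' this).symm

theorem Conflict.block_subset (h : Conflict M J x t a a' φ y y' σ σ')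
    (hT : T ⊆ J.erase t \ {a, a'}) : {a, a', t} ∪ T ⊆ J := by
  obtain ⟨-, -, haJ, haJ', htJ, -⟩ := h.toFull.mems
  refine Finset.union_subset ?_ (hT.trans Full.rest_subset)
  intro k hk
  simp at hk
  rcases hk with rfl | rfl | rfl <;> assumption

theorem Conflict.card_block (h : Conflict M J x t a a' φ y y' σ σ') :
    ({a, a', t} : Finset ι).card = 3 := by
  obtain ⟨hta, hta', -⟩ := h.toFull.mems
  rw [Finset.card_eq_three]
  exact ⟨a, a', t, h.ne, hta.symm, hta'.symm, rfl⟩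

theorem Conflict.block_ssubset (h : Conflict M J x t a a' φ y y' σ σ')
    (hT : T ⊂ J.erase t \ {a, a'}) : {a, a', t} ∪ T ⊂ J := by
  refine ⟨h.block_subset hT.1, fun hsub => hT.2 fun k hk => ?_⟩
  have hk' := hsub (Full.rest_subset hk)
  simp at hk hk'
  tauto

/-- The two points of a conflict differ in all directions outside the block. -/
theorem Conflict.gap_eq (h : Conflict M J x t a a' φ y y' σ σ') :
    gap J t a a' y y' = J.erase t \ {a, a'} := by
  have hM := h.layer.crit.isCode
  by_contra hne
  set W := gap J t a a' y y' with hW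
  have hWB : W ⊂ J.erase t \ {a, a'} := (Finset.filter_subset _ _).ssubset_of_ne hne
  have hy' : InFace ({a, a', t} ∪ W) y y' := by
    intro k hk
    by_cases hkB : k ∈ J.erase t \ {a, a'}
    · by_contra hc
      exact hk (Finset.mem_union_right _ (Finset.mem_filter.2 ⟨hkB, fun e => hc e.symm⟩))
    · exact h.inFace' k hkB
  have hKJ := h.block_subset hWB.1
  rcases h.layer.crit.smaller _ (h.block_ssubset hWB) y with hr | ⟨X, hX⟩
  · obtain ⟨B, hB, hB2, hs⟩ := exists_split_of_not_red (F := {a, a', t})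
      Finset.subset_union_left h.card_block hr fun w hw =>
        h.not_red_block (by
          rw [Finset.mem_sdiff, Finset.mem_union] at hw
          tauto)
    obtain ⟨e, he, e', he', hee⟩ := Finset.one_lt_card.1 hB2
    have hBW : B ⊆ W := fun k hk => by
      have := hB hk
      rw [Finset.mem_sdiff, Finset.mem_union] at this
      tauto
    have hl : Linked M t a a' φ σ y' := by
      refine hs.stab_of_modify hM (hB.trans Finset.sdiff_subset) (b := a) (e := e) (s := y) ?_ he
        (by simp) hy' (InFace.refl _ _) (lk_supp (by simp) (by simp)) fun r hr' _ hrs => ?_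
      · intro k hk
        refine Finset.mem_sdiff.2 ⟨Finset.mem_union_left _ hk, fun hkB => ?_⟩
        exact (Finset.mem_sdiff.1 (hB hkB)).2 hk
      · refine h.close r (h.inFace.trans (hr'.mono hKJ)) (Finset.card_lt_card ?_)
        refine ⟨fun k hk => ?_, fun hsub => ?_⟩
        · have hk' := Finset.mem_filter.1 hk
          by_contra hkW
          refine hk'.2 (hr' k ?_)
          have := hk'.1
          simp only [Finset.mem_union, Finset.mem_insert, Finset.mem_singleton,
            Finset.mem_sdiff, Finset.mem_erase] at this ⊢
          tauto
        · have := (Finset.mem_filter.1 (hsub (hBW he'))).2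
          exact this (hrs e' (by simp [he', hee.symm]))
    exact h.ne_of (h.unique' _ h.ne_zero hl)
  · have hl := hX.2 a (by simp) a' (by simp) h.ne
    rw [h.toFull.eq_map h.inFace (by simp) (by simp) hl] at hl
    have h0 := hX.1 a (by simp)
    have e1 := h.unique _ h0 (hl.mono Finset.subset_union_left (InFace.refl _ _))
    have e2 := h.unique' _ h0 (hl.mono Finset.subset_union_left hy')
    exact h.ne_of (e1.symm.trans e2)

/-- The link between `a'` and `t` on the block extends to all proper faces. -/
theorem Conflict.stab_union (h : Conflict M J x t a a' φ y y' σ σ')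
    (hθ : Stab M {a, a', t} y (lk a' (φ σ) t θ)) (hT : T ⊂ J.erase t \ {a, a'}) :
    Stab M ({a, a', t} ∪ T) y (lk a' (φ σ) t θ) := by
  have hM := h.layer.crit.isCode
  obtain ⟨hta, hta', -⟩ := h.toFull.mems
  induction hn : T.card using Nat.strong_induction_on generalizing T with
  | _ n ih =>
  rcases h.layer.crit.smaller _ (h.block_ssubset hT) y with hr | ⟨X, hX⟩
  · obtain ⟨B, hB, hB2, hs⟩ := exists_split_of_not_red (F := {a, a', t})
      Finset.subset_union_left h.card_block hr fun w hw =>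
        h.not_red_block (by
          rw [Finset.mem_sdiff, Finset.mem_union] at hw
          rw [h.gap_eq]
          exact hT.1 (by tauto))
    have hBT : B ⊆ T := fun k hk => by
      have := hB hk
      rw [Finset.mem_sdiff, Finset.mem_union] at this
      tauto
    have hBF : ∀ k ∈ B, k ∉ ({a, a', t} : Finset ι) := fun k hk => (Finset.mem_sdiff.1 (hB hk)).2
    obtain ⟨e, he⟩ : B.Nonempty := Finset.card_pos.1 (by omega)
    have hsub : insert e (T \ B) ⊆ T := Finset.insert_subset (hBT he) Finset.sdiff_subset
    have hcard : (insert e (T \ B)).card < n := by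
      have h1 := Finset.card_insert_le e (T \ B)
      have h2 := Finset.card_sdiff_add_card_eq_card hBT
      omega
    refine hs.compl.stab hM (k := e) Finset.sdiff_subset (by simp [hBT he]) (by simp [he])
      (lk_supp ?_ ?_) ?_
    · rw [Finset.mem_sdiff]
      exact ⟨by simp, fun hk => hBF _ hk (by simp)⟩
    · rw [Finset.mem_sdiff]
      exact ⟨by simp, fun hk => hBF _ hk (by simp)⟩
    · refine (ih _ hcard (hsub.trans_ssubset hT) rfl).mono ?_ (InFace.refl _ _)
      intro k hk
      simp only [Finset.mem_insert, Finset.mem_sdiff, Finset.mem_union] at hk ⊢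
      tauto
  · have hl := hX.2 a (by simp) a' (by simp) h.ne
    have em := h.toFull.eq_map h.inFace (by simp) (by simp) hl
    have e1 : X a = σ := h.unique _ (hX.1 a (by simp)) (by
      rw [em] at hl
      exact hl.mono Finset.subset_union_left (InFace.refl _ _))
    rw [e1] at em
    have h2 := hX.2 a' (by simp) t (by simp) hta'.symm
    rw [em] at h2
    rwa [lk_unique hM h2 hθ hta'.symm (InFace.refl _ _) (InFace.refl _ _) (by simp)
      (by simp)] at h2

end Blocks

/-! ### Slices at a conflict -/

section Slices

variable {ι : Type*} [DecidableEq ι]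
variable {M : Set (ι → V)} {J I A B F K T : Finset ι} {x y y' z v q s X X' : ι → V}
variable {i j k a a' t w w₁ w₂ b : ι} {π ρ σ σ' θ c e : V} {φ : V → V}

theorem exists_class_of_link (hM : IsCode M) (hF : F.card = 3) (hi : i ∈ F) (hj : j ∈ F)
    (hij : i ≠ j) (h : Stab M F x (lk i π j ρ)) (hπ : π ≠ 0) :
    ∃ Z, IsClass M F x Z ∧ Z i = π := by
  obtain ⟨k, hk⟩ : (F \ {i, j}).Nonempty := by
    rw [← Finset.card_pos]
    have h1 := Finset.card_sdiff_add_card_inter F {i, j}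
    have h2 := (Finset.card_le_card (Finset.inter_subset_right (s₁ := F) (s₂ := {i, j}))).trans
      Finset.card_le_two
    omega
  simp only [Finset.mem_sdiff, Finset.mem_insert, Finset.mem_singleton, not_or] at hk
  obtain ⟨hkF, hki, hkj⟩ := hk
  obtain rfl : F = {i, j, k} := by
    refine (Finset.eq_of_subset_of_card_le ?_ ?_).symm
    · intro l hl
      simp at hl
      rcases hl with rfl | rfl | rfl <;> assumption
    · rw [hF, Finset.card_eq_three.2 ⟨i, j, k, hij, Ne.symm hki, Ne.symm hkj, rfl⟩]
  obtain ⟨θ, hθ, h1, h2⟩ := exists_link_third hM hij (Ne.symm hki) (Ne.symm hkj) h hπ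
  refine ⟨fun l => if l = i then π else if l = j then ρ else θ,
    IsClass.of_hub (k := i) (by simp) ?_ ?_, by simp⟩
  · intro l _
    have := lk_ne_zero hM h hij (by simp) hπ
    split_ifs <;> assumption
  · intro l hl hli
    simp only [Finset.mem_insert, Finset.mem_singleton] at hl
    rcases hl with rfl | rfl | rfl
    · exact absurd rfl hli
    · simpa [hli] using h.lk_symm hij
    · simpa [hli, hkj] using h1.lk_symm (Ne.symm hki)

theorem Red.four_le (h : Red M J x) : 4 ≤ J.card := by
  obtain ⟨A, hA, h2, h3, -⟩ := h
  have := Finset.card_sdiff_add_card_eq_card hA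
  omega

/-- If a triple has a unique class at `y` and two classes at `z`, then the face containing both
is irreducible. -/
theorem not_red_of_two_classes (hM : IsCode M) (hF : F.card = 3) (hw : w ∉ F)
    (hz : InFace (insert w F) y z) {Z Z' : ι → V} (hZ : IsClass M F z Z) (hZ' : IsClass M F z Z')
    (hi : i ∈ F) (hne : Z i ≠ Z' i) (hX : ∀ Y, IsClass M F y Y → ∀ i ∈ F, Y i = X i) :
    ¬Red M (insert w F) y := by
  intro hr
  obtain ⟨d, hd, hs⟩ := exists_split_pair hw hz (fun h => by have := h.four_le; omega) hr
  have hdw : d ≠ w := fun h => hw (h ▸ hd)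
  have hFd : (F.erase d).card = 2 := by rw [Finset.card_erase_of_mem hd, hF]
  obtain ⟨j, hj, k, hk, hjk⟩ := Finset.one_lt_card.1 (by omega : 1 < (F.erase d).card)
  have hcompl : insert w F \ {w, d} = F.erase d := by
    ext l
    simp only [Finset.mem_sdiff, Finset.mem_insert, Finset.mem_singleton, Finset.mem_erase]
    constructor
    · tauto
    · rintro ⟨h1, h2⟩
      exact ⟨Or.inr h2, fun h => h.elim (fun h => hw (h ▸ h2)) h1⟩
  have hs' := hs.compl
  rw [hcompl] at hs'
  have hjF := Finset.mem_of_mem_erase hj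
  have key : ∀ Y, IsClass M F z Y → Y j = X j := by
    intro Y hY
    have h1 := hY.2 j hjF k (Finset.mem_of_mem_erase hk) hjk
    have h2 := (hs'.mono subset_rfl hz).stab hM (k := d)
      ((Finset.erase_subset _ _).trans (Finset.subset_insert _ _)) (by simp [hd]) (by simp)
      (lk_supp hj hk) (by rwa [Finset.insert_erase hd])
    obtain ⟨Y', hY', e⟩ := exists_class_of_link hM hF hjF (Finset.mem_of_mem_erase hk) hjk
      (h2.mono (Finset.subset_insert w F) hz.symm) (hY.1 j hjF)
    rw [← e, hX Y' hY' j hjF]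
  refine hne (hZ.eq_of_eq hM hZ' hjF ?_ hi)
  rw [key Z' hZ', key Z hZ]

/-- The block extended by `w` at `y` has the class `X`, which is the only one on the slices
`c` and `c + σ` of the direction `a`. -/
structure Slice (M : Set (ι → V)) (t a a' w : ι) (φ : V → V) (y : ι → V) (σ c : V)
    (X : ι → V) : Prop where
  isClass : IsClass M (insert w {a, a', t}) y X
  fst : X a = σ
  snd : X a' = φ σ
  unique : ∀ e, (e = c ∨ e = c + σ) → ∀ Z, IsClass M {a', t, w} (update y a e) Z →
    ∀ i ∈ ({a', t, w} : Finset ι), Z i = X i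

theorem Conflict.exists_slice (h : Conflict M J x t a a' φ y y' σ σ')
    (hw : w ∈ J.erase t \ {a, a'}) :
    ∃ c₀ X, ∀ c, (c = c₀ ∨ c = c₀ + σ) → Slice M t a a' w φ y σ c X := by
  have hM := h.layer.crit.isCode
  obtain ⟨hta, hta', -⟩ := h.toFull.mems
  obtain ⟨hwt, hwa, hwa', -⟩ := Full.mem_rest hw
  have hnr := h.not_red_block (w := w) (by rwa [h.gap_eq])
  have hcard : (insert w {a, a', t} : Finset ι).card = 4 := by
    rw [Finset.card_insert_of_notMem (by simp [hwt, hwa, hwa']), h.card_block]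
  obtain ⟨X, hX⟩ := (red_or_semi_of_card_four hM hcard).resolve_left hnr
  have hl := hX.2 a (by simp) a' (by simp) h.ne
  have em := h.toFull.eq_map h.inFace (by simp) (by simp) hl
  have e1 : X a = σ := h.unique _ (hX.1 a (by simp)) (by
    rw [em] at hl
    exact hl.mono (Finset.subset_insert _ _) (InFace.refl _ _))
  obtain ⟨c₀, hc₀⟩ := exists_unique_slice hM hX hcard.ge (a := a) (by simp) hnr
  have hset : (insert w {a, a', t} : Finset ι).erase a = {a', t, w} := by
    ext l
    simp only [Finset.mem_erase, Finset.mem_insert, Finset.mem_singleton]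
    constructor
    · tauto
    · rintro (rfl | rfl | rfl)
      · exact ⟨h.ne.symm, by tauto⟩
      · exact ⟨hta, by tauto⟩
      · exact ⟨hwa, by tauto⟩
  rw [hset, e1] at hc₀
  refine ⟨c₀, X, fun c hc => ⟨hX, e1, e1 ▸ em, fun e he => hc₀ e ?_⟩⟩
  rcases hc with rfl | rfl <;> rcases he with rfl | rfl <;> simp [V.add_add_cancel]

theorem Slice.not_link (hM : IsCode M) (h : Slice M t a a' w φ y σ c X)
    (hF : ({a', t, w} : Finset ι).card = 3) (he : e = c ∨ e = c + σ) (hπ : π ≠ 0)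
    (hne : π ≠ φ σ) {j : ι} (hj : j ∈ ({a', t, w} : Finset ι)) (hj' : a' ≠ j) :
    ¬Stab M {a', t, w} (update y a e) (lk a' π j ρ) := by
  intro hs
  obtain ⟨Z, hZ, hZa⟩ := exists_class_of_link hM hF (by simp) hj hj' hs hπ
  exact hne (by rw [← hZa, ← h.snd, h.unique e he Z hZ a' (by simp)])

theorem Conflict.card_triple (h : Conflict M J x t a a' φ y y' σ σ')
    (hw : w ∈ J.erase t \ {a, a'}) : ({a', t, w} : Finset ι).card = 3 := by
  obtain ⟨hta, hta', -⟩ := h.toFull.mems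
  obtain ⟨hwt, hwa, hwa', -⟩ := Full.mem_rest hw
  exact Finset.card_eq_three.2 ⟨a', t, w, hta'.symm, hwa'.symm, hwt.symm, rfl⟩

theorem Conflict.triple_subset (h : Conflict M J x t a a' φ y y' σ σ')
    (hw : w ∈ J.erase t \ {a, a'}) : {a', t, w} ⊆ J.erase a := by
  obtain ⟨hta, hta', haJ, haJ', htJ, -⟩ := h.toFull.mems
  obtain ⟨hwt, hwa, hwa', hwJ⟩ := Full.mem_rest hw
  intro k hk
  simp only [Finset.mem_insert, Finset.mem_singleton] at hk
  rcases hk with rfl | rfl | rfl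
  · simp [h.ne.symm, haJ']
  · simp [hta, htJ]
  · simp [hwa, hwJ]

theorem Conflict.inFace_update (h : Conflict M J x t a a' φ y y' σ σ') (c : V) :
    InFace (J.erase a) (update y a c) (update y' a c) := by
  intro k hk
  by_cases hka : k = a
  · subst hka; simp
  · rw [update_of_ne hka, update_of_ne hka]
    refine h.inFace' k fun hk' => hk ?_
    have := Full.mem_rest hk'
    simp [hka, this.2.2.2]

/-- The common slice of two points of a conflict is reducible. -/
theorem Conflict.red_slice (h : Conflict M J x t a a' φ y y' σ σ')
    (hw : w ∈ J.erase t \ {a, a'}) (hX : Slice M t a a' w φ y σ c X)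
    (hX' : Slice M t a a' w φ y' σ' c X') : Red M (J.erase a) (update y a c) := by
  refine (h.layer.crit.smaller _ (Finset.erase_ssubset h.toFull.mems.2.2.1) _).resolve_right ?_
  rintro ⟨Z, hZ⟩
  have hsub := h.triple_subset hw
  have e1 := hX.unique c (Or.inl rfl) Z (hZ.mono hsub (InFace.refl _ _)) a' (by simp)
  have e2 := hX'.unique c (Or.inl rfl) Z (hZ.mono hsub (h.inFace_update c)) a' (by simp)
  exact h.toFull.map_ne h.ne_of (by rw [← hX.snd, ← hX'.snd, ← e1, ← e2])

theorem Conflict.exists_third (h : Conflict M J x t a a' φ y y' σ σ') :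
    ∃ θ, Stab M {a, a', t} y (lk a' (φ σ) t θ) := by
  obtain ⟨hta, hta', -⟩ := h.toFull.mems
  obtain ⟨θ, -, -, hθ⟩ := exists_link_third h.layer.crit.isCode h.ne hta.symm hta'.symm h.linked
    h.ne_zero
  exact ⟨θ, hθ⟩

theorem Conflict.exists_common_slice (h : Conflict M J x t a a' φ y y' σ σ')
    (hw : w ∈ J.erase t \ {a, a'}) :
    ∃ c X X', Slice M t a a' w φ y σ c X ∧ Slice M t a a' w φ y' σ' c X' := by
  obtain ⟨c, X, hX⟩ := h.exists_slice hw
  obtain ⟨d, X', hX'⟩ := h.symm.exists_slice hw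
  obtain ⟨e, h1, h2⟩ := V.cosets_meet c d σ σ' h.ne_zero h.ne_zero' h.ne_of
  exact ⟨e, X, X', hX e h1, hX' e h2⟩

/-- There are at most two directions outside the block of a conflict. -/
theorem Conflict.card_rest_le (h : Conflict M J x t a a' φ y y' σ σ') :
    (J.erase t \ {a, a'}).card ≤ 2 := by
  by_contra! h3
  have hM := h.layer.crit.isCode
  obtain ⟨hta, hta', haJ, haJ', htJ, -⟩ := h.toFull.mems
  have haa := h.ne
  obtain ⟨w₁, hw₁⟩ : (J.erase t \ {a, a'}).Nonempty := Finset.card_pos.1 (by omega)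
  obtain ⟨hwt, hwa, hwa', hwJ⟩ := Full.mem_rest hw₁
  obtain ⟨c, X, X', hX, hX'⟩ := h.exists_common_slice hw₁
  obtain ⟨θ, hθ⟩ := h.exists_third
  obtain ⟨θ', hθ'⟩ := h.symm.exists_third
  have hF3 := h.card_triple hw₁
  have hFK := h.triple_subset hw₁
  have hτ := h.toFull.map_ne_zero h.ne_zero
  have hτ' := h.toFull.map_ne_zero h.ne_zero'
  have hττ := h.toFull.map_ne h.ne_of
  obtain ⟨B, hB, hB2, hs⟩ := exists_split_of_not_red hFK hF3 (h.red_slice hw₁ hX hX') (by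
    intro w hw
    simp only [Finset.mem_sdiff, Finset.mem_erase, Finset.mem_insert, Finset.mem_singleton,
      not_or] at hw
    obtain ⟨⟨hwa₂, hwJ₂⟩, hwa₂', hwt₂, hww⟩ := hw
    have hwB : w ∈ J.erase t \ {a, a'} := by simp [*]
    set z := update (update y a c) w (y' w) with hz
    have l1 : Stab M {a', t, w₁} z (lk a' (φ σ) t θ) := by
      refine (h.stab_union (T := {w, w₁}) hθ ?_).mono ?_ fun k hk => ?_
      · refine ⟨fun k hk => ?_, fun hsub => ?_⟩
        · simp only [Finset.mem_insert, Finset.mem_singleton] at hk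
          rcases hk with rfl | rfl <;> assumption
        · have := (Finset.card_le_card hsub).trans Finset.card_le_two
          omega
      · intro k hk
        simp at hk ⊢; tauto
      · simp only [Finset.mem_union, Finset.mem_insert, Finset.mem_singleton, not_or] at hk
        rw [hz, update_of_ne hk.2.1, update_of_ne hk.1.1]
    have l2 : Stab M {a', t, w₁} z (lk a' (φ σ') t θ') := by
      refine (h.symm.stab_union (T := (J.erase t \ {a, a'}).erase w) hθ'
        (Finset.erase_ssubset hwB)).mono ?_ fun k hk => ?_
      · intro k hk
        simp only [Finset.mem_insert, Finset.mem_singleton] at hk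
        rcases hk with rfl | rfl | rfl
        · simp
        · simp
        · simp [Ne.symm hww, hwt, hwa, hwa', hwJ]
      · simp only [Finset.mem_union, Finset.mem_insert, Finset.mem_singleton, not_or] at hk
        by_cases hkw : k = w
        · subst hkw; simp [hz]
        · rw [hz, update_of_ne hkw, update_of_ne hk.1.1]
          refine (h.inFace' k fun hkB => hk.2 ?_).symm
          simp only [Finset.mem_erase]
          exact ⟨hkw, hkB⟩
    obtain ⟨Z, hZ, eZ⟩ := exists_class_of_link hM hF3 (by simp) (by simp) hta'.symm l1 hτ
    obtain ⟨Z', hZ', eZ'⟩ := exists_class_of_link hM hF3 (by simp) (by simp) hta'.symm l2 hτ'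
    refine not_red_of_two_classes hM hF3 (by simp [hwa₂', hwt₂, hww])
      ((InFace.refl _ _).update (by simp) _) hZ hZ' (i := a') (by simp) (by rwa [eZ, eZ'])
      (hX.unique c (Or.inl rfl)))
  obtain ⟨e, he, e', he', hee⟩ := Finset.one_lt_card.1 hB2
  have hBF : ∀ k ∈ B, k ∉ ({a', t, w₁} : Finset ι) := fun k hk => (Finset.mem_sdiff.1 (hB hk)).2
  have hBr : ∀ k ∈ B, k ∈ J.erase t \ {a, a'} := by
    intro k hk
    have := hB hk
    simp at this ⊢
    tauto
  refine hX'.not_link hM hF3 (Or.inl rfl) hτ hττ (j := t) (ρ := θ) (by simp) hta'.symm ?_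
  refine hs.stab_of_modify hM (hB.trans Finset.sdiff_subset) (b := a') (e := e)
    (s := update y a c) (fun k hk => Finset.mem_sdiff.2 ⟨hFK hk, fun hkB => hBF k hkB hk⟩) he
    (by simp) (h.inFace_update c) (InFace.refl _ _) (lk_supp (by simp) (by simp))
    fun r hr _ hrs => ?_
  refine (h.stab_union (T := (J.erase t \ {a, a'}) \ B.erase e) hθ ?_).mono ?_ fun k hk => ?_
  · refine ⟨Finset.sdiff_subset, fun hsub => ?_⟩
    have := hsub (hBr e' he')
    simp [he', hee.symm] at this
  · intro k hk
    have hkB : k ∉ B := fun hkB => hBF k hkB hk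
    simp only [Finset.mem_insert, Finset.mem_singleton] at hk
    rcases hk with rfl | rfl | rfl
    · simp
    · simp
    · simp [hwt, hwa, hwa', hwJ, hkB]
  · simp only [Finset.mem_union, Finset.mem_insert, Finset.mem_singleton, not_or] at hk
    by_cases hkB : k ∈ B.erase e
    · rw [hrs k hkB, update_of_ne hk.1.1]
    · rw [hr k, update_of_ne hk.1.1]
      intro hkJ
      refine hk.2 (Finset.mem_sdiff.2 ⟨?_, hkB⟩)
      simp at hkJ ⊢
      tauto

end Slices

/-! ### Conflicts with two directions outside the block -/

set_option synthInstance.maxSize 1000 in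
theorem V.mem_coset_or : ∀ ω u u' v : V, ω ≠ 0 → u' ≠ u → u' ≠ u + ω →
    v = u ∨ v = u + ω ∨ v = u' ∨ v = u' + ω := by decide

set_option synthInstance.maxSize 4000 in
theorem V.eq_of_two_values : ∀ θ p q r : V, θ ≠ 0 → p ≠ 0 → q ≠ 0 → r ≠ 0 → p ≠ θ → q ≠ θ → r ≠ θ →
    p ≠ q → p ≠ r → q = r := by decide

/-- A two-valued table periodic in both arguments, with a constant column, a non-constant row and
a non-constant column, has another constant row. -/
theorem V.const_row {η : V → V → V} {σ σ' ω θ η₀ c u u' : V} (hσ : σ ≠ 0) (hσ' : σ' ≠ 0)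
    (hσσ : σ ≠ σ') (hω : ω ≠ 0) (hθ : θ ≠ 0) (h1 : ∀ e v, η (e + σ') v = η e v)
    (h2 : ∀ e v, η e (v + ω) = η e v) (h0 : ∀ e v, η e v ≠ 0) (hη : ∀ e v, η e v ≠ θ)
    (hu : ∀ e, η e u = η₀) (hc : ∀ k, ¬∀ v, η c v = k) (hu' : ∀ k, ¬∀ e, η e u' = k) (v : V) :
    η (c + σ) v = η₀ := by
  have hne : u' ≠ u := fun e => hu' η₀ fun b => by rw [e, hu]
  have hne' : u' ≠ u + ω := fun e => hu' η₀ fun b => by rw [e, h2, hu]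
  have hv : ∀ e v, η e v = η₀ ∨ η e v = η e u' := by
    intro e v
    rcases V.mem_coset_or ω u u' v hω hne hne' with rfl | rfl | rfl | rfl
    · exact Or.inl (hu e)
    · exact Or.inl (by rw [h2, hu])
    · exact Or.inr rfl
    · exact Or.inr (h2 _ _)
  have hcu : η c u' ≠ η₀ := fun e => hc η₀ fun v => (hv c v).elim id fun h => h.trans e
  have hcs : η c u' ≠ η (c + σ) u' := by
    intro e
    refine hu' (η c u') fun b => ?_
    rcases V.cases_of_ne σ σ' (b + c) hσ hσ' hσσ with h | h | h | h
    · rw [show b = c by rw [← V.add_add_cancel b c, h, zero_add]]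
    · rw [show b = c + σ by rw [← V.add_add_cancel b c, h, add_comm], e]
    · rw [show b = c + σ' by rw [← V.add_add_cancel b c, h, add_comm], h1]
    · rw [show b = c + σ + σ' by rw [← V.add_add_cancel b c, h, add_comm, add_assoc], h1, e]
  have := V.eq_of_two_values θ _ _ _ hθ (h0 c u') (h0 _ _) (hu c ▸ h0 c u) (hη _ _) (hη _ _)
    (hu c ▸ hη c u) hcs hcu
  exact (hv (c + σ) v).elim id fun h => h.trans this

section TwoRest

variable {ι : Type*} [DecidableEq ι]
variable {M : Set (ι → V)} {J I A B F K T : Finset ι} {x y y' z v q s X X' : ι → V}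
variable {i j k a a' t w w₁ w₂ b : ι} {π ρ σ σ' θ c e : V} {φ : V → V}

theorem exists_pair_link (hM : IsCode M) (hij : i ≠ j) (hπ : π ≠ 0) (x : ι → V) :
    ∃ ρ, ρ ≠ 0 ∧ Stab M {i, j} x (lk i π j ρ) := by
  obtain ⟨ρ, hρ, h⟩ := V.exists_shift (hM.perm hij x).injective hπ
  refine ⟨ρ, hρ, (stab_lk_iff hM hij (by simp) (by simp)).2 fun y hy u => ?_⟩
  rw [hM.perm_congr hij (z := x) fun k hk hk' => hy k (by simp [hk, hk'])]
  exact h u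

theorem Conflict.exists_other_link (h : Conflict M J x t a a' φ y y' σ σ')
    (hB : J.erase t \ {a, a'} = {w₁, w₂}) (hww : w₁ ≠ w₂)
    (hX' : Slice M t a a' w₁ φ y' σ' c X') :
    ∃ η, Stab M {a', t, w₁} (update y' a (c + σ)) (lk a' (φ σ) t η) := by
  have hM := h.layer.crit.isCode
  have haa := h.ne
  obtain ⟨hta, hta', haJ, haJ', htJ, haL, haL'⟩ := h.toFull.mems
  have hw₁ : w₁ ∈ J.erase t \ {a, a'} := by simp [hB]
  obtain ⟨hwt, hwa, hwa', hwJ⟩ := Full.mem_rest hw₁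
  have hτ := h.toFull.map_ne_zero h.ne_zero
  have hττ := h.toFull.map_ne h.ne_of
  have hF3 := h.card_triple hw₁
  set p : V → V → ι → V := fun e v => update (update y' a e) w₁ v with hp
  choose η hη0 hη using fun e v => exists_pair_link hM hta'.symm hτ (p e v)
  have hQ : ∀ e v, InFace (insert w₁ {a, a', t}) y' (p e v) := fun e v =>
    ((InFace.refl _ _).update (by simp) e).update (by simp) v
  have uniq : ∀ e v ε, Stab M {a', t} (p e v) (lk a' (φ σ) t ε) → η e v = ε := fun e v ε hs =>
    lk_unique hM (hη e v) hs hta'.symm (InFace.refl _ _) (InFace.refl _ _) (by simp) (by simp)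
  have hθ' := hX'.isClass.2 a' (by simp) t (by simp) hta'.symm
  have h1 : ∀ e v, η (e + σ') v = η e v := by
    intro e v
    refine uniq _ _ _ (Stab.conj (hX'.isClass.2 a (by simp) a' (by simp) haa) (I := {a', t})
      ?_ (hQ e v) (lk_supp (by simp) (by simp)) (lk_supp (by simp) (by simp)) (hη e v) ?_)
    · intro k hk; simp at hk ⊢; tauto
    · intro k hk
      simp only [Finset.mem_insert, Finset.mem_singleton, not_or] at hk
      by_cases hka : k = a
      · subst hka; simp [hp, hwa.symm, lk_left, hX'.fst]
      · simp only [hp]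
        rw [lk_other hka hk.1, add_zero]
        by_cases hkw : k = w₁
        · subst hkw; simp
        · simp [hkw, hka]
  have h2 : ∀ e v, η e (v + X' w₁) = η e v := by
    intro e v
    refine uniq _ _ _ (Stab.conj (hX'.isClass.2 a' (by simp) w₁ (by simp) hwa'.symm)
      (I := {a', t}) ?_ (hQ e v) (lk_supp (by simp) (by simp)) (lk_supp (by simp) (by simp))
      (hη e v) ?_)
    · intro k hk; simp at hk ⊢; tauto
    · intro k hk
      simp only [Finset.mem_insert, Finset.mem_singleton, not_or] at hk
      by_cases hkw : k = w₁
      · subst hkw; simp [hp, lk_right hwa'.symm]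
      · rw [lk_other hk.1 hkw]
        simp [hp, hkw]
  have hηθ : ∀ e v, η e v ≠ X' t := by
    intro e v he
    have hs := hη e v
    rw [he] at hs
    have hs' : Stab M {a', t} (p e v) (lk a' (φ σ') t (X' t)) := by
      rw [← hX'.snd]
      refine hθ'.mono ?_ (hQ e v)
      intro k hk; simp at hk ⊢; tauto
    have := lk_ne_zero hM (hs.lk_add hs' (by simp) (by simp)) hta'.symm (by simp) (by
      intro e0
      exact hττ (by rw [← V.add_add_cancel (φ σ) (φ σ'), e0, zero_add]))
    exact this (V.add_self _)
  have hpJ : ∀ e v, InFace J x (p e v) := fun e v =>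
    (h.symm.inFace.update haJ e).update hwJ v
  have hcard2 : (gap J t a a' y y').card = 2 := by rw [h.gap_eq, hB, Finset.card_pair hww]
  have hLk : ∀ e δ, δ ≠ 0 → Linked M t a a' φ δ (p e (y w₁)) := by
    intro e δ hδ
    refine h.toFull.linked_of_two h.ne_zero h.ne_zero' h.ne_of (h.close _ (hpJ _ _) ?_)
      (h.close' _ (hpJ _ _) ?_) hδ
    · rw [hcard2]
      refine (Finset.card_le_card (t := {w₂}) fun k hk => ?_).trans_lt (by simp)
      simp only [gap, hB, Finset.mem_filter, Finset.mem_insert, Finset.mem_singleton] at hk ⊢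
      rcases hk with ⟨rfl | rfl, hk⟩
      · exact absurd (by simp [hp]) hk
      · rfl
    · rw [hcard2]
      refine (Finset.card_le_card (t := {w₁}) fun k hk => ?_).trans_lt (by simp)
      simp only [gap, hB, Finset.mem_filter, Finset.mem_insert, Finset.mem_singleton] at hk ⊢
      rcases hk with ⟨rfl | rfl, hk⟩
      · rfl
      · refine absurd ?_ hk
        have : k ≠ a := by
          rintro rfl
          have : k ∈ J.erase t \ {k, a'} := by rw [hB]; simp
          simp at this
        simp [hp, hww.symm, this]
  have hcol : ∀ e, η e (y w₁) = η 0 (y w₁) := by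
    intro e
    by_cases he : e = 0
    · rw [he]
    refine uniq _ _ _ (Stab.conj (hLk 0 e he) (I := {a', t}) ?_ (InFace.refl _ _)
      (lk_supp (by simp) (by simp)) (lk_supp (by simp) (by simp)) (hη 0 (y w₁)) ?_)
    · intro k hk; simp at hk ⊢; tauto
    · intro k hk
      simp only [Finset.mem_insert, Finset.mem_singleton, not_or] at hk
      by_cases hka : k = a
      · subst hka; simp [hp, hwa.symm, lk_left]
      · simp only [hp]
        rw [lk_other hka hk.1, add_zero]
        by_cases hkw : k = w₁
        · subst hkw; simp
        · simp [hkw, hka]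
  have glue : ∀ e ε, (∀ v, η e v = ε) →
      Stab M {a', t, w₁} (update y' a e) (lk a' (φ σ) t ε) := by
    intro e ε hv q hq hqM
    rw [← hv (q w₁)]
    refine hη e (q w₁) q (fun k hk => ?_) hqM
    simp only [Finset.mem_insert, Finset.mem_singleton, not_or] at hk
    by_cases hkw : k = w₁
    · subst hkw; simp [hp]
    · simp only [hp]
      rw [update_of_ne hkw, hq k (by simp [hk, hkw])]
  refine ⟨η 0 (y w₁), glue _ _ (V.const_row h.ne_zero h.ne_zero' h.ne_of
    (hX'.isClass.1 w₁ (by simp)) (hX'.isClass.1 t (by simp)) h1 h2 hη0 hηθ hcol ?_ (u' := y' w₁)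
    ?_)⟩
  · intro k hk
    exact hX'.not_link hM hF3 (Or.inl rfl) hτ hττ (by simp) hta'.symm (glue c k hk)
  · intro k hk
    have hs : Stab M {a', t, a} y' (lk a' (φ σ) t k) := by
      intro q hq hqM
      rw [← hk (q a)]
      refine hη (q a) (y' w₁) q (fun l hl => ?_) hqM
      simp only [Finset.mem_insert, Finset.mem_singleton, not_or] at hl
      by_cases hla : l = a
      · subst hla; simp [hp, hwa.symm]
      · have := hq l (by simp [hl, hla])
        by_cases hlw : l = w₁
        · subst hlw; simp [hp, this]
        · simp [hp, hlw, hla, this]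
    obtain ⟨δ, hδ, hd, -⟩ := exists_link_third hM hta'.symm haa.symm hta hs hτ
    have hd' := hd.lk_symm haa.symm
    have em := h.toFull.eq_map h.symm.inFace (by simp) (by simp) hd'
    have : δ = σ' := h.unique' δ hδ (by
      unfold Linked
      rw [← em]
      refine hd'.mono ?_ (InFace.refl _ _)
      intro k hk; simp at hk ⊢; tauto)
    exact hττ (by rw [em, this])

theorem Conflict.stab_slice (h : Conflict M J x t a a' φ y y' σ σ')
    (hB : J.erase t \ {a, a'} = {w₁, w₂}) (hww : w₁ ≠ w₂) (hX : Slice M t a a' w₁ φ y σ c X)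
    (hX' : Slice M t a a' w₁ φ y' σ' c X')
    (hs : Split M (J.erase a) (update y a c) {a', w₂}) :
    ∃ ω, Stab M (J.erase a) (update y a c) (lk a' (φ σ) w₂ ω) := by
  have hM := h.layer.crit.isCode
  have haa := h.ne
  obtain ⟨hta, hta', haJ, haJ', htJ, haL, haL'⟩ := h.toFull.mems
  have hw₁ : w₁ ∈ J.erase t \ {a, a'} := by simp [hB]
  have hw₂ : w₂ ∈ J.erase t \ {a, a'} := by simp [hB]
  obtain ⟨hwt, hwa, hwa', hwJ⟩ := Full.mem_rest hw₁
  obtain ⟨hwt₂, hwa₂, hwa₂', hwJ₂⟩ := Full.mem_rest hw₂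
  have hτ := h.toFull.map_ne_zero h.ne_zero
  have hττ := h.toFull.map_ne h.ne_of
  have hF3 := h.card_triple hw₁
  have hFK := h.triple_subset hw₁
  have hJa : J.erase a = insert w₂ {a', t, w₁} := by
    ext k
    by_cases hk : k ∈ J.erase t \ {a, a'}
    · have hk' := Full.mem_rest hk
      have hk2 := hk
      rw [hB] at hk2
      simp only [Finset.mem_erase, Finset.mem_insert, Finset.mem_singleton] at hk2 ⊢
      tauto
    · have hk' : k ≠ w₁ ∧ k ≠ w₂ :=
        ⟨fun e => hk (e ▸ hw₁), fun e => hk (e ▸ hw₂)⟩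
      simp only [Finset.mem_sdiff, Finset.mem_erase, Finset.mem_insert, Finset.mem_singleton]
        at hk ⊢
      constructor
      · tauto
      · rintro (rfl | rfl | rfl | rfl)
        · exact absurd rfl hk'.2
        · exact ⟨haa.symm, haJ'⟩
        · exact ⟨hta, htJ⟩
        · exact absurd rfl hk'.1
  obtain ⟨η, hη⟩ := h.exists_other_link hB hww hX'
  obtain ⟨Z, hZ, eZ⟩ := exists_class_of_link hM hF3 (by simp) (by simp) hta'.symm hη hτ
  have hZ' : IsClass M {a', t, w₁} (update y' a (c + σ)) X' := by
    refine hX'.isClass.mono ?_ ((InFace.refl _ _).update (by simp) _)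
    intro k hk; simp at hk ⊢; tauto
  have hnr : ¬Red M (J.erase a) (update y a (c + σ)) := by
    rw [hJa]
    refine not_red_of_two_classes hM hF3 (by simp [hwa₂', hwt₂, hww.symm]) ?_ hZ hZ' (i := a')
      (by simp) (by rwa [eZ, hX'.snd]) (hX.unique _ (Or.inr rfl))
    rw [← hJa]
    exact h.inFace_update _
  obtain ⟨Y, hY⟩ :=
    (h.layer.crit.smaller _ (Finset.erase_ssubset haJ) (update y a (c + σ))).resolve_left hnr
  have eY : Y a' = φ σ := by
    rw [← hX.snd]
    exact hX.unique _ (Or.inr rfl) Y (hY.mono hFK (InFace.refl _ _)) a' (by simp)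
  have hl := hY.2 a' (by simp [haa.symm, haJ']) w₂ (by simp [hwa₂, hwJ₂]) hwa₂'.symm
  rw [eY] at hl
  refine ⟨Y w₂, ?_⟩
  have htK : t ∈ J.erase a := hFK (by simp)
  have hface : ∀ e, InFace (J.erase a) (update y a e) (update (update y a e) t (x t)) := fun e =>
    (InFace.refl _ _).update htK _
  have hl1 : Stab M {a', w₁, w₂} (update (update y a (c + σ)) t (x t))
      (lk a' (φ σ) w₂ (Y w₂)) := by
    refine hl.mono ?_ (hface _)
    rw [hJa]
    intro k hk; simp at hk ⊢; tauto
  have hl2 : Stab M {a', w₁, w₂} (update (update y a c) t (x t)) (lk a' (φ σ) w₂ (Y w₂)) := by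
    refine Stab.conj (h.links σ) (I := {a', w₁, w₂}) ?_
      (inFace_update_layer (G := J) htJ (h.inFace.update haJ _)).1 (lk_supp haL haL')
      (lk_supp (by simp) (by simp)) hl1 ?_
    · intro k hk
      simp only [Finset.mem_insert, Finset.mem_singleton] at hk
      rcases hk with rfl | rfl | rfl
      · exact haL'
      · simp [hwt, hwJ]
      · simp [hwt₂, hwJ₂]
    · intro k hk
      simp only [Finset.mem_insert, Finset.mem_singleton, not_or] at hk
      by_cases hka : k = a
      · subst hka; simp [hta.symm, lk_left, V.add_add_cancel]
      · rw [lk_other hka hk.1, add_zero]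
        by_cases hkt : k = t
        · subst hkt; simp
        · simp [hkt, hka]
  have := (hs.mono subset_rfl (hface c)).stab hM (k := w₁) (v := lk a' (φ σ) w₂ (Y w₂)) ?_
    (hFK (by simp)) (by simp [hwa', hww]) (lk_supp (by simp) (by simp))
    (hl2.mono (by intro k hk; simp at hk ⊢; tauto) (InFace.refl _ _))
  · exact this.mono subset_rfl (hface c).symm
  · intro k hk
    simp only [Finset.mem_insert, Finset.mem_singleton] at hk
    rcases hk with rfl | rfl
    · simp [haa.symm, haJ']
    · simp [hwa₂, hwJ₂]

/-- There are no conflicts. -/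
theorem Conflict.false (h : Conflict M J x t a a' φ y y' σ σ') : False := by
  have hM := h.layer.crit.isCode
  have haa := h.ne
  obtain ⟨hta, hta', haJ, haJ', htJ, haL, haL'⟩ := h.toFull.mems
  obtain ⟨w₁, w₂, hww, hB⟩ := Finset.card_eq_two.1
    (le_antisymm h.card_rest_le h.layer.two_le_compl)
  have hw₁ : w₁ ∈ J.erase t \ {a, a'} := by simp [hB]
  have hw₂ : w₂ ∈ J.erase t \ {a, a'} := by simp [hB]
  obtain ⟨hwt, hwa, hwa', hwJ⟩ := Full.mem_rest hw₁
  obtain ⟨hwt₂, hwa₂, hwa₂', hwJ₂⟩ := Full.mem_rest hw₂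
  have hτ := h.toFull.map_ne_zero h.ne_zero
  have hττ := h.toFull.map_ne h.ne_of
  have hF3 := h.card_triple hw₁
  have hFK := h.triple_subset hw₁
  obtain ⟨c, X, X', hX, hX'⟩ := h.exists_common_slice hw₁
  have hXc : IsClass M {a', t, w₁} (update y a c) X := by
    refine hX.isClass.mono ?_ ((InFace.refl _ _).update (by simp) _)
    intro k hk; simp at hk ⊢; tauto
  have hface := h.inFace_update c
  have bad : ∀ (j : ι) (ρ : V), j ∈ ({a', t, w₁} : Finset ι) → a' ≠ j →
      ¬Stab M (J.erase a) (update y a c) (lk a' (φ σ) j ρ) := fun j ρ hj hj' hs =>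
    hX'.not_link hM hF3 (Or.inl rfl) hτ hττ hj hj' (hs.mono hFK hface)
  have ht := hXc.2 a' (by simp) t (by simp) hta'.symm
  have hw := hXc.2 a' (by simp) w₁ (by simp) hwa'.symm
  rw [hX.snd] at ht hw
  have hr := h.red_slice hw₁ hX hX'
  have haK : a' ∈ J.erase a := hFK (by simp)
  have htK : t ∈ J.erase a := hFK (by simp)
  have hwK : w₁ ∈ J.erase a := hFK (by simp)
  have hJa : insert a' ({t, w₁, w₂} : Finset ι) = J.erase a := by
    ext k
    by_cases hk : k ∈ J.erase t \ {a, a'}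
    · have hk' := Full.mem_rest hk
      have hk2 := hk
      rw [hB] at hk2
      simp only [Finset.mem_erase, Finset.mem_insert, Finset.mem_singleton] at hk2 ⊢
      tauto
    · have hk' : k ≠ w₁ ∧ k ≠ w₂ :=
        ⟨fun e => hk (e ▸ hw₁), fun e => hk (e ▸ hw₂)⟩
      simp only [Finset.mem_sdiff, Finset.mem_erase, Finset.mem_insert, Finset.mem_singleton]
        at hk ⊢
      constructor
      · rintro (rfl | rfl | rfl | rfl)
        · exact ⟨haa.symm, haJ'⟩
        · exact ⟨hta, htJ⟩
        · exact absurd rfl hk'.1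
        · exact absurd rfl hk'.2
      · tauto
  rw [← hJa] at hr
  obtain ⟨d, hd, hs⟩ := exists_split_pair (z := update y a c)
    (by simp [hta'.symm, hwa'.symm, hwa₂'.symm]) (InFace.refl _ _)
    (fun hr' => by have := hr'.four_le.trans Finset.card_le_three; omega) hr
  rw [hJa] at hs
  simp only [Finset.mem_insert, Finset.mem_singleton] at hd
  rcases hd with rfl | rfl | rfl
  · refine bad d _ (by simp) hta'.symm (hs.stab hM (k := w₁) ?_ hwK (by simp [hwt, hwa'])
      (lk_supp (by simp) (by simp)) (ht.mono ?_ (InFace.refl _ _)))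
    · intro k hk
      exact hFK (by simp at hk ⊢; tauto)
    · intro k hk; simp at hk ⊢; tauto
  · refine bad d _ (by simp) hwa'.symm (hs.stab hM (k := t) ?_ htK (by simp [hwt.symm, hta'])
      (lk_supp (by simp) (by simp)) (hw.mono ?_ (InFace.refl _ _)))
    · intro k hk
      exact hFK (by simp at hk ⊢; tauto)
    · intro k hk; simp at hk ⊢; tauto
  · obtain ⟨ω, hω⟩ := h.stab_slice hB hww hX hX' hs
    obtain ⟨ω', hω'⟩ := h.symm.stab_slice hB hww hX' hX (hs.mono subset_rfl hface)
    replace hω' := hω'.mono subset_rfl hface.symm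
    have hdK : d ∈ J.erase a := by simp [hwa₂, hwJ₂]
    obtain ⟨π, hπ⟩ := exists_link_to hM hwa₂'.symm haK (k := d) (fun π hπ => by
      rcases V.cases_of_ne _ _ π hτ (h.toFull.map_ne_zero h.ne_zero') hττ with
        rfl | rfl | rfl | rfl
      · exact absurd rfl hπ
      · exact ⟨_, hω⟩
      · exact ⟨_, hω'⟩
      · exact ⟨_, hω.lk_add hω' haK hdK⟩) (y d + y' d)
    refine hX'.not_link hM hF3 (Or.inl rfl) hτ hττ (j := t) (by simp) hta'.symm
      (Stab.conj hπ hFK (InFace.refl _ _) (lk_supp haK hdK) (lk_supp (by simp) (by simp)) ht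
        fun k hk => ?_)
    simp only [Finset.mem_insert, Finset.mem_singleton, not_or] at hk
    by_cases hkd : k = d
    · subst hkd
      rw [lk_right hwa₂'.symm, update_of_ne hwa₂, update_of_ne hwa₂, ← add_assoc, V.add_self,
        zero_add]
    · rw [lk_other hk.1 hkd, add_zero]
      by_cases hka : k = a
      · subst hka; simp
      · rw [update_of_ne hka, update_of_ne hka]
        refine h.inFace' k fun hkB => ?_
        rw [hB] at hkB
        simp [hk, hkd] at hkB

theorem Full.false (h : Full M J x t a a' φ) : False := by
  obtain ⟨y, y', σ, σ', hc⟩ := h.exists_conflict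
  exact hc.false

theorem Critical.false (h : Critical M J x) : False := by
  have hM := h.isCode
  obtain ⟨t, S, y, hy, hL⟩ := h.exists_layer
  obtain ⟨a, a', haa, rfl⟩ := Finset.card_eq_two.1 hL.card_eq_two
  have haL : a ∈ J.erase t := hL.subset (by simp)
  have haL' : a' ∈ J.erase t := hL.subset (by simp)
  obtain ⟨w, hw⟩ : (J.erase t \ {a, a'}).Nonempty :=
    Finset.card_pos.1 (by have := hL.two_le_compl; omega)
  obtain ⟨hwt, hwa, hwa', hwJ⟩ := Full.mem_rest hw
  obtain ⟨Z, hZ⟩ := semi_triple hM hwa hwa' haa (x := y)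
  have hl := hL.stab_layer hw (InFace.refl _ _) (lk_supp (by simp) (by simp))
    (hZ.2 a (by simp) a' (by simp) haa)
  have h0 := hZ.1 a (by simp)
  refine hL.not_strict haa h0 hl fun δ ε hδ hs => ?_
  by_contra hne
  have hall : ∀ δ', ∃ ε', Stab M (J.erase t) y (lk a δ' a' ε') := by
    intro δ'
    rcases V.cases_of_ne δ (Z a) δ' hδ h0 hne with rfl | rfl | rfl | rfl
    · refine ⟨0, fun p _ hp => ?_⟩
      have : (lk a 0 a' 0 : ι → V) = 0 := by ext1 k; simp [lk]
      simpa [this] using hp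
    · exact ⟨_, hs⟩
    · exact ⟨_, hl⟩
    · exact ⟨_, hs.lk_add hl haL haL'⟩
  choose φ hφ using hall
  exact Full.false ⟨hL, haa, hφ⟩

/-- Every face of a code is reducible or semilinear. -/
theorem red_or_semi (hM : IsCode M) (J : Finset ι) (x : ι → V) : Red M J x ∨ Semi M J x := by
  induction J using Finset.strongInduction generalizing x with
  | H J ih =>
  obtain h | h | h : J.card ≤ 3 ∨ J.card = 4 ∨ 5 ≤ J.card := by omega
  · exact Or.inr (semi_of_card_le_three hM h)
  · exact red_or_semi_of_card_four hM h
  · by_contra! hcon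
    exact Critical.false ⟨hM, h, hcon.1, hcon.2, ih⟩

end TwoRest

/-! ### Quasigroups as codes -/

section Quasigroups

variable {n : ℕ} {S T : Type*}

theorem _root_.IsNQuasigroup.conj {f : (Fin n → S) → S} (hf : IsNQuasigroup f) (α : S ≃ T)
    (β : Fin n → T ≃ S) : IsNQuasigroup fun x : Fin n → T => α (f fun i => β i (x i)) := by
  intro i x
  have : (fun a => α (f fun j => β j (update x i a j))) =
      α ∘ (fun b => f (update (fun j => β j (x j)) i b)) ∘ β i := by
    ext1 a
    simp only [comp_apply]
    congr 2
    ext1 j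
    by_cases hj : j = i
    · subst hj; simp
    · simp [hj]
  rw [this]
  exact α.bijective.comp ((hf i _).comp (β i).bijective)

theorem _root_.PermutablyReducible.of_conj {f : (Fin n → S) → S} (E : S ≃ T)
    (h : PermutablyReducible fun x : Fin n → T => E (f fun i => E.symm (x i))) :
    PermutablyReducible f := by
  obtain ⟨m, h2, hm, σ, g, k, hg, hk, H⟩ := h
  refine ⟨m, h2, hm, σ, _, _, hg.conj E.symm fun _ => E, hk.conj E.symm fun _ => E, fun x => ?_⟩
  have := H fun i => E (x i)
  simp only [Equiv.symm_apply_apply] at this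
  rw [Equiv.eq_symm_apply, this]
  congr 1
  ext1 j
  refine Fin.cases ?_ (fun j => ?_) j <;> simp

/-- The graph of an `n`-ary operation. -/
def graph (f : (Fin n → V) → V) : Set (Fin (n + 1) → V) := {x | x 0 = f (Fin.tail x)}

theorem cons_mem_graph {f : (Fin n → V) → V} {a : V} {x : Fin n → V} :
    (Fin.cons a x : Fin (n + 1) → V) ∈ graph f ↔ a = f x := Iff.rfl

theorem isCode_graph {f : (Fin n → V) → V} (hf : IsNQuasigroup f) : IsCode (graph f) := by
  intro x i
  refine Fin.cases ?_ (fun i => ?_) i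
  · refine ⟨f (Fin.tail x), ?_, fun a ha => ?_⟩
    · simp [graph, Fin.tail_update_zero]
    · simpa [graph, Fin.tail_update_zero] using ha
  · have h0 : ∀ a, update x i.succ a 0 = x 0 := fun a => update_of_ne (Fin.succ_ne_zero i).symm _ _
    obtain ⟨a, ha, huniq⟩ := (hf i (Fin.tail x)).existsUnique (x 0)
    refine ⟨a, ?_, fun b hb => huniq b ?_⟩
    · simp only [graph, Set.mem_ofPred_eq, h0, Fin.tail_update_succ]
      exact ha.symm
    · simp only [graph, Set.mem_ofPred_eq, h0, Fin.tail_update_succ] at hb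
      exact hb.symm

theorem exists_perm_mem_iff (A : Finset (Fin n)) :
    ∃ σ : Equiv.Perm (Fin n), ∀ i, σ i ∈ A ↔ i.val < A.card := by
  have hA : A.card ≤ n := by simpa using Finset.card_le_univ A
  have hc : Fintype.card {i : Fin n // i.val < A.card} = Fintype.card {i // i ∈ A} := by
    rw [Fintype.card_subtype, Fintype.card_coe, Fin.card_filter_val_lt, min_eq_right hA]
  let e := Fintype.equivOfCardEq hc
  refine ⟨e.extendSubtype, fun i => ⟨fun h => ?_, e.extendSubtype_mem i⟩⟩
  by_contra hi
  exact e.extendSubtype_not_mem i hi h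

/-- The point with the given coordinates at the first `m` places and at the other places, in the
order prescribed by `σ`. -/
def combine {m : ℕ} (σ : Equiv.Perm (Fin n)) (u : Fin m → S) (v : Fin (n - m) → S) : Fin n → S :=
  fun i => if h : (σ.symm i).val < m then u ⟨(σ.symm i).val, h⟩
    else v ⟨(σ.symm i).val - m, by omega⟩

theorem combine_restrict {m : ℕ} (hm : m ≤ n) (σ : Equiv.Perm (Fin n)) (x : Fin n → S) :
    combine σ (fun k : Fin m => x (σ ⟨k.val, by omega⟩))
      (fun j : Fin (n - m) => x (σ ⟨m + j.val, by omega⟩)) = x := by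
  ext1 i
  unfold combine
  split_ifs with h
  · simp
  · have : (⟨m + ((σ.symm i).val - m), by omega⟩ : Fin n) = σ.symm i := by
      ext; simp only; omega
    simp [this]

theorem combine_update_left {m : ℕ} (hm : m ≤ n) (σ : Equiv.Perm (Fin n)) (u : Fin m → S)
    (v : Fin (n - m) → S) (i : Fin m) (a : S) :
    combine σ (update u i a) v = update (combine σ u v) (σ ⟨i.val, by omega⟩) a := by
  ext1 k
  by_cases hk : k = σ ⟨i.val, by omega⟩
  · subst hk; simp [combine]
  · have hk' : (σ.symm k).val ≠ i.val := fun h => hk (by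
      rw [← Equiv.symm_apply_eq]; exact Fin.ext h)
    rw [update_of_ne hk]
    unfold combine
    split_ifs with h
    · rw [update_of_ne (fun e => hk' (congrArg Fin.val e))]
    · rfl

theorem combine_update_right {m : ℕ} (hm : m ≤ n) (σ : Equiv.Perm (Fin n)) (u : Fin m → S)
    (v : Fin (n - m) → S) (j : Fin (n - m)) (a : S) :
    combine σ u (update v j a) = update (combine σ u v) (σ ⟨m + j.val, by omega⟩) a := by
  ext1 k
  by_cases hk : k = σ ⟨m + j.val, by omega⟩
  · subst hk; simp [combine]
  · have hk' : (σ.symm k).val ≠ m + j.val := fun h => hk (by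
      rw [← Equiv.symm_apply_eq]; exact Fin.ext h)
    rw [update_of_ne hk]
    unfold combine
    split_ifs with h
    · rfl
    · rw [update_of_ne (fun e => hk' (by have := congrArg Fin.val e; simp only at this; omega))]

/-- A quasigroup whose dependence on the first `m` arguments factors through one value is
reducible. -/
theorem permutablyReducible_of_indep {f : (Fin n → V) → V} (hf : IsNQuasigroup f) {m : ℕ}
    (h2 : 2 ≤ m) (hm : m ≤ n - 1) (σ : Equiv.Perm (Fin n))
    (H : ∀ (u u' : Fin m → V) (v v' : Fin (n - m) → V),
      f (combine σ u v) = f (combine σ u' v) → f (combine σ u v') = f (combine σ u' v')) :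
    PermutablyReducible f := by
  have hmn : m ≤ n := by omega
  set g : (Fin m → V) → V := fun u => f (combine σ u 0) with hg
  have hgq : IsNQuasigroup g := by
    intro i u
    simp only [hg, combine_update_left hmn]
    exact hf _ _
  set i₀ : Fin m := ⟨0, by omega⟩
  set r := Equiv.ofBijective _ (hgq i₀ 0) with hr
  refine ⟨m, h2, hm, σ, g, fun w => f (combine σ (update 0 i₀ (r.symm (w 0))) (Fin.tail w)),
    hgq, ?_, fun x => ?_⟩
  · intro i w
    refine Fin.cases ?_ (fun i => ?_) i
    · simp only [update_self, Fin.tail_update_zero, combine_update_left hmn]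
      exact (hf _ _).comp r.symm.bijective
    · have h0 : ∀ a, update w i.succ a 0 = w 0 :=
        fun a => update_of_ne (Fin.succ_ne_zero i).symm _ _
      simp only [h0, Fin.tail_update_succ, combine_update_right hmn]
      exact hf _ _
  · simp only [Fin.cons_zero, Fin.tail_cons]
    conv_lhs => rw [← combine_restrict hmn σ x]
    refine H _ _ 0 _ ?_
    exact (r.apply_symm_apply _).symm

theorem permutablyReducible_of_red {f : (Fin n → V) → V} (hf : IsNQuasigroup f)
    {x : Fin (n + 1) → V} (h : Red (graph f) Finset.univ x) : PermutablyReducible f := by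
  obtain ⟨A, h0, h2, h3, hs⟩ : ∃ A : Finset (Fin (n + 1)), 0 ∉ A ∧ 2 ≤ A.card ∧
      2 ≤ (Finset.univ \ A).card ∧ Split (graph f) Finset.univ x A := by
    obtain ⟨A, hA, h2, h3, hs⟩ := h
    by_cases h0 : 0 ∈ A
    · exact ⟨Finset.univ \ A, by simp [h0], h3, by rwa [Finset.sdiff_sdiff_eq_self hA], hs.compl⟩
    · exact ⟨A, h0, h2, h3, hs⟩
  set A' : Finset (Fin n) := Finset.univ.filter fun i => i.succ ∈ A with hA'
  have hAA : A = A'.map (Fin.succEmb n) := by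
    ext i
    refine Fin.cases ?_ (fun i => ?_) i
    · simp [h0]
    · simp [hA']
  have hcard : A.card = A'.card := by rw [hAA, Finset.card_map]
  have hle := Finset.card_sdiff_add_card_eq_card (Finset.subset_univ A)
  rw [Finset.card_univ, Fintype.card_fin] at hle
  obtain ⟨σ, hσ⟩ := exists_perm_mem_iff A'
  have hmem : ∀ i : Fin n, i.succ ∈ A ↔ (σ.symm i).val < A'.card := by
    intro i
    rw [← hσ, Equiv.apply_symm_apply]
    simp [hA']
  refine permutablyReducible_of_indep (m := A'.card) hf (by omega) (by omega) σ fun u u' v v' huv => ?_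
  have key : ∀ [∀ i, Decidable (i ∈ A)] (b b' : V) (u u' : Fin A'.card → V) (v v' : Fin (n - A'.card) → V),
      A.piecewise (Fin.cons b (combine σ u v) : Fin (n + 1) → V)
        (Fin.cons b' (combine σ u' v')) = Fin.cons b' (combine σ u v') := by
    intro _ b b' u u' v v'
    ext1 i
    refine Fin.cases ?_ (fun i => ?_) i
    · simp [h0]
    · by_cases hi : i.succ ∈ A
      · simp [hi, combine, (hmem i).1 hi]
      · have : ¬(σ.symm i).val < A'.card := fun h => hi ((hmem i).2 h)
        simp [hi, combine, this]
  have := hs (Fin.cons (f (combine σ u v)) (combine σ u v))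
    (Fin.cons (f (combine σ u v')) (combine σ u' v')) (by intro i hi; simp at hi)
    (by intro i hi; simp at hi)
  rw [key, key] at this
  simpa only [cons_mem_graph] using this rfl huv rfl

set_option synthInstance.maxSize 4000 in
/-- The pairs `{u, u + π}` are the fibres of `lmap` under a suitable numbering of the alphabet. -/
theorem exists_equiv_lmap {π : V} (hπ : π ≠ 0) : ∃ τ : V ≃ Fin 4, ∀ u v,
    lmap (τ u) = lmap (τ v) ↔ v = u ∨ v = u + π := by
  obtain ⟨ρ, hρ0, hρ⟩ : ∃ ρ : V, ρ ≠ 0 ∧ ρ ≠ π := by revert π; decide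
  have hb : Bijective (![0, π, ρ, π + ρ] : Fin 4 → V) := by
    revert π ρ; decide
  refine ⟨(Equiv.ofBijective _ hb).symm, fun u v => ?_⟩
  obtain ⟨i, rfl⟩ := hb.2 u
  obtain ⟨j, rfl⟩ := hb.2 v
  have e : ∀ i, (Equiv.ofBijective _ hb).symm (![0, π, ρ, π + ρ] i) = i :=
    Equiv.ofBijective_symm_apply_apply _ hb
  rw [e, e]
  clear e hb
  revert π ρ i j
  decide

theorem exists_perm_lmap (d : ZMod 2) : ∃ ρ : Equiv.Perm (Fin 4), ∀ a, lmap (ρ a) = lmap a + d := by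
  fin_cases d
  · exact ⟨1, by decide⟩
  · exact ⟨Equiv.swap 0 2 * Equiv.swap 1 3, by decide⟩

theorem semilinear_of_semi {f : (Fin n → Fin 4) → Fin 4} (hf : IsNQuasigroup f) (E : Fin 4 ≃ V)
    {x₀ : Fin (n + 1) → V}
    (h : Semi (graph fun x => E (f fun i => E.symm (x i))) Finset.univ x₀) : Semilinear f := by
  set F : (Fin n → V) → V := fun x => E (f fun i => E.symm (x i)) with hF
  have hFq : IsNQuasigroup F := hf.conj E fun _ => E.symm
  obtain ⟨X, hX0, hX⟩ := h
  choose τ hτ using fun i => exists_equiv_lmap (hX0 i (Finset.mem_univ i))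
  have shift : ∀ x i, F (update x i (x i + X i.succ)) = F x + X 0 := by
    intro x i
    have h1 := hX 0 (Finset.mem_univ _) i.succ (Finset.mem_univ _) (Fin.succ_ne_zero i).symm
      (Fin.cons (F x) x) (by intro j hj; simp at hj) rfl
    have h2 : (Fin.cons (F x) x + lk 0 (X 0) i.succ (X i.succ) : Fin (n + 1) → V) =
        Fin.cons (F x + X 0) (update x i (x i + X i.succ)) := by
      ext1 j
      refine Fin.cases ?_ (fun j => ?_) j
      · simp [lk_left]
      · by_cases hj : j = i
        · subst hj
          simp [lk_right (Fin.succ_ne_zero j).symm]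
        · have : j.succ ≠ i.succ := fun e => hj (Fin.succ_injective _ e)
          simp [lk_other (Fin.succ_ne_zero j) this, hj]
    rw [h2, cons_mem_graph] at h1
    exact h1.symm
  have two : ∀ p q r s : ZMod 2, p ≠ q → r ≠ s → p + r = q + s := by decide
  set D : (Fin n → V) → ZMod 2 := fun x =>
    lmap (τ 0 (F x)) + ∑ i, lmap (τ i.succ (x i)) with hD
  have step : ∀ x i v, D (update x i v) = D x := by
    intro x i v
    have hsum : ∀ y : Fin n → V, ∑ j, lmap (τ j.succ (y j)) =
        lmap (τ i.succ (y i)) + ∑ j ∈ Finset.univ.erase i, lmap (τ j.succ (y j)) :=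
      fun y => (Finset.add_sum_erase _ _ (Finset.mem_univ i)).symm
    have hrest : ∑ j ∈ Finset.univ.erase i, lmap (τ j.succ (update x i v j)) =
        ∑ j ∈ Finset.univ.erase i, lmap (τ j.succ (x j)) :=
      Finset.sum_congr rfl fun j hj => by rw [update_of_ne (Finset.ne_of_mem_erase hj)]
    simp only [hD]
    rw [hsum, hsum x, hrest, ← add_assoc, ← add_assoc, update_self]
    congr 1
    have inj := (hFq i x).1
    by_cases hv : lmap (τ i.succ (x i)) = lmap (τ i.succ v)
    · rw [hv]
      congr 1
      refine ((hτ 0 _ _).2 ?_).symm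
      rcases (hτ _ _ _).1 hv with rfl | rfl
      · left; rw [update_eq_self]
      · right; exact shift x i
    · refine two _ _ _ _ (fun e => hv ((hτ _ _ _).2 ?_)) (Ne.symm hv)
      rcases (hτ _ _ _).1 e.symm with e | e
      · left
        refine inj ?_
        simpa using e
      · right
        rw [← shift x i] at e
        exact inj e
  have const : ∀ x, D x = D 0 := fun x =>
    eq_of_forall_update (x := 0) (Finset.Subset.refl Finset.univ) (fun y _ i _ v => step y i v)
      (InFace.refl _ _) (by intro i hi; simp at hi)
  obtain ⟨ρ, hρ⟩ := exists_perm_lmap (D 0)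
  set τ₀ : Equiv.Perm (Fin 4) := (E.trans (τ 0)).trans ρ
  set τ' : Fin n → Equiv.Perm (Fin 4) := fun i => E.trans (τ i.succ)
  refine ⟨fun y => τ₀ (f fun i => (τ' i).symm (y i)), τ₀, τ', hf.conj τ₀ fun i => (τ' i).symm,
    fun y => ?_, fun x => by simp⟩
  have hy := const fun i => E ((τ' i).symm (y i))
  simp only [hD, hF, Equiv.symm_apply_apply] at hy
  have e : ∀ i, τ i.succ (E ((τ' i).symm (y i))) = y i := fun i => (τ' i).apply_symm_apply (y i)
  simp only [e] at hy
  have char : ∀ p q r : ZMod 2, p + q = r → p + r = q := by decide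
  change lmap (ρ (τ 0 (E (f fun i => (τ' i).symm (y i))))) = _
  rw [hρ]
  exact char _ _ _ hy

end Quasigroups

end OrderFour

/-- Theorem 2.1: every `n`-quasigroup of order 4 is permutably
reducible or semilinear. -/
theorem stmt3 (n : ℕ) (f : (Fin n → Fin 4) → Fin 4) (hf : IsNQuasigroup f) :
    PermutablyReducible f ∨ Semilinear f := by
  let E : Fin 4 ≃ OrderFour.V := Fintype.equivOfCardEq (by decide)
  have hF := hf.conj E fun _ => E.symm
  rcases OrderFour.red_or_semi (OrderFour.isCode_graph hF) Finset.univ 0 with h | h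
  · exact Or.inl (PermutablyReducible.of_conj E (OrderFour.permutablyReducible_of_red hF h))
  · exact Or.inr (OrderFour.semilinear_of_semi hf E h)
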